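/- arXiv:2002.02731 — 4 statements merged into one kernel-verified Lean document; each statement's English description precedes it below -/
import Mathlib

section
/- Let F₅(N) denote the number of integers n with 2^{N−1} ≤ n < 2^N such that s_2(5n) < s_2(n) (the 5-flimsy numbers with N bits), and let c = 3√5/(8√π). Then F₅(N) = 2^N·(1/4 − c·N^{−1/2} + O(N^{−3/2})); that is, there exists a constant C > 0 such that for all integers N ≥ 1, |F₅(N) − 2^N·(1/4 − c·N^{−1/2})| ≤ C·2^N·N^{−3/2}. -/
open Finset Real

/-- The number of `m` with `n + 1` binary digits such that `s_2(5m + c) + d < s_2(m)`. -/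
def flimsyCount (c n : ℕ) (d : ℤ) : ℕ :=
  #{m ∈ Ico (2 ^ n) (2 ^ (n + 1)) |
    ((Nat.digits 2 (5 * m + c)).sum : ℤ) + d < ((Nat.digits 2 m).sum : ℤ)}

theorem sum_digits_two_mul (m : ℕ) :
    (Nat.digits 2 (2 * m)).sum = (Nat.digits 2 m).sum := by
  rcases Nat.eq_zero_or_pos m with rfl | hm
  · simp
  · rw [Nat.digits_def' (by norm_num) (by lia)]
    simp

theorem sum_digits_two_mul_add_one (m : ℕ) :
    (Nat.digits 2 (2 * m + 1)).sum = (Nat.digits 2 m).sum + 1 := by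
  rw [Nat.digits_def' (by norm_num) (by lia)]
  have h1 : (2 * m + 1) % 2 = 1 := by lia
  have h2 : (2 * m + 1) / 2 = m := by lia
  rw [h1, h2, List.sum_cons, add_comm]

theorem sum_Ico_two_mul (f : ℕ → ℕ) (a k : ℕ) :
    ∑ m ∈ Ico (2 * a) (2 * (a + k)), f m = ∑ m ∈ Ico a (a + k), (f (2 * m) + f (2 * m + 1)) := by
  induction k with
  | zero => simp
  | succ k ih =>
    rw [← add_assoc, Finset.sum_Ico_succ_top (by lia), ← ih,
      show 2 * (a + k + 1) = 2 * (a + k) + 1 + 1 by ring,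
      Finset.sum_Ico_succ_top (by lia), Finset.sum_Ico_succ_top (by lia)]
    ring

theorem flimsyCount_succ {c c₀ c₁ : ℕ} {r₀ r₁ : ℕ} (n : ℕ) {d d₀ d₁ : ℤ}
    (h₀ : c = 2 * c₀ + r₀) (hr₀ : r₀ < 2) (h₁ : 5 + c = 2 * c₁ + r₁) (hr₁ : r₁ < 2)
    (hd₀ : d₀ = d + r₀) (hd₁ : d₁ = d + r₁ - 1) :
    flimsyCount c (n + 1) d = flimsyCount c₀ n d₀ + flimsyCount c₁ n d₁ := by
  have key : ∀ k r, r < 2 → (Nat.digits 2 (2 * k + r)).sum = (Nat.digits 2 k).sum + r := by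
    intro k r hr
    interval_cases r
    · simpa using sum_digits_two_mul k
    · exact sum_digits_two_mul_add_one k
  simp only [flimsyCount, Finset.card_filter]
  rw [show 2 ^ (n + 1) = 2 * 2 ^ n by ring, show 2 ^ (n + 1 + 1) = 2 * (2 ^ n + 2 ^ n) by ring,
    sum_Ico_two_mul, ← Finset.sum_add_distrib, two_mul]
  refine Finset.sum_congr rfl fun m _ => ?_
  rw [show 5 * (2 * m) + c = 2 * (5 * m + c₀) + r₀ by lia,
    show 5 * (2 * m + 1) + c = 2 * (5 * m + c₁) + r₁ by lia, key _ _ hr₀, key _ _ hr₁,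
    sum_digits_two_mul, sum_digits_two_mul_add_one]
  congr 1 <;> refine if_congr ?_ rfl rfl <;> push_cast <;> lia

theorem flimsyCount_zero_succ (n : ℕ) (d : ℤ) :
    flimsyCount 0 (n + 1) d = flimsyCount 0 n d + flimsyCount 2 n d :=
  flimsyCount_succ (r₀ := 0) (r₁ := 1) n (by simp) (by simp) (by simp) (by simp)
    (by simp) (by simp)

theorem flimsyCount_one_succ (n : ℕ) (d : ℤ) :
    flimsyCount 1 (n + 1) d = flimsyCount 0 n (d + 1) + flimsyCount 3 n (d - 1) :=
  flimsyCount_succ (r₀ := 1) (r₁ := 0) n (by simp) (by simp) (by simp) (by simp)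
    (by simp) (by simp)

theorem flimsyCount_two_succ (n : ℕ) (d : ℤ) :
    flimsyCount 2 (n + 1) d = flimsyCount 1 n d + flimsyCount 3 n d :=
  flimsyCount_succ (r₀ := 0) (r₁ := 1) n (by simp) (by simp) (by simp) (by simp)
    (by simp) (by simp)

theorem flimsyCount_three_succ (n : ℕ) (d : ℤ) :
    flimsyCount 3 (n + 1) d = flimsyCount 1 n (d + 1) + flimsyCount 4 n (d - 1) :=
  flimsyCount_succ (r₀ := 1) (r₁ := 0) n (by simp) (by simp) (by simp) (by simp)
    (by simp) (by simp)

theorem flimsyCount_four_succ (n : ℕ) (d : ℤ) :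
    flimsyCount 4 (n + 1) d = flimsyCount 2 n d + flimsyCount 4 n d :=
  flimsyCount_succ (r₀ := 0) (r₁ := 1) n (by simp) (by simp) (by simp) (by simp)
    (by simp) (by simp)

theorem flimsyCount_two_recurrence (n : ℕ) (d : ℤ) :
    flimsyCount 2 (n + 4) d + flimsyCount 2 (n + 1) d =
      flimsyCount 2 (n + 3) d + flimsyCount 2 (n + 2) d +
        (flimsyCount 2 (n + 1) (d + 1) + flimsyCount 2 (n + 1) (d - 1)) +
        (flimsyCount 2 n (d + 2) + flimsyCount 2 n (d - 2)) := by
  simp only [flimsyCount_zero_succ, flimsyCount_one_succ, flimsyCount_two_succ,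
    flimsyCount_three_succ, flimsyCount_four_succ, add_sub_cancel_right, sub_add_cancel,
    show d + 1 + 1 = d + 2 by ring, show d - 1 - 1 = d - 2 by ring]
  ring

theorem flimsyCount_base (c : ℕ) (d : ℤ) :
    flimsyCount c 0 d = if ((Nat.digits 2 (5 + c)).sum : ℤ) + d < 1 then 1 else 0 := by
  rw [flimsyCount, Finset.card_filter, show Ico (2 ^ 0) (2 ^ (0 + 1)) = {1} from rfl,
    Finset.sum_singleton]
  simp

/-- The number of `m` counted by neither `flimsyCount 2 n d` nor `flimsyCount 2 n (-d)`
(negative if there is an overlap). -/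
def centralCount (n : ℕ) (d : ℤ) : ℝ :=
  2 ^ n - flimsyCount 2 n d - flimsyCount 2 n (-d)

theorem centralCount_recurrence (n : ℕ) (d : ℤ) :
    centralCount (n + 4) d = centralCount (n + 3) d + centralCount (n + 2) d -
      centralCount (n + 1) d + (centralCount (n + 1) (d + 1) + centralCount (n + 1) (d - 1)) +
        (centralCount n (d + 2) + centralCount n (d - 2)) := by
  have h₁ := congrArg (Nat.cast (R := ℝ)) (flimsyCount_two_recurrence n d)
  have h₂ := congrArg (Nat.cast (R := ℝ)) (flimsyCount_two_recurrence n (-d))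
  push_cast at h₁ h₂
  simp only [centralCount, neg_add, neg_sub', sub_neg_eq_add, ← sub_eq_add_neg]
  simp only [pow_add]
  linarith

theorem centralCount_zero (d : ℤ) :
    centralCount 0 d = if |d| ≤ 2 then 1 else 0 := by
  simp only [centralCount, flimsyCount_base]
  norm_num
  grind

theorem centralCount_one (d : ℤ) :
    centralCount 1 d = (if |d| ≤ 0 then 1 else 0) + (if |d| ≤ 1 then 1 else 0) := by
  simp only [centralCount, flimsyCount_two_succ, flimsyCount_base]
  norm_num
  grind

theorem centralCount_two (d : ℤ) :
    centralCount 2 d = 2 * (if |d| ≤ 2 then 1 else 0) := by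
  simp only [centralCount, flimsyCount_two_succ, flimsyCount_one_succ, flimsyCount_three_succ,
    flimsyCount_base]
  norm_num
  grind

theorem centralCount_three (d : ℤ) :
    centralCount 3 d = (if |d| ≤ 0 then 1 else 0) + 2 * (if |d| ≤ 1 then 1 else 0) +
      (if |d| ≤ 2 then 1 else 0) + 2 * (if |d| ≤ 3 then 1 else 0) := by
  simp only [centralCount, flimsyCount_two_succ, flimsyCount_one_succ, flimsyCount_three_succ,
    flimsyCount_zero_succ, flimsyCount_four_succ, flimsyCount_base]
  norm_num
  grind

/-- The cosine coefficient of index `d` of `f`, up to normalisation. -/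
noncomputable def cosCoeff (f : ℝ → ℝ) (d : ℤ) : ℝ :=
  ∫ θ in (0 : ℝ)..π, f θ * cos (d * θ)

theorem cosCoeff_one (d : ℤ) : cosCoeff (fun _ => 1) d = if d = 0 then π else 0 := by
  split_ifs with hd
  · simp [cosCoeff, hd]
  · have hd' : (d : ℝ) ≠ 0 := mod_cast hd
    simp [cosCoeff, intervalIntegral.integral_comp_mul_left (fun x => cos x) hd',
      Real.sin_int_mul_pi]

theorem cosCoeff_add {f g : ℝ → ℝ} (hf : Continuous f) (hg : Continuous g) (d : ℤ) :
    cosCoeff (fun θ => f θ + g θ) d = cosCoeff f d + cosCoeff g d := by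
  simp only [cosCoeff, add_mul]
  exact intervalIntegral.integral_add (Continuous.intervalIntegrable (by fun_prop) _ _)
    (Continuous.intervalIntegrable (by fun_prop) _ _)

theorem cosCoeff_const_mul (a : ℝ) (f : ℝ → ℝ) (d : ℤ) :
    cosCoeff (fun θ => a * f θ) d = a * cosCoeff f d := by
  simp only [cosCoeff, mul_assoc]
  exact intervalIntegral.integral_const_mul _ _

theorem cosCoeff_two_cos_mul {f : ℝ → ℝ} (hf : Continuous f) (d : ℤ) :
    cosCoeff (fun θ => 2 * cos θ * f θ) d = cosCoeff f (d + 1) + cosCoeff f (d - 1) := by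
  simp only [cosCoeff]
  rw [← intervalIntegral.integral_add (Continuous.intervalIntegrable (by fun_prop) _ _)
    (Continuous.intervalIntegrable (by fun_prop) _ _)]
  refine intervalIntegral.integral_congr fun θ _ => ?_
  simp only [Int.cast_add, Int.cast_sub, Int.cast_one, add_mul, sub_mul, one_mul, cos_add, cos_sub]
  ring

theorem cosCoeff_two_cos_sq_mul {f : ℝ → ℝ} (hf : Continuous f) (d : ℤ) :
    cosCoeff (fun θ => (2 * cos θ) ^ 2 * f θ) d =
      cosCoeff f (d + 2) + 2 * cosCoeff f d + cosCoeff f (d - 2) := by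
  simp only [sq, mul_assoc (2 * cos _) (2 * cos _)]
  rw [cosCoeff_two_cos_mul (f := fun θ => 2 * cos θ * f θ) (by fun_prop), cosCoeff_two_cos_mul hf,
    cosCoeff_two_cos_mul hf, show d + 1 + 1 = d + 2 by ring, show d - 1 - 1 = d - 2 by ring,
    add_sub_cancel_right, sub_add_cancel]
  ring

theorem cosCoeff_cubic {f : ℝ → ℝ} (α β γ δ : ℝ) (hf : ∀ θ, f θ =
      α + β * (2 * cos θ) + γ * (2 * cos θ) ^ 2 + δ * (2 * cos θ) ^ 3) (d : ℤ) :
    cosCoeff f d =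
      (α + 2 * γ) * (if d = 0 then π else 0) +
      (β + 3 * δ) * ((if d = -1 then π else 0) + (if d = 1 then π else 0)) +
      γ * ((if d = -2 then π else 0) + (if d = 2 then π else 0)) +
      δ * ((if d = -3 then π else 0) + (if d = 3 then π else 0)) := by
  obtain rfl := funext hf
  have h₁ (d : ℤ) : cosCoeff (fun θ => 2 * cos θ) d =
      (if d = -1 then π else 0) + (if d = 1 then π else 0) := by
    simpa [cosCoeff_one, sub_eq_zero, add_eq_zero_iff_eq_neg] using
      cosCoeff_two_cos_mul (f := fun _ => 1) (by fun_prop) d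
  have h₂ : cosCoeff (fun θ => (2 * cos θ) ^ 2) d =
      (if d = -2 then π else 0) + 2 * (if d = 0 then π else 0) + (if d = 2 then π else 0) := by
    simpa [cosCoeff_one, sub_eq_zero, add_eq_zero_iff_eq_neg] using
      cosCoeff_two_cos_sq_mul (f := fun _ => 1) (by fun_prop) d
  have h₃ : cosCoeff (fun θ => (2 * cos θ) ^ 3) d =
      (if d = -3 then π else 0) + (if d = 3 then π else 0) +
        3 * ((if d = -1 then π else 0) + (if d = 1 then π else 0)) := by
    have := cosCoeff_two_cos_sq_mul (f := fun θ => 2 * cos θ) (by fun_prop) d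
    simp only [← pow_succ, h₁] at this
    rw [this]
    simp only [show d + 2 = -1 ↔ d = -3 by lia, show d + 2 = 1 ↔ d = -1 by lia,
      show d - 2 = -1 ↔ d = 1 by lia, show d - 2 = 1 ↔ d = 3 by lia]
    ring
  have h₀ := cosCoeff_const_mul α (fun _ => 1) d
  simp only [mul_one] at h₀
  rw [cosCoeff_add (by fun_prop) (by fun_prop), cosCoeff_add (by fun_prop) (by fun_prop),
    cosCoeff_add (by fun_prop) (by fun_prop), cosCoeff_const_mul β fun θ => 2 * cos θ,
    cosCoeff_const_mul γ, cosCoeff_const_mul δ fun θ => (2 * cos θ) ^ 3, h₀, h₁, h₂, h₃, cosCoeff_one]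
  ring

/-- The cosine transform of `centralCount n`, divided by `2 ^ n`, as a polynomial in
`t = 2 cos θ`. -/
noncomputable def centralSymbol (t : ℝ) : ℕ → ℝ
  | 0 => t ^ 2 + t - 1
  | 1 => (t + 2) / 2
  | 2 => (t ^ 2 + t - 1) / 2
  | 3 => (2 * t ^ 3 + 3 * t ^ 2 - t) / 8
  | n + 4 => centralSymbol t (n + 3) / 2 + centralSymbol t (n + 2) / 4 +
      (t - 1) / 8 * centralSymbol t (n + 1) + (t ^ 2 - 2) / 16 * centralSymbol t n

theorem continuous_centralSymbol (n : ℕ) : Continuous fun t => centralSymbol t n := by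
  induction n using Nat.strong_induction_on with
  | _ n ih =>
    match n with
    | 0 => unfold centralSymbol; fun_prop
    | 1 => unfold centralSymbol; fun_prop
    | 2 => unfold centralSymbol; fun_prop
    | 3 => unfold centralSymbol; fun_prop
    | n + 4 =>
      have h₀ := ih n (by lia)
      have h₁ := ih (n + 1) (by lia)
      have h₂ := ih (n + 2) (by lia)
      have h₃ := ih (n + 3) (by lia)
      unfold centralSymbol
      fun_prop

theorem continuous_centralSymbol_two_cos (n : ℕ) :
    Continuous fun θ : ℝ => centralSymbol (2 * cos θ) n :=
  (continuous_centralSymbol n).comp (by fun_prop)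

theorem cosCoeff_centralSymbol_recurrence (n : ℕ) (d : ℤ) :
    cosCoeff (fun θ => centralSymbol (2 * cos θ) (n + 4)) d =
      cosCoeff (fun θ => centralSymbol (2 * cos θ) (n + 3)) d / 2 +
      cosCoeff (fun θ => centralSymbol (2 * cos θ) (n + 2)) d / 4 +
      (cosCoeff (fun θ => centralSymbol (2 * cos θ) (n + 1)) (d + 1) +
        cosCoeff (fun θ => centralSymbol (2 * cos θ) (n + 1)) (d - 1) -
        cosCoeff (fun θ => centralSymbol (2 * cos θ) (n + 1)) d) / 8 +
      (cosCoeff (fun θ => centralSymbol (2 * cos θ) n) (d + 2) +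
        cosCoeff (fun θ => centralSymbol (2 * cos θ) n) (d - 2)) / 16 := by
  have c₀ := continuous_centralSymbol_two_cos n
  have c₁ := continuous_centralSymbol_two_cos (n + 1)
  have c₂ := continuous_centralSymbol_two_cos (n + 2)
  have c₃ := continuous_centralSymbol_two_cos (n + 3)
  have key : (fun θ : ℝ => centralSymbol (2 * cos θ) (n + 4)) = fun θ =>
      1 / 2 * centralSymbol (2 * cos θ) (n + 3) + 1 / 4 * centralSymbol (2 * cos θ) (n + 2) +
      1 / 8 * (2 * cos θ * centralSymbol (2 * cos θ) (n + 1)) +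
      -1 / 8 * centralSymbol (2 * cos θ) (n + 1) +
      1 / 16 * ((2 * cos θ) ^ 2 * centralSymbol (2 * cos θ) n) +
      -1 / 8 * centralSymbol (2 * cos θ) n := by
    funext θ
    rw [centralSymbol]
    ring
  rw [key, cosCoeff_add (by fun_prop) (by fun_prop), cosCoeff_add (by fun_prop) (by fun_prop),
    cosCoeff_add (by fun_prop) (by fun_prop), cosCoeff_add (by fun_prop) (by fun_prop),
    cosCoeff_add (by fun_prop) (by fun_prop)]
  simp only [cosCoeff_const_mul, cosCoeff_two_cos_mul c₁, cosCoeff_two_cos_sq_mul c₀]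
  ring

theorem pi_mul_centralCount (n : ℕ) : ∀ d : ℤ, π * centralCount n d =
    2 ^ n * cosCoeff (fun θ => centralSymbol (2 * cos θ) n) d := by
  induction n using Nat.strong_induction_on with
  | _ n ih =>
    intro d
    match n with
    | 0 =>
      rw [cosCoeff_cubic (-1) 1 1 0 fun θ => by rw [centralSymbol]; ring, centralCount_zero]
      grind
    | 1 =>
      rw [cosCoeff_cubic 1 (1 / 2) 0 0 fun θ => by rw [centralSymbol]; ring, centralCount_one]
      grind
    | 2 =>
      rw [cosCoeff_cubic (-1 / 2) (1 / 2) (1 / 2) 0 fun θ => by rw [centralSymbol]; ring, centralCount_two]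
      grind
    | 3 =>
      rw [cosCoeff_cubic 0 (-1 / 8) (3 / 8) (1 / 4) fun θ => by rw [centralSymbol]; ring, centralCount_three]
      grind
    | n + 4 =>
      rw [centralCount_recurrence, cosCoeff_centralSymbol_recurrence]
      have h₀ := ih n (by lia)
      have h₁ := ih (n + 1) (by lia)
      have h₂ := ih (n + 2) (by lia)
      have h₃ := ih (n + 3) (by lia)
      simp only [mul_add, mul_sub, h₀, h₁, h₂, h₃, pow_add]
      ring

theorem abs_le_pow_mul_of_recurrence {e S : ℕ → ℝ} {b p q r u : ℝ} (hb : 0 < b) (hb₁ : b ≤ 1)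
    (hS : Monotone S) (hS₀ : 0 ≤ S 0) (hq : |p| + |q| + |r| + |u| ≤ b ^ 5)
    (hinit : ∀ j < 5, |e j| ≤ b ^ j * S j)
    (hrec : ∀ n, |e (n + 5) - (p * e (n + 3) + q * e (n + 2) + r * e (n + 1) + u * e n)| ≤
      b ^ (n + 5) * (S (n + 5) - S (n + 4))) (n : ℕ) : |e n| ≤ b ^ n * S n := by
  induction n using Nat.strong_induction_on with
  | _ n ih =>
    by_cases hn : n < 5
    · exact hinit n hn
    obtain ⟨n, rfl⟩ := Nat.exists_eq_add_of_le' (not_lt.mp hn)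
    have hpos : ∀ k, 0 ≤ S k := fun k => hS₀.trans (hS (Nat.zero_le k))
    have hX : ∀ j < 5, |e (n + j)| ≤ b ^ n * S (n + 4) := fun j hj =>
      (ih (n + j) (by lia)).trans <| mul_le_mul
        (pow_le_pow_of_le_one hb.le hb₁ (by lia)) (hS (by lia)) (hpos _) (by positivity)
    have hsum : |p * e (n + 3) + q * e (n + 2) + r * e (n + 1) + u * e n| ≤
        (|p| + |q| + |r| + |u|) * (b ^ n * S (n + 4)) := by
      have h₀ := mul_le_mul_of_nonneg_left (hX 0 (by lia)) (abs_nonneg u)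
      have h₁ := mul_le_mul_of_nonneg_left (hX 1 (by lia)) (abs_nonneg r)
      have h₂ := mul_le_mul_of_nonneg_left (hX 2 (by lia)) (abs_nonneg q)
      have h₃ := mul_le_mul_of_nonneg_left (hX 3 (by lia)) (abs_nonneg p)
      simp only [← abs_mul, add_zero] at h₀ h₁ h₂ h₃
      have t₁ := abs_add_le (p * e (n + 3) + q * e (n + 2) + r * e (n + 1)) (u * e n)
      have t₂ := abs_add_le (p * e (n + 3) + q * e (n + 2)) (r * e (n + 1))
      have t₃ := abs_add_le (p * e (n + 3)) (q * e (n + 2))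
      linarith
    have hmul := mul_le_mul_of_nonneg_right hq (mul_nonneg (pow_nonneg hb.le n) (hpos (n + 4)))
    have htri := abs_add_le (e (n + 5) - (p * e (n + 3) + q * e (n + 2) + r * e (n + 1) + u * e n))
      (p * e (n + 3) + q * e (n + 2) + r * e (n + 1) + u * e n)
    rw [sub_add_cancel] at htri
    have hr := hrec n
    rw [pow_add] at hr ⊢
    linarith

theorem centralSymbol_recurrence (t : ℝ) (n : ℕ) :
    centralSymbol t (n + 5) = 1 / 2 * centralSymbol t (n + 3) + t / 8 * centralSymbol t (n + 2) +
      (t ^ 2 + t - 3) / 16 * centralSymbol t (n + 1) + (t ^ 2 - 2) / 32 * centralSymbol t n := by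
  rw [show n + 5 = n + 1 + 4 from rfl, centralSymbol, centralSymbol]
  ring

theorem abs_centralSymbol_two_sub_three_le (n : ℕ) :
    |centralSymbol 2 n - 3| ≤ 2 * (1 / 2) ^ n := by
  have hinv : ∀ n, centralSymbol 2 (n + 3) - 3 + (centralSymbol 2 (n + 2) - 3) / 2 +
      (centralSymbol 2 (n + 1) - 3) / 4 + (centralSymbol 2 n - 3) / 8 = 0 := by
    intro n
    induction n with
    | zero => norm_num [centralSymbol]
    | succ n ih =>
      rw [show n + 1 + 3 = n + 4 from rfl, centralSymbol]
      linear_combination ih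
  induction n using Nat.strong_induction_on with
  | _ n ih =>
    match n with
    | 0 => norm_num [centralSymbol]
    | 1 => norm_num [centralSymbol]
    | 2 => norm_num [centralSymbol]
    | 3 => norm_num [centralSymbol]
    | n + 4 =>
      have h : centralSymbol 2 (n + 4) - 3 = 1 / 16 * (centralSymbol 2 n - 3) := by
        rw [centralSymbol]
        linear_combination hinv n / 2
      rw [h, abs_mul, pow_add, abs_of_pos (by norm_num)]
      linarith [ih n (by lia)]

theorem abs_centralSymbol_sub_le_of_lt_five {s : ℝ} (hs₀ : 0 ≤ s) (hs₄ : s ≤ 4) {j : ℕ}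
    (hj : j < 5) :
    |centralSymbol (2 - s) j - 3 * (1 - s / 5) ^ j - (centralSymbol 2 j - 3)| ≤ 25 * s := by
  have key : ∀ a b c d x : ℝ, |a| + 4 * |b| + 16 * |c| + 64 * |d| ≤ 25 →
      x = s * (a + b * s + c * s ^ 2 + d * s ^ 3) → |x| ≤ 25 * s := by
    intro a b c d x h hx
    have h2 : s ^ 2 ≤ 16 := by nlinarith
    have h3 : s ^ 3 ≤ 64 := by nlinarith
    have t₁ := abs_add_le (a + b * s + c * s ^ 2) (d * s ^ 3)
    have t₂ := abs_add_le (a + b * s) (c * s ^ 2)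
    have t₃ := abs_add_le a (b * s)
    rw [abs_mul d, abs_of_nonneg (by positivity : 0 ≤ s ^ 3)] at t₁
    rw [abs_mul c, abs_of_nonneg (by positivity : 0 ≤ s ^ 2)] at t₂
    rw [abs_mul b, abs_of_nonneg hs₀] at t₃
    have u₁ := mul_le_mul_of_nonneg_left hs₄ (abs_nonneg b)
    have u₂ := mul_le_mul_of_nonneg_left h2 (abs_nonneg c)
    have u₃ := mul_le_mul_of_nonneg_left h3 (abs_nonneg d)
    rw [hx, abs_mul, abs_of_nonneg hs₀, mul_comm]
    exact mul_le_mul_of_nonneg_right (by linarith) hs₀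
  interval_cases j
  · refine key (-5) 1 0 0 _ (by norm_num [abs_of_pos, abs_of_neg]) ?_
    simp only [centralSymbol]
    ring
  · refine key (1 / 10) 0 0 0 _ (by norm_num [abs_of_pos, abs_of_neg]) ?_
    simp only [centralSymbol]
    ring
  · refine key (-13 / 10) (19 / 50) 0 0 _ (by norm_num [abs_of_pos, abs_of_neg]) ?_
    simp only [centralSymbol]
    ring
  · refine key (-103 / 40) (303 / 200) (-113 / 500) 0 _ (by norm_num [abs_of_pos, abs_of_neg]) ?_
    simp only [centralSymbol]
    ring
  · refine key (-13 / 5) (837 / 400) (-1183 / 2000) (577 / 10000) _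
      (by norm_num [abs_of_pos, abs_of_neg]) ?_
    simp only [centralSymbol]
    ring

theorem sum_abs_coeff_le {s : ℝ} (hs₀ : 0 ≤ s) (hs₄ : s ≤ 4) :
    |(1 / 2 : ℝ)| + |(2 - s) / 8| + |((2 - s) ^ 2 + (2 - s) - 3) / 16| + |((2 - s) ^ 2 - 2) / 32| ≤
      1 - s / 32 := by
  rw [abs_of_pos (by norm_num : (0 : ℝ) < 1 / 2)]
  rcases abs_cases ((2 - s) / 8) with h₁ | h₁ <;>
  rcases abs_cases (((2 - s) ^ 2 + (2 - s) - 3) / 16) with h₂ | h₂ <;>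
  rcases abs_cases (((2 - s) ^ 2 - 2) / 32) with h₃ | h₃ <;>
  nlinarith

theorem abs_centralSymbol_sub_le {s : ℝ} (hs₀ : 0 ≤ s) (hs₄ : s ≤ 4) (n : ℕ) :
    |centralSymbol (2 - s) n - 3 * (1 - s / 5) ^ n - (centralSymbol 2 n - 3)| ≤
      (1 - s / 160) ^ n * (50 * s + 4 * n * s ^ 2) := by
  set b := 1 - s / 160 with hb
  set g := 1 - s / 5 with hg
  have hb₀ : 39 / 40 ≤ b := by linarith
  have hb₁ : b ≤ 1 := by linarith
  have hg₀ : 0 ≤ g := by linarith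
  have hgb : g ≤ b := by linarith
  have hb₅ : 1 - s / 32 ≤ b ^ 5 := by
    have := one_add_mul_le_pow (a := -(s / 160)) (by linarith) 5
    rw [← sub_eq_add_neg, ← hb] at this
    push_cast at this
    linarith
  set S : ℕ → ℝ := fun n => 30 * s + 4 * n * s ^ 2 + 20 * s * (1 - (2 / 3) ^ n) with hS
  have hmono : Monotone S := by
    refine monotone_nat_of_le_succ fun n => ?_
    have : 0 ≤ s * (2 / 3 : ℝ) ^ n := by positivity
    simp only [hS, pow_succ]
    push_cast
    nlinarith [sq_nonneg s]
  have key := abs_le_pow_mul_of_recurrence (S := S)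
    (e := fun n => centralSymbol (2 - s) n - 3 * g ^ n - (centralSymbol 2 n - 3))
    (by linarith) hb₁ hmono (by simp [hS, hs₀]) ((sum_abs_coeff_le hs₀ hs₄).trans hb₅) ?_ ?_ n
  · refine key.trans (mul_le_mul_of_nonneg_left ?_ (by positivity))
    have : 0 ≤ s * (2 / 3 : ℝ) ^ n := by positivity
    simp only [hS]
    linarith
  · intro j hj
    refine (abs_centralSymbol_sub_le_of_lt_five hs₀ hs₄ hj).trans ?_
    have h₁ : 9 / 10 ≤ b ^ j :=
      calc (9 / 10 : ℝ) ≤ (39 / 40) ^ 4 := by norm_num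
        _ ≤ b ^ 4 := by gcongr
        _ ≤ b ^ j := pow_le_pow_of_le_one (by linarith) hb₁ (by lia)
    have h₂ : S 0 ≤ S j := hmono (Nat.zero_le j)
    have h₃ : S 0 = 30 * s := by simp [hS]
    calc 25 * s ≤ 9 / 10 * (30 * s) := by linarith
      _ ≤ b ^ j * S j := by rw [← h₃]; gcongr
  · intro n
    have hb₇ : 7 / 8 ≤ b ^ 5 := by linarith
    set y : ℕ → ℝ := fun n => centralSymbol 2 n - 3 with hy
    have hy₀ := abs_centralSymbol_two_sub_three_le n
    have hy₁ := abs_centralSymbol_two_sub_three_le (n + 1)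
    have hy₂ := abs_centralSymbol_two_sub_three_le (n + 2)
    have hpoly : |99 / 800 - 117 / 2000 * s + s ^ 2 / 125 - s ^ 3 / 3125| ≤ 1 := by
      rw [abs_le]
      constructor <;> nlinarith [pow_nonneg hs₀ 2, pow_nonneg hs₀ 3, mul_nonneg hs₀ (sub_nonneg.2 hs₄),
        mul_nonneg (pow_nonneg hs₀ 2) (sub_nonneg.2 hs₄)]
    have hres : centralSymbol (2 - s) (n + 5) - 3 * g ^ (n + 5) - y (n + 5) -
        (1 / 2 * (centralSymbol (2 - s) (n + 3) - 3 * g ^ (n + 3) - y (n + 3)) +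
          (2 - s) / 8 * (centralSymbol (2 - s) (n + 2) - 3 * g ^ (n + 2) - y (n + 2)) +
          ((2 - s) ^ 2 + (2 - s) - 3) / 16 *
            (centralSymbol (2 - s) (n + 1) - 3 * g ^ (n + 1) - y (n + 1)) +
          ((2 - s) ^ 2 - 2) / 32 * (centralSymbol (2 - s) n - 3 * g ^ n - y n)) =
        -(3 * s ^ 2) * (g ^ n * (99 / 800 - 117 / 2000 * s + s ^ 2 / 125 - s ^ 3 / 3125)) -
        s * (1 / 8 * y (n + 2) + (5 - s) / 16 * y (n + 1) + (4 - s) / 32 * y n) := by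
      simp only [hy]
      rw [centralSymbol_recurrence (2 - s), centralSymbol_recurrence 2]
      simp only [pow_add, hg]
      ring
    have hA : |g ^ n * (99 / 800 - 117 / 2000 * s + s ^ 2 / 125 - s ^ 3 / 3125)| ≤ b ^ n := by
      rw [abs_mul, abs_of_nonneg (by positivity)]
      calc _ ≤ g ^ n * 1 := by gcongr
        _ = g ^ n := mul_one _
        _ ≤ b ^ n := by gcongr
    have hB : |1 / 8 * y (n + 2) + (5 - s) / 16 * y (n + 1) + (4 - s) / 32 * y n| ≤
        (1 / 2) ^ n := by
      have t₁ := abs_add_le (1 / 8 * y (n + 2) + (5 - s) / 16 * y (n + 1)) ((4 - s) / 32 * y n)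
      have t₂ := abs_add_le (1 / 8 * y (n + 2)) ((5 - s) / 16 * y (n + 1))
      rw [abs_mul (1 / 8), abs_mul ((5 - s) / 16), abs_of_pos (by norm_num : (0 : ℝ) < 1 / 8),
        abs_of_nonneg (by linarith : 0 ≤ (5 - s) / 16)] at t₂
      rw [abs_mul ((4 - s) / 32), abs_of_nonneg (by linarith : 0 ≤ (4 - s) / 32)] at t₁
      have u₁ : (5 - s) / 16 * |y (n + 1)| ≤ 5 / 16 * |y (n + 1)| := by gcongr; linarith
      have u₀ : (4 - s) / 32 * |y n| ≤ 4 / 32 * |y n| := by gcongr; linarith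
      simp only [pow_add] at hy₁ hy₂
      have hp : (0 : ℝ) ≤ (1 / 2) ^ n := by positivity
      linarith
    have hhalf : (1 / 2 : ℝ) ^ n ≤ b ^ n * (2 / 3) ^ n := by
      rw [← mul_pow]
      gcongr
      linarith
    have hbn : 0 ≤ b ^ n := by positivity
    have hinc : S (n + 5) - S (n + 4) = 4 * s ^ 2 + 320 / 243 * s * (2 / 3) ^ n := by
      simp only [hS, pow_add]
      push_cast
      ring
    rw [hres, hinc, pow_add]
    calc _ ≤ 3 * s ^ 2 * b ^ n + s * (1 / 2) ^ n := by
          refine (abs_sub _ _).trans ?_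
          rw [abs_mul, abs_mul s, abs_neg, abs_of_nonneg hs₀,
            abs_of_nonneg (by positivity : 0 ≤ 3 * s ^ 2)]
          gcongr
      _ ≤ 3 * s ^ 2 * b ^ n + s * (b ^ n * (2 / 3) ^ n) := by gcongr
      _ ≤ b ^ n * (7 / 8) * (4 * s ^ 2 + 320 / 243 * s * (2 / 3) ^ n) := by
          have h₁ : 0 ≤ b ^ n * s ^ 2 := by positivity
          have h₂ : 0 ≤ b ^ n * (s * (2 / 3) ^ n) := by positivity
          linarith
      _ ≤ _ := by gcongr

theorem mul_exp_neg_div_le {c : ℝ} (hc : 0 < c) (x : ℝ) : x * exp (-(x / c)) ≤ c := by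
  have h : x ≤ c * exp (x / c) := by
    have := add_one_le_exp (x / c)
    calc x = c * (x / c) := by field_simp
      _ ≤ _ := by gcongr; linarith
  calc x * exp (-(x / c)) ≤ c * exp (x / c) * exp (-(x / c)) := by gcongr
    _ = c := by rw [mul_assoc, ← exp_add, add_neg_cancel, exp_zero, mul_one]

theorem abs_one_sub_sub_exp_le (θ : ℝ) :
    |1 - (2 - 2 * cos θ) / 5 - exp (-(θ ^ 2 / 5))| ≤ θ ^ 4 / 5 := by
  have hy : 0 ≤ θ ^ 2 / 5 := by positivity
  have h₁ := one_sub_sq_div_two_le_cos (x := θ)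
  have h₂ : cos θ - 1 + θ ^ 2 / 2 ≤ θ ^ 4 / 2 := by
    rcases le_total |θ| 1 with h | h
    · have := (abs_le.mp (cos_bound h)).2
      rw [show |θ| ^ 4 = θ ^ 4 by rw [pow_abs, abs_of_nonneg (by positivity)]] at this
      nlinarith [pow_nonneg (sq_nonneg θ) 2]
    · have : 1 ≤ θ ^ 2 := (one_le_sq_iff_one_le_abs θ).2 h
      nlinarith [cos_le_one θ]
  have h₃ := add_one_le_exp (-(θ ^ 2 / 5))
  have h₄ : exp (-(θ ^ 2 / 5)) ≤ 1 - θ ^ 2 / 5 + (θ ^ 2 / 5) ^ 2 := by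
    rw [exp_neg]
    refine (inv_anti₀ (by positivity) (add_one_le_exp (θ ^ 2 / 5))).trans ?_
    rw [inv_le_iff_one_le_mul₀ (by positivity)]
    nlinarith [pow_nonneg hy 3]
  rw [abs_le]
  constructor <;> nlinarith [pow_nonneg (sq_nonneg θ) 2]

theorem sq_div_four_le_two_sub_two_cos {θ : ℝ} (hθ₀ : 0 ≤ θ) (hθ : θ ≤ π) :
    θ ^ 2 / 4 ≤ 2 - 2 * cos θ := by
  have h := cos_le_one_sub_mul_cos_sq (by rwa [abs_of_nonneg hθ₀])
  have hπ : 1 / 8 ≤ 2 / π ^ 2 := by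
    rw [div_le_div_iff₀ (by norm_num) (by positivity)]
    nlinarith [pi_pos, pi_le_four]
  nlinarith [sq_nonneg θ]

theorem abs_centralSymbol_sub_gaussian_le {θ : ℝ} (hθ₀ : 0 ≤ θ) (hθ : θ ≤ π) {n : ℕ}
    (hn : 1 ≤ n) :
    |centralSymbol (2 * cos θ) n - 3 * exp (-(n / 5) * θ ^ 2)| ≤
      50000000 / n * exp (-(n / 1280) * θ ^ 2) + 2 * (1 / 2) ^ n := by
  set s := 2 - 2 * cos θ with hs
  have hn' : (0 : ℝ) < n := by exact_mod_cast hn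
  have hs₀ : 0 ≤ s := by linarith [cos_le_one θ]
  have hs₄ : s ≤ 4 := by linarith [neg_one_le_cos θ]
  have hsle : s ≤ θ ^ 2 := by linarith [one_sub_sq_div_two_le_cos (x := θ)]
  have hsge : θ ^ 2 / 4 ≤ s := sq_div_four_le_two_sub_two_cos hθ₀ hθ
  have hθ16 : θ ^ 2 ≤ 16 := by linarith
  set E := exp (-(θ ^ 2 / 640)) with hE
  set Y := n * θ ^ 2 with hY
  have hY₀ : 0 ≤ Y := by positivity
  have hEn : E ^ n = exp (-(Y / 1280)) * exp (-(Y / 1280)) := by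
    rw [hE, ← exp_nat_mul, ← exp_add, hY]
    ring_nf
  have hE₁ := add_one_le_exp (-(θ ^ 2 / 640))
  rw [← hE] at hE₁
  have hEhalf : 1 ≤ 2 * E := by linarith
  have hbE : 1 - s / 160 ≤ E := by linarith
  have hgE : 1 - s / 5 ≤ E := by linarith
  have heE : exp (-(θ ^ 2 / 5)) ≤ E := exp_le_exp.2 (by linarith [sq_nonneg θ])
  have h₁ := abs_centralSymbol_sub_le hs₀ hs₄ n
  rw [show 2 - s = 2 * cos θ by rw [hs]; ring] at h₁
  have h₁' : (1 - s / 160) ^ n * (50 * s + 4 * n * s ^ 2) ≤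
      E ^ n * (50 * θ ^ 2 + 4 * n * (θ ^ 2) ^ 2) := by
    gcongr
    linarith
  have h₂ := abs_centralSymbol_two_sub_three_le n
  have h₃ : |(1 - s / 5) ^ n - exp (-(θ ^ 2 / 5)) ^ n| ≤ E ^ n * (n * θ ^ 4) := by
    refine (abs_pow_sub_pow_le _ _ _).trans ?_
    have hmax : max |1 - s / 5| |exp (-(θ ^ 2 / 5))| ≤ E := by
      rw [abs_of_nonneg (by linarith : 0 ≤ 1 - s / 5), abs_of_pos (exp_pos _)]
      exact max_le hgE heE
    calc _ ≤ θ ^ 4 / 5 * n * E ^ (n - 1) := by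
          gcongr
          exact abs_one_sub_sub_exp_le θ
      _ ≤ θ ^ 4 / 5 * n * E ^ (n - 1) * (2 * E) := le_mul_of_one_le_right (by positivity) hEhalf
      _ = E ^ (n - 1 + 1) * (n * θ ^ 4) * (2 / 5) := by ring
      _ ≤ E ^ (n - 1 + 1) * (n * θ ^ 4) := by
          have : 0 ≤ E ^ (n - 1 + 1) * (n * θ ^ 4) := by positivity
          linarith
      _ = _ := by rw [Nat.sub_add_cancel hn]
  rw [← exp_nat_mul, show (n : ℝ) * -(θ ^ 2 / 5) = -(n / 5) * θ ^ 2 by ring] at h₃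
  have h₄ : E ^ n * (50 * θ ^ 2 + 7 * n * θ ^ 4) ≤ 50000000 / n * exp (-(n / 1280) * θ ^ 2) := by
    have hF : exp (-(n / 1280) * θ ^ 2) = exp (-(Y / 1280)) := by
      rw [hY]
      ring_nf
    have hq₁ : Y * exp (-(Y / 1280)) ≤ 1280 := mul_exp_neg_div_le (by norm_num) Y
    have hq₂ : Y * exp (-(Y / 2560)) ≤ 2560 := mul_exp_neg_div_le (by norm_num) Y
    have hq₃ : Y ^ 2 * exp (-(Y / 1280)) ≤ 2560 ^ 2 := by
      calc Y ^ 2 * exp (-(Y / 1280)) = (Y * exp (-(Y / 2560))) ^ 2 := by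
            have : exp (-(Y / 1280)) = exp (-(Y / 2560)) * exp (-(Y / 2560)) := by
              rw [← exp_add]
              ring_nf
            rw [this]
            ring
        _ ≤ _ := by gcongr
    rw [hF, hEn, div_mul_eq_mul_div, le_div_iff₀ hn']
    calc _ = (50 * (Y * exp (-(Y / 1280))) + 7 * (Y ^ 2 * exp (-(Y / 1280)))) *
          exp (-(Y / 1280)) := by rw [hY]; ring
      _ ≤ _ := by
        gcongr
        linarith
  have htri : |centralSymbol (2 * cos θ) n - 3 * exp (-(n / 5) * θ ^ 2)| ≤
      |centralSymbol (2 * cos θ) n - 3 * (1 - s / 5) ^ n - (centralSymbol 2 n - 3)| +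
        3 * |(1 - s / 5) ^ n - exp (-(n / 5) * θ ^ 2)| + |centralSymbol 2 n - 3| := by
    rw [← abs_of_pos (by norm_num : (0 : ℝ) < 3), ← abs_mul, abs_of_pos (by norm_num : (0 : ℝ) < 3)]
    refine le_trans (le_of_eq ?_) (abs_add_three _ _ _)
    congr 1
    ring
  linarith

theorem gaussian_le_div_mul_gaussian {θ : ℝ} (hθ : 1 ≤ θ) {n : ℕ} (hn : 1 ≤ n) :
    3 * exp (-(n / 5) * θ ^ 2) ≤ 50000000 / n * exp (-(n / 1280) * θ ^ 2) := by
  have hn' : (0 : ℝ) < n := by exact_mod_cast hn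
  have hF := mul_exp_neg_div_le (c := 1280) (by norm_num) (n * θ ^ 2)
  have hnθ : (n : ℝ) ≤ n * θ ^ 2 := le_mul_of_one_le_right hn'.le (one_le_pow₀ hθ)
  have he : exp (-(n / 5) * θ ^ 2) ≤
      exp (-(n * θ ^ 2 / 1280)) * exp (-(n * θ ^ 2 / 1280)) := by
    rw [← exp_add, exp_le_exp]
    linarith
  rw [show -((n : ℝ) / 1280) * θ ^ 2 = -(n * θ ^ 2 / 1280) by ring, div_mul_eq_mul_div,
    le_div_iff₀ hn']
  calc _ ≤ 3 * (exp (-(n * θ ^ 2 / 1280)) * exp (-(n * θ ^ 2 / 1280))) * (n * θ ^ 2) := by gcongr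
    _ = 3 * (n * θ ^ 2 * exp (-(n * θ ^ 2 / 1280))) * exp (-(n * θ ^ 2 / 1280)) := by ring
    _ ≤ _ := by gcongr; linarith

open MeasureTheory Set in
theorem abs_cosCoeff_centralSymbol_sub_le {n : ℕ} (hn : 1 ≤ n) :
    |cosCoeff (fun θ => centralSymbol (2 * cos θ) n) 0 - 3 * (√(π / (n / 5)) / 2)| ≤
      50000000 / n * (√(π / (n / 1280)) / 2) + 2 * (1 / 2) ^ n * π := by
  have hn' : (0 : ℝ) < n := by exact_mod_cast hn
  set A : ℝ → ℝ := fun θ => centralSymbol (2 * cos θ) n with hA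
  set G : ℝ → ℝ := fun θ => 3 * exp (-(n / 5) * θ ^ 2) with hG
  set B : ℝ → ℝ := fun θ => 50000000 / n * exp (-(n / 1280) * θ ^ 2) with hB
  have hGint : Integrable G := (integrable_exp_neg_mul_sq (by positivity)).const_mul _
  have hBint : Integrable B := (integrable_exp_neg_mul_sq (by positivity)).const_mul _
  have hAint : IntegrableOn A (Ioc 0 π) :=
    (intervalIntegrable_iff_integrableOn_Ioc_of_le pi_pos.le).1
      ((continuous_centralSymbol_two_cos n).intervalIntegrable _ _)
  have hG' : ∫ θ in Ioi (0 : ℝ), G θ = 3 * (√(π / (n / 5)) / 2) := by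
    rw [← integral_gaussian_Ioi, ← integral_const_mul]
  have hB' : ∫ θ in Ioi (0 : ℝ), B θ = 50000000 / n * (√(π / (n / 1280)) / 2) := by
    rw [← integral_gaussian_Ioi, ← integral_const_mul]
  have hA' : cosCoeff A 0 = ∫ θ in Ioc 0 π, A θ := by
    rw [cosCoeff, intervalIntegral.integral_of_le pi_pos.le]
    simp
  have hsplit : ∀ f : ℝ → ℝ, Integrable f →
      ∫ θ in Ioi (0 : ℝ), f θ = (∫ θ in Ioc 0 π, f θ) + ∫ θ in Ioi π, f θ := fun f hf => by
    rw [← setIntegral_union (Ioc_disjoint_Ioi le_rfl) measurableSet_Ioi hf.integrableOn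
      hf.integrableOn, Ioc_union_Ioi_eq_Ioi pi_pos.le]
  have h₁ : |∫ θ in Ioc 0 π, (A θ - G θ)| ≤ ∫ θ in Ioc 0 π, (B θ + 2 * (1 / 2) ^ n) := by
    rw [← norm_eq_abs]
    refine norm_integral_le_of_norm_le (f := fun θ => A θ - G θ)
      (hBint.integrableOn.add (integrableOn_const (by simp))) ?_
    filter_upwards [ae_restrict_mem measurableSet_Ioc] with θ hθ
    exact abs_centralSymbol_sub_gaussian_le hθ.1.le hθ.2 hn
  have h₂ : |∫ θ in Ioi π, G θ| ≤ ∫ θ in Ioi π, B θ := by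
    rw [← norm_eq_abs]
    refine norm_integral_le_of_norm_le hBint.integrableOn ?_
    filter_upwards [ae_restrict_mem measurableSet_Ioi] with θ hθ
    rw [norm_of_nonneg (by positivity)]
    exact gaussian_le_div_mul_gaussian (by linarith [pi_gt_three, mem_Ioi.1 hθ]) hn
  rw [integral_sub hAint hGint.integrableOn] at h₁
  rw [integral_add hBint.integrableOn (integrableOn_const (by simp))] at h₁
  have hconst : ∫ _ in Ioc 0 π, (2 * (1 / 2) ^ n : ℝ) = 2 * (1 / 2) ^ n * π := by
    simp [pi_pos.le, mul_comm]
  rw [hconst] at h₁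
  rw [← hG', ← hB', hA', hsplit G hGint, hsplit B hBint]
  rw [abs_le] at *
  constructor <;> linarith [h₁.1, h₁.2, h₂.1, h₂.2]

theorem inv_mul_sqrt_le {k x y : ℝ} (hk : 0 ≤ k) (hx : 0 < x) (hy : 0 < y) (h : y ≤ k ^ 2 * x) :
    1 / (x * √x) ≤ k ^ 3 * (1 / (y * √y)) := by
  have hs : √y ≤ k * √x := by
    rw [← sqrt_sq hk, ← sqrt_mul (sq_nonneg k)]
    exact sqrt_le_sqrt h
  have hx' := sqrt_pos.2 hx
  have hy' := sqrt_pos.2 hy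
  rw [mul_one_div, div_le_div_iff₀ (by positivity) (by positivity), one_mul]
  calc y * √y ≤ k ^ 2 * x * (k * √x) := by gcongr
    _ = _ := by ring

theorem inv_sqrt_sub_le {x y : ℝ} (hx : 0 < x) (hxy : x ≤ y) (hyx : y ≤ x + 2) :
    1 / √x - 1 / √y ≤ 1 / (x * √x) := by
  have hx' := sqrt_pos.2 hx
  have hs := sqrt_le_sqrt hxy
  have hy' := hx'.trans_le hs
  have hxx := sq_sqrt hx.le
  have hyy := sq_sqrt (hx.le.trans hxy)
  have hd : √x * (√y - √x) ≤ 1 := by nlinarith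
  rw [div_sub_div _ _ hx'.ne' hy'.ne', div_le_div_iff₀ (by positivity) (by positivity)]
  calc (1 * √y - √x * 1) * (x * √x) = √x * (√y - √x) * (√x * √x) := by
        rw [mul_self_sqrt hx.le]; ring
    _ ≤ 1 * (√x * √y) := by gcongr
    _ = _ := by ring

theorem half_pow_le_inv_mul_sqrt {n : ℕ} (hn : 1 ≤ n) :
    (1 / 2 : ℝ) ^ n ≤ 2 * (1 / (n * √n)) := by
  have hn' : (1 : ℝ) ≤ n := by exact_mod_cast hn
  have hs : √(n : ℝ) ≤ n := sqrt_le_iff.2 ⟨by linarith, by nlinarith⟩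
  have hsq : ∀ m : ℕ, m ^ 2 ≤ 2 * 2 ^ m := by
    intro m
    induction m with
    | zero => simp
    | succ m ih =>
      rcases lt_or_ge m 3 with hm | hm
      · interval_cases m <;> norm_num
      · rw [pow_succ 2]
        nlinarith
  have hsq' : (n : ℝ) ^ 2 ≤ 2 * 2 ^ n := by exact_mod_cast hsq n
  rw [one_div_pow, mul_one_div, div_le_div_iff₀ (by positivity) (by positivity), one_mul]
  refine le_trans ?_ hsq'
  rw [sq]
  gcongr

theorem abs_flimsyCount_two_sub_le :
    ∃ K : ℝ, 0 ≤ K ∧ ∀ n : ℕ, 1 ≤ n →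
      |(flimsyCount 2 n 0 : ℝ) / 2 ^ n - (1 / 2 - 2 * (3 * √5 / (8 * √π)) * (1 / √n))| ≤
        K * (1 / (n * √n)) := by
  refine ⟨(50000000 * (√(π * 1280) / 2) + 4 * π) / (2 * π), by positivity, fun n hn => ?_⟩
  have hn' : (0 : ℝ) < n := by exact_mod_cast hn
  have h := abs_cosCoeff_centralSymbol_sub_le hn
  have hc := pi_mul_centralCount n 0
  set I := cosCoeff (fun θ => centralSymbol (2 * cos θ) n) 0
  have hI : (flimsyCount 2 n 0 : ℝ) / 2 ^ n = 1 / 2 - I / (2 * π) := by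
    rw [centralCount, neg_zero] at hc
    have hπ := pi_ne_zero
    field_simp
    linarith
  have hs : √(π / (n / 5)) = √5 * √π * (1 / √n) := by
    rw [div_div_eq_mul_div, sqrt_div (by positivity), sqrt_mul pi_pos.le]
    ring
  have hs' : √(π / (n / 1280)) = √(π * 1280) * (1 / √n) := by
    rw [div_div_eq_mul_div, sqrt_div (by positivity)]
    ring
  have hmain : (flimsyCount 2 n 0 : ℝ) / 2 ^ n - (1 / 2 - 2 * (3 * √5 / (8 * √π)) * (1 / √n)) =
      -((I - 3 * (√(π / (n / 5)) / 2)) / (2 * π)) := by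
    rw [hI, hs]
    have hπ : √π ≠ 0 := (sqrt_pos.2 pi_pos).ne'
    have hn0 : √(n : ℝ) ≠ 0 := (sqrt_pos.2 hn').ne'
    rw [show 2 * π = 2 * √π ^ 2 by rw [sq_sqrt pi_pos.le]]
    field_simp
    ring
  rw [hmain, abs_neg, abs_div, abs_of_pos (by positivity : 0 < 2 * π), div_mul_eq_mul_div]
  gcongr
  refine h.trans ?_
  have h₂ := mul_le_mul_of_nonneg_right (half_pow_le_inv_mul_sqrt hn) pi_pos.le
  calc _ = 50000000 * (√(π * 1280) / 2) * (1 / (n * √n)) + 2 * ((1 / 2) ^ n * π) := by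
        rw [hs']
        field_simp
    _ ≤ _ := by linarith

theorem exists_abs_flimsyCount_zero_sub_le :
    ∃ K : ℝ, 0 < K ∧ ∀ n : ℕ,
      |(flimsyCount 0 n 0 : ℝ) / 2 ^ (n + 1) -
        (1 / 4 - 3 * √5 / (8 * √π) * (1 / √(n + 1 : ℝ)))| ≤
        K * (1 / ((n + 1) * √(n + 1 : ℝ))) := by
  obtain ⟨K, hK, hb⟩ := abs_flimsyCount_two_sub_le
  set c := 3 * √5 / (8 * √π) with hc
  have hc₀ : 0 ≤ c := by positivity
  set v : ℕ → ℝ := fun n => (flimsyCount 0 n 0 : ℝ) / 2 ^ (n + 1) -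
    (1 / 4 - c * (1 / √(n + 1 : ℝ))) with hv
  set g : ℝ → ℝ := fun x => 1 / (x * √x) with hg
  have hg₀ : ∀ n : ℕ, 0 < g (n + 1) := fun n => by simp only [hg]; positivity
  refine ⟨|v 0| / g 1 + |v 1| / g 2 + 100 * (K + c) + 1, ?_, fun n => ?_⟩
  · have := hg₀ 0
    have := hg₀ 1
    norm_num at *
    positivity
  set L := |v 0| / g 1 + |v 1| / g 2 + 100 * (K + c) + 1 with hL
  have hg1 : 0 < g 1 := by simpa using hg₀ 0
  have hg2 : 0 < g 2 := by simp only [hg]; positivity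
  have hL₀ : 0 ≤ L := by positivity
  change |v n| ≤ L * g (n + 1)
  induction n with
  | zero =>
    rw [← div_le_iff₀ (hg₀ 0)]
    simp only [CharP.cast_eq_zero, zero_add]
    have : 0 ≤ |v 1| / g 2 := by positivity
    linarith
  | succ m ih =>
    rcases Nat.eq_zero_or_pos m with rfl | hm
    · rw [← div_le_iff₀ (hg₀ _)]
      norm_num
      have : 0 ≤ |v 0| / g 1 := by positivity
      linarith
    have hm' : (1 : ℝ) ≤ m := by exact_mod_cast hm
    have hrec : v (m + 1) = v m / 2 + ((flimsyCount 2 m 0 : ℝ) / 2 ^ m -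
        (1 / 2 - 2 * c * (1 / √m))) / 4 -
        c / 2 * ((1 / √m - 1 / √(m + 2 : ℝ)) + (1 / √(m + 1 : ℝ) - 1 / √(m + 2 : ℝ))) := by
      simp only [hv]
      rw [flimsyCount_zero_succ]
      push_cast
      rw [show (m : ℝ) + 1 + 1 = m + 2 by ring]
      simp only [pow_succ]
      ring
    have hw := hb m hm
    have d₁ := inv_sqrt_sub_le (x := m) (y := m + 2) (by linarith) (by linarith) (by linarith)
    have d₂ := inv_sqrt_sub_le (x := m + 1) (y := m + 2) (by linarith) (by linarith) (by linarith)
    have d₁' : 1 / √(m + 2 : ℝ) ≤ 1 / √(m : ℝ) := by gcongr; linarith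
    have d₂' : 1 / √(m + 2 : ℝ) ≤ 1 / √(m + 1 : ℝ) := by gcongr; linarith
    have r₁ := inv_mul_sqrt_le (k := 7 / 4) (x := m) (y := m + 2) (by norm_num) (by linarith)
      (by linarith) (by linarith)
    have r₂ := inv_mul_sqrt_le (k := 123 / 100) (x := m + 1) (y := m + 2) (by norm_num)
      (by linarith) (by linarith) (by linarith)
    have hcast : ((m + 1 : ℕ) : ℝ) + 1 = m + 2 := by push_cast; ring
    rw [hcast, hrec]
    change _ ≤ _ * g (m + 2)
    change g m ≤ _ * g (m + 2) at r₁
    change g (m + 1) ≤ _ * g (m + 2) at r₂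
    change _ ≤ K * g m at hw
    change _ ≤ g m at d₁
    change _ ≤ g (m + 1) at d₂
    have hgp : 0 < g (m + 2) := by simp only [hg]; positivity
    set D := (1 / √(m : ℝ) - 1 / √(m + 2 : ℝ)) + (1 / √(m + 1 : ℝ) - 1 / √(m + 2 : ℝ)) with hD
    have hD₀ : 0 ≤ D := by linarith
    have hD₁ : D ≤ 8 * g (m + 2) := by linarith
    have e₁ : c / 2 * D ≤ c / 2 * (8 * g (m + 2)) := by gcongr
    have e₀ : 0 ≤ c / 2 * D := by positivity
    have e₂ : K * g m ≤ K * (6 * g (m + 2)) := by gcongr; linarith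
    have e₃ : L * g (m + 1) ≤ L * (187 / 100 * g (m + 2)) := by gcongr; linarith
    have e₄ : 100 * (K + c) * g (m + 2) ≤ L * g (m + 2) := by
      gcongr
      have : 0 ≤ |v 0| / g 1 + |v 1| / g 2 := by positivity
      linarith
    have p₁ : 0 ≤ K * g (m + 2) := by positivity
    have p₂ : 0 ≤ c * g (m + 2) := by positivity
    rw [abs_le] at *
    constructor <;> linarith [ih.1, ih.2, hw.1, hw.2]

theorem stmt_16 :
    ∃ C : ℝ, 0 < C ∧ ∀ N : ℕ, 1 ≤ N →
      |(((Finset.Ico (2 ^ (N - 1)) (2 ^ N)).filter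
            (fun n => (Nat.digits 2 (5 * n)).sum < (Nat.digits 2 n).sum)).card : ℝ) -
          2 ^ N * (1 / 4 - (3 * Real.sqrt 5 / (8 * Real.sqrt π)) *
            (N : ℝ) ^ (-(1 / 2 : ℝ)))| ≤
        C * 2 ^ N * (N : ℝ) ^ (-(3 / 2 : ℝ)) := by
  obtain ⟨K, hK, hb⟩ := exists_abs_flimsyCount_zero_sub_le
  refine ⟨K, hK, fun N hN => ?_⟩
  obtain ⟨n, rfl⟩ := Nat.exists_eq_add_of_le' hN
  have hn : (0 : ℝ) < n + 1 := by positivity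
  have hcard : #{m ∈ Finset.Ico (2 ^ (n + 1 - 1)) (2 ^ (n + 1)) |
      (Nat.digits 2 (5 * m)).sum < (Nat.digits 2 m).sum} = flimsyCount 0 n 0 := by
    simp only [flimsyCount, add_zero, Nat.add_sub_cancel, Nat.cast_lt]
  have h₁ : ((n + 1 : ℕ) : ℝ) ^ (-(1 / 2 : ℝ)) = 1 / √(n + 1 : ℝ) := by
    push_cast
    rw [rpow_neg hn.le, ← sqrt_eq_rpow, one_div]
  have h₂ : ((n + 1 : ℕ) : ℝ) ^ (-(3 / 2 : ℝ)) = 1 / ((n + 1) * √(n + 1 : ℝ)) := by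
    push_cast
    rw [rpow_neg hn.le, show (3 / 2 : ℝ) = 1 + 1 / 2 by norm_num, rpow_add hn, rpow_one,
      ← sqrt_eq_rpow, one_div]
  rw [hcard, h₁, h₂]
  have hp : (0 : ℝ) < 2 ^ (n + 1) := by positivity
  have h := mul_le_mul_of_nonneg_left (hb n) hp.le
  rw [← abs_of_pos hp, ← abs_mul, abs_of_pos hp, mul_sub, mul_div_cancel₀ _ hp.ne'] at h
  calc _ ≤ _ := h
    _ = _ := by ring
end

section
/- Let G(N) denote the number of integers n with 3^{N−1} ≤ n < 3^N such that s_3(2n) < s_3(n) (the integers with N base-3 digits that are 2-flimsy in base 3). Then G(N) = 3^N·(1/3 + (√3/√(πN))·(−1/3 + 1/(48N) − 13/(1536N²) − 65/(24576N³) + O(N^{−4}))); that is, there exists a constant C > 0 such that for all integers N ≥ 1, |G(N) − 3^N·(1/3 + (√3/√(πN))·(−1/3 + 1/(48N) − 13/(1536N²) − 65/(24576N³)))| ≤ C·3^N·N^{−9/2}. -/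
open Finset Real

/-- The change of the ternary digit sum under doubling. -/
def doublingShift (n : ℕ) : ℤ :=
  ((Nat.digits 3 (2 * n)).sum : ℤ) - (Nat.digits 3 n).sum

/-- The change of the ternary digit sum under doubling with an incoming carry, normalised by
counting the carry itself. -/
def carryShift (n : ℕ) : ℤ :=
  ((Nat.digits 3 (2 * n + 1)).sum : ℤ) - (Nat.digits 3 n).sum - 1

lemma sum_digits_three_mul_add (q d : ℕ) (hd : d < 3) :
    (Nat.digits 3 (3 * q + d)).sum = (Nat.digits 3 q).sum + d := by
  rcases Nat.eq_zero_or_pos (3 * q + d) with h | h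
  · obtain ⟨rfl, rfl⟩ : q = 0 ∧ d = 0 := by omega
    simp
  · rw [Nat.digits_def' (by norm_num) h]
    have h1 : (3 * q + d) % 3 = d := by omega
    have h2 : (3 * q + d) / 3 = q := by omega
    rw [h1, h2, List.sum_cons, add_comm]

lemma doublingShift_three_mul (q : ℕ) : doublingShift (3 * q) = doublingShift q := by
  have h1 := sum_digits_three_mul_add q 0 (by norm_num)
  have h2 := sum_digits_three_mul_add (2 * q) 0 (by norm_num)
  rw [show 3 * (2 * q) + 0 = 2 * (3 * q) by ring] at h2
  simp only [add_zero] at h1 h2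
  simp [doublingShift, h1, h2]

lemma doublingShift_three_mul_add_one (q : ℕ) :
    doublingShift (3 * q + 1) = doublingShift q + 1 := by
  have h1 := sum_digits_three_mul_add q 1 (by norm_num)
  have h2 := sum_digits_three_mul_add (2 * q) 2 (by norm_num)
  rw [show 3 * (2 * q) + 2 = 2 * (3 * q + 1) by ring] at h2
  simp only [doublingShift, h1, h2]
  push_cast
  ring

lemma doublingShift_three_mul_add_two (q : ℕ) :
    doublingShift (3 * q + 2) = carryShift q := by
  have h1 := sum_digits_three_mul_add q 2 (by norm_num)
  have h2 := sum_digits_three_mul_add (2 * q + 1) 1 (by norm_num)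
  rw [show 3 * (2 * q + 1) + 1 = 2 * (3 * q + 2) by ring] at h2
  simp only [doublingShift, carryShift, h1, h2]
  push_cast
  ring

lemma carryShift_three_mul (q : ℕ) : carryShift (3 * q) = doublingShift q := by
  have h1 := sum_digits_three_mul_add q 0 (by norm_num)
  have h2 := sum_digits_three_mul_add (2 * q) 1 (by norm_num)
  rw [show 3 * (2 * q) + 1 = 2 * (3 * q) + 1 by ring] at h2
  simp only [add_zero] at h1
  simp only [doublingShift, carryShift, h1, h2]
  push_cast
  ring

lemma carryShift_three_mul_add_one (q : ℕ) :
    carryShift (3 * q + 1) = carryShift q - 1 := by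
  have h1 := sum_digits_three_mul_add q 1 (by norm_num)
  have h2 := sum_digits_three_mul_add (2 * q + 1) 0 (by norm_num)
  rw [show 3 * (2 * q + 1) + 0 = 2 * (3 * q + 1) + 1 by ring] at h2
  simp only [carryShift, h1, h2]
  push_cast
  ring

lemma carryShift_three_mul_add_two (q : ℕ) :
    carryShift (3 * q + 2) = carryShift q := by
  have h1 := sum_digits_three_mul_add q 2 (by norm_num)
  have h2 := sum_digits_three_mul_add (2 * q + 1) 2 (by norm_num)
  rw [show 3 * (2 * q + 1) + 2 = 2 * (3 * q + 2) + 1 by ring] at h2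
  simp only [carryShift, h1, h2]
  push_cast
  ring

lemma sum_Ico_three_mul (g : ℕ → ℝ) {a b : ℕ} (hab : a ≤ b) :
    ∑ n ∈ Ico (3 * a) (3 * b), g n =
      ∑ n ∈ Ico a b, (g (3 * n) + g (3 * n + 1) + g (3 * n + 2)) := by
  induction b, hab using Nat.le_induction with
  | base => simp
  | succ b hb ih =>
    rw [sum_Ico_succ_top hb, ← ih, show 3 * (b + 1) = 3 * b + 1 + 1 + 1 by ring,
      sum_Ico_succ_top (by omega), sum_Ico_succ_top (by omega), sum_Ico_succ_top (by omega)]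
    ring

/-- The sum of `f` over the values of `doublingShift` on the integers with `m + 1` ternary digits. -/
noncomputable def shiftSum (m : ℕ) (f : ℤ → ℝ) : ℝ :=
  ∑ n ∈ Ico (3 ^ m) (3 ^ (m + 1)), f (doublingShift n)

lemma sum_Ico_pow_succ (g : ℕ → ℝ) (m : ℕ) :
    ∑ n ∈ Ico (3 ^ (m + 1)) (3 ^ (m + 1 + 1)), g n =
      ∑ n ∈ Ico (3 ^ m) (3 ^ (m + 1)), (g (3 * n) + g (3 * n + 1) + g (3 * n + 2)) := by
  rw [← sum_Ico_three_mul g (Nat.pow_le_pow_right (by norm_num) (Nat.le_succ m))]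
  rw [← pow_succ', ← pow_succ']

lemma shiftSum_zero (f : ℤ → ℝ) : shiftSum 0 f = f 0 + f 1 := by
  have h : Ico (3 ^ 0) (3 ^ (0 + 1)) = ({1, 2} : Finset ℕ) := by decide
  rw [shiftSum, h, sum_pair (by norm_num)]
  have h1 : doublingShift 1 = 1 := by norm_num [doublingShift]
  have h2 : doublingShift 2 = 0 := by norm_num [doublingShift]
  rw [h1, h2, add_comm]

lemma sum_carryShift (m : ℕ) (f : ℤ → ℝ) :
    ∑ n ∈ Ico (3 ^ m) (3 ^ (m + 1)), f (carryShift n) = shiftSum m (fun k => f (k - 1)) := by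
  induction m generalizing f with
  | zero =>
    have h : Ico (3 ^ 0) (3 ^ (0 + 1)) = ({1, 2} : Finset ℕ) := by decide
    rw [shiftSum_zero, h, sum_pair (by norm_num)]
    have h1 : carryShift 1 = -1 := by norm_num [carryShift]
    have h2 : carryShift 2 = 0 := by norm_num [carryShift]
    rw [h1, h2]
    norm_num
  | succ m ih =>
    rw [shiftSum, sum_Ico_pow_succ, sum_Ico_pow_succ]
    simp only [doublingShift_three_mul, doublingShift_three_mul_add_one,
      doublingShift_three_mul_add_two, carryShift_three_mul, carryShift_three_mul_add_one,
      carryShift_three_mul_add_two, sum_add_distrib, add_sub_cancel_right]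
    rw [ih f]
    simp only [shiftSum]
    ring

lemma shiftSum_succ (m : ℕ) (f : ℤ → ℝ) :
    shiftSum (m + 1) f = shiftSum m (fun k => f k + f (k + 1) + f (k - 1)) := by
  rw [shiftSum, sum_Ico_pow_succ]
  simp only [doublingShift_three_mul, doublingShift_three_mul_add_one,
    doublingShift_three_mul_add_two, sum_add_distrib, shiftSum]
  rw [sum_carryShift m f, shiftSum]

lemma shiftSum_reflect (m : ℕ) (f : ℤ → ℝ) :
    shiftSum m (fun k => f (1 - k)) = shiftSum m f := by
  induction m generalizing f with
  | zero => simp [shiftSum_zero, add_comm]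
  | succ m ih =>
    rw [shiftSum_succ, shiftSum_succ, ← ih]
    congr 1
    funext k
    rw [sub_sub_cancel, show 1 - (1 - k + 1) = k - 1 by ring,
      show 1 - (1 - k - 1) = k + 1 by ring]
    ring

lemma shiftSum_cos (m : ℕ) (θ : ℝ) :
    shiftSum m (fun k => cos (k * θ)) = (1 + 2 * cos θ) ^ m * (1 + cos θ) := by
  induction m with
  | zero => simp [shiftSum_zero]
  | succ m ih =>
    rw [shiftSum_succ, pow_succ', mul_assoc, ← ih, shiftSum, shiftSum, mul_sum]
    refine sum_congr rfl fun n _ => ?_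
    push_cast
    rw [add_mul, sub_mul, one_mul, cos_add, cos_sub]
    ring

lemma integral_cos_int_mul (k : ℤ) :
    ∫ θ in (0 : ℝ)..π, cos (k * θ) = if k = 0 then π else 0 := by
  split_ifs with h
  · simp [h]
  · have hk : (k : ℝ) ≠ 0 := by exact_mod_cast h
    rw [intervalIntegral.integral_comp_mul_left (fun x => cos x) hk]
    simp [integral_cos, sin_int_mul_pi]

lemma shiftSum_indicator_zero (m : ℕ) :
    shiftSum m (fun k => if k = 0 then 1 else 0) =
      (∫ θ in (0 : ℝ)..π, (1 + 2 * cos θ) ^ m * (1 + cos θ)) / π := by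
  simp_rw [← shiftSum_cos, shiftSum]
  rw [intervalIntegral.integral_finsetSum
    fun n _ => (by fun_prop : Continuous _).intervalIntegrable _ _, sum_div]
  refine sum_congr rfl fun n _ => ?_
  rw [integral_cos_int_mul]
  split_ifs <;> simp [pi_ne_zero]

lemma card_flimsy (m : ℕ) :
    (((Ico (3 ^ m) (3 ^ (m + 1))).filter
      (fun n => (Nat.digits 3 (2 * n)).sum < (Nat.digits 3 n).sum)).card : ℝ) =
      3 ^ m - (∫ θ in (0 : ℝ)..π, (1 + 2 * cos θ) ^ m * (1 + cos θ)) / π := by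
  have hG : (((Ico (3 ^ m) (3 ^ (m + 1))).filter
      (fun n => (Nat.digits 3 (2 * n)).sum < (Nat.digits 3 n).sum)).card : ℝ) =
      shiftSum m (fun k => if k < 0 then 1 else 0) := by
    rw [shiftSum, card_filter]
    push_cast
    refine sum_congr rfl fun n _ => ?_
    have : (Nat.digits 3 (2 * n)).sum < (Nat.digits 3 n).sum ↔ doublingShift n < 0 := by
      rw [doublingShift]; omega
    simp [this]
  have h1 := shiftSum_reflect m (fun k => if k < 0 then 1 else 0)
  have h2 := shiftSum_reflect m (fun k => if k = 0 then 1 else 0)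
  have htot : shiftSum m (fun _ => 1) = 2 * 3 ^ m := by
    rw [shiftSum]
    simp only [sum_const, Nat.card_Ico, nsmul_eq_mul, mul_one]
    rw [Nat.cast_sub (Nat.pow_le_pow_right (by norm_num) (Nat.le_add_right m 1))]
    push_cast
    ring
  have hsplit : shiftSum m (fun _ => 1) =
      shiftSum m (fun k => if k < 0 then 1 else 0) +
      shiftSum m (fun k => if k = 0 then 1 else 0) +
      shiftSum m (fun k => if 1 - k = 0 then 1 else 0) +
      shiftSum m (fun k => if 1 - k < 0 then 1 else 0) := by
    simp only [shiftSum, ← sum_add_distrib]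
    refine sum_congr rfl fun n _ => ?_
    generalize doublingShift n = k
    rcases lt_trichotomy k 0 with h | h | h
    · simp [h, h.ne, show ¬ (1 - k = 0) by omega, show ¬ (1 - k < 0) by omega]
    · simp [h]
    · rcases eq_or_ne k 1 with h' | h'
      · simp [h']
      · simp [h.not_gt, h.ne', show ¬ (1 - k = 0) by omega, show 1 - k < 0 by omega]
  rw [← shiftSum_indicator_zero, hG]
  linarith

/-- The even moments of the weight `(1 - y ^ 2) ^ m` on the unit interval. -/
noncomputable def betaMoment (m k : ℕ) : ℝ :=
  ∫ y in (0 : ℝ)..1, (1 - y ^ 2) ^ m * y ^ (2 * k)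

lemma betaMoment_succ_left (m k : ℕ) :
    betaMoment (m + 1) k = betaMoment m k - betaMoment m (k + 1) := by
  rw [betaMoment, betaMoment, betaMoment, ← intervalIntegral.integral_sub
    ((by fun_prop : Continuous _).intervalIntegrable _ _)
    ((by fun_prop : Continuous _).intervalIntegrable _ _)]
  congr 1
  funext y
  ring

lemma betaMoment_by_parts (m k : ℕ) :
    (2 * k + 1) * betaMoment (m + 1) k = 2 * (m + 1) * betaMoment m (k + 1) := by
  have hd : ∀ y ∈ Set.uIcc (0 : ℝ) 1, HasDerivAt (fun y : ℝ => (1 - y ^ 2) ^ (m + 1) * y ^ (2 * k + 1))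
      ((2 * k + 1) * ((1 - y ^ 2) ^ (m + 1) * y ^ (2 * k)) -
        2 * (m + 1) * ((1 - y ^ 2) ^ m * y ^ (2 * (k + 1)))) y := by
    intro y _
    have h := (((hasDerivAt_pow 2 y).const_sub 1).pow (m + 1)).mul (hasDerivAt_pow (2 * k + 1) y)
    refine h.congr_deriv ?_
    simp only [Nat.add_sub_cancel, Pi.pow_apply]
    push_cast
    ring
  have h := intervalIntegral.integral_eq_sub_of_hasDerivAt hd
    ((by fun_prop : Continuous _).intervalIntegrable _ _)
  rw [intervalIntegral.integral_sub
    ((by fun_prop : Continuous _).intervalIntegrable _ _)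
    ((by fun_prop : Continuous _).intervalIntegrable _ _),
    intervalIntegral.integral_const_mul, intervalIntegral.integral_const_mul] at h
  simp only [betaMoment]
  have h0 : (1 - (1 : ℝ) ^ 2) ^ (m + 1) * 1 ^ (2 * k + 1) -
      (1 - (0 : ℝ) ^ 2) ^ (m + 1) * 0 ^ (2 * k + 1) = 0 := by simp
  linarith

lemma betaMoment_succ_right (m k : ℕ) :
    betaMoment m (k + 1) = (2 * k + 1) / (2 * (m + 1) + 2 * k + 1) * betaMoment m k := by
  have h1 := betaMoment_by_parts m k
  rw [betaMoment_succ_left] at h1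
  have : (0 : ℝ) < 2 * (m + 1) + 2 * k + 1 := by positivity
  field_simp
  linarith

lemma betaMoment_succ_zero (m : ℕ) :
    betaMoment (m + 1) 0 = (2 * m + 2) / (2 * m + 3) * betaMoment m 0 := by
  rw [betaMoment_succ_left, betaMoment_succ_right]
  have : (0 : ℝ) < 2 * m + 3 := by positivity
  push_cast
  field_simp
  ring

lemma betaMoment_zero_zero : betaMoment 0 0 = 1 := by simp [betaMoment]

lemma betaMoment_zero_pos (m : ℕ) : 0 < betaMoment m 0 := by
  induction m with
  | zero => simp [betaMoment_zero_zero]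
  | succ m ih => rw [betaMoment_succ_zero]; positivity

lemma wallis_eq_betaMoment_sq (m : ℕ) :
    Real.Wallis.W m = (2 * m + 1) * betaMoment m 0 ^ 2 := by
  induction m with
  | zero => simp [Real.Wallis.W, betaMoment_zero_zero]
  | succ m ih =>
    rw [Real.Wallis.W_succ, ih, betaMoment_succ_zero]
    push_cast
    field_simp
    ring

lemma tendsto_mul_betaMoment_sq :
    Filter.Tendsto (fun m : ℕ => ((m : ℝ) + 1) * betaMoment m 0 ^ 2) Filter.atTop
      (nhds (π / 4)) := by
  have h2 : Filter.Tendsto (fun m : ℕ => 1 / 2 + 1 / 4 * (1 / ((m : ℝ) + 1 / 2))) Filter.atTop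
      (nhds (1 / 2 + 1 / 4 * 0)) := by
    refine tendsto_const_nhds.add (Filter.Tendsto.const_mul _ ?_)
    simp only [one_div]
    exact (Filter.tendsto_atTop_add_const_right _ _ tendsto_natCast_atTop_atTop).inv_tendsto_atTop
  have h := Real.Wallis.tendsto_W_nhds_pi_div_two.mul h2
  rw [show π / 2 * (1 / 2 + 1 / 4 * 0) = π / 4 by ring] at h
  refine h.congr fun m => ?_
  rw [wallis_eq_betaMoment_sq]
  field_simp
  ring

lemma mul_betaMoment_sq_succ (m : ℕ) :
    ((m + 1 : ℕ) + 1 : ℝ) * betaMoment (m + 1) 0 ^ 2 =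
      4 * (m + 1) * (m + 2) / (2 * m + 3) ^ 2 * ((m + 1) * betaMoment m 0 ^ 2) := by
  rw [betaMoment_succ_zero]
  push_cast
  field_simp
  ring

/-- Asymptotic expansion of `4 N / π * betaMoment (N - 1) 0 ^ 2` with remainder `c / N ^ 4`. -/
noncomputable def momentExpansion (c x : ℝ) : ℝ :=
  1 + 1 / (4 * x) + 1 / (32 * x ^ 2) - 1 / (128 * x ^ 3) + c / x ^ 4

lemma tendsto_momentExpansion (c : ℝ) :
    Filter.Tendsto (fun m : ℕ => momentExpansion c (m + 1)) Filter.atTop (nhds 1) := by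
  have h0 : Filter.Tendsto (fun m : ℕ => ((m : ℝ) + 1)⁻¹) Filter.atTop (nhds 0) :=
    (Filter.tendsto_atTop_add_const_right _ _ tendsto_natCast_atTop_atTop).inv_tendsto_atTop
  have hc : Continuous fun t : ℝ => 1 + t / 4 + t ^ 2 / 32 - t ^ 3 / 128 + c * t ^ 4 := by
    fun_prop
  have h := (hc.tendsto 0).comp h0
  norm_num at h
  refine h.congr fun m => ?_
  simp only [Function.comp, momentExpansion]
  field_simp

lemma momentExpansion_pos {c x : ℝ} (hc : -1 ≤ c) (hx : 1 ≤ x) : 0 < momentExpansion c x := by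
  obtain ⟨t, ht, rfl⟩ : ∃ t : ℝ, 0 ≤ t ∧ x = t + 1 := ⟨x - 1, by linarith, by ring⟩
  obtain ⟨d, hd, rfl⟩ : ∃ d : ℝ, 0 ≤ d ∧ c = d - 1 := ⟨c + 1, by linarith, by ring⟩
  have h : momentExpansion (d - 1) (t + 1) =
      (128 * (t + 1) ^ 4 + 32 * (t + 1) ^ 3 + 4 * (t + 1) ^ 2 - (t + 1) + 128 * (d - 1)) /
        (128 * (t + 1) ^ 4) := by
    rw [momentExpansion]
    field_simp
    ring
  rw [h]
  refine div_pos ?_ (by positivity)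
  ring_nf
  positivity

lemma momentExpansion_one_succ_le (x : ℝ) (hx : 0 ≤ x) :
    momentExpansion 1 (x + 2) ≤
      4 * (x + 1) * (x + 2) / (2 * x + 3) ^ 2 * momentExpansion 1 (x + 1) := by
  rw [← sub_nonneg]
  have h : 4 * (x + 1) * (x + 2) / (2 * x + 3) ^ 2 * momentExpansion 1 (x + 1) -
      momentExpansion 1 (x + 2) =
      (4 * (x + 2) ^ 5 * (128 * (x + 1) ^ 4 + 32 * (x + 1) ^ 3 + 4 * (x + 1) ^ 2 - (x + 1) + 128) -
      (x + 1) ^ 3 * (2 * x + 3) ^ 2 *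
        (128 * (x + 2) ^ 4 + 32 * (x + 2) ^ 3 + 4 * (x + 2) ^ 2 - (x + 2) + 128)) /
      (128 * (x + 1) ^ 3 * (2 * x + 3) ^ 2 * (x + 2) ^ 4) := by
    rw [momentExpansion, momentExpansion]
    field_simp
    ring
  rw [h]
  refine div_nonneg ?_ (by positivity)
  ring_nf
  positivity

lemma le_momentExpansion_neg_one_succ (x : ℝ) (hx : 0 ≤ x) :
    4 * (x + 1) * (x + 2) / (2 * x + 3) ^ 2 * momentExpansion (-1) (x + 1) ≤
      momentExpansion (-1) (x + 2) := by
  rw [← sub_nonneg]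
  have h : momentExpansion (-1) (x + 2) -
      4 * (x + 1) * (x + 2) / (2 * x + 3) ^ 2 * momentExpansion (-1) (x + 1) =
      ((x + 1) ^ 3 * (2 * x + 3) ^ 2 *
        (128 * (x + 2) ^ 4 + 32 * (x + 2) ^ 3 + 4 * (x + 2) ^ 2 - (x + 2) - 128) -
      4 * (x + 2) ^ 5 * (128 * (x + 1) ^ 4 + 32 * (x + 1) ^ 3 + 4 * (x + 1) ^ 2 - (x + 1) - 128)) /
      (128 * (x + 1) ^ 3 * (2 * x + 3) ^ 2 * (x + 2) ^ 4) := by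
    rw [momentExpansion, momentExpansion]
    field_simp
    ring
  rw [h]
  refine div_nonneg ?_ (by positivity)
  ring_nf
  positivity

lemma mul_betaMoment_sq_le (m : ℕ) :
    ((m : ℝ) + 1) * betaMoment m 0 ^ 2 ≤ π / 4 * momentExpansion 1 (m + 1) := by
  have hpos : ∀ m : ℕ, 0 < momentExpansion 1 ((m : ℝ) + 1) := fun m =>
    momentExpansion_pos (by norm_num) (by linarith [(Nat.cast_nonneg m : (0 : ℝ) ≤ m)])
  have hmono : Monotone fun m : ℕ =>
      ((m : ℝ) + 1) * betaMoment m 0 ^ 2 / momentExpansion 1 (m + 1) := by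
    refine monotone_nat_of_le_succ fun n => ?_
    rw [div_le_div_iff₀ (hpos n) (hpos (n + 1)), mul_betaMoment_sq_succ]
    have h := momentExpansion_one_succ_le n (Nat.cast_nonneg n)
    rw [show ((n + 1 : ℕ) : ℝ) + 1 = n + 2 by push_cast; ring]
    have := mul_le_mul_of_nonneg_left h (by positivity : 0 ≤ ((n : ℝ) + 1) * betaMoment n 0 ^ 2)
    linarith
  have hlim := tendsto_mul_betaMoment_sq.div (tendsto_momentExpansion 1) one_ne_zero
  have := hmono.ge_of_tendsto hlim m
  rwa [div_one, div_le_iff₀ (hpos m)] at this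

lemma le_mul_betaMoment_sq (m : ℕ) :
    π / 4 * momentExpansion (-1) (m + 1) ≤ ((m : ℝ) + 1) * betaMoment m 0 ^ 2 := by
  have hpos : ∀ m : ℕ, 0 < momentExpansion (-1) ((m : ℝ) + 1) := fun m =>
    momentExpansion_pos le_rfl (by linarith [(Nat.cast_nonneg m : (0 : ℝ) ≤ m)])
  have hanti : Antitone fun m : ℕ =>
      ((m : ℝ) + 1) * betaMoment m 0 ^ 2 / momentExpansion (-1) (m + 1) := by
    refine antitone_nat_of_succ_le fun n => ?_
    rw [div_le_div_iff₀ (hpos (n + 1)) (hpos n), mul_betaMoment_sq_succ]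
    have h := le_momentExpansion_neg_one_succ n (Nat.cast_nonneg n)
    rw [show ((n + 1 : ℕ) : ℝ) + 1 = n + 2 by push_cast; ring]
    have := mul_le_mul_of_nonneg_left h (by positivity : 0 ≤ ((n : ℝ) + 1) * betaMoment n 0 ^ 2)
    linarith
  have hlim := tendsto_mul_betaMoment_sq.div (tendsto_momentExpansion (-1)) one_ne_zero
  have := hanti.le_of_tendsto hlim m
  rwa [div_one, le_div_iff₀ (hpos m)] at this

lemma integral_cos_eq_integral_sqrt (m : ℕ) :
    ∫ θ in (0 : ℝ)..π, (1 + 2 * cos θ) ^ m * (1 + cos θ) =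
      3 ^ m * (2 * √3) * ∫ y in (0 : ℝ)..(2 / √3), (1 - y ^ 2) ^ m * √(1 - 3 / 4 * y ^ 2) := by
  have h3 : √3 ^ 2 = 3 := sq_sqrt (by norm_num)
  have h3pos : 0 < √3 := by positivity
  have hd : ∀ θ ∈ Set.uIcc 0 π,
      HasDerivAt (fun θ : ℝ => 2 / √3 * sin (θ / 2)) (cos (θ / 2) / √3) θ := by
    intro θ _
    have h := (((hasDerivAt_id θ).div_const 2).sin).const_mul (2 / √3)
    refine h.congr_deriv ?_
    simp only [id]
    field_simp
  have h := intervalIntegral.integral_comp_mul_deriv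
    (g := fun y : ℝ => (1 - y ^ 2) ^ m * √(1 - 3 / 4 * y ^ 2)) hd
    (by fun_prop) (by fun_prop)
  simp only [zero_div, sin_zero, mul_zero, sin_pi_div_two, mul_one] at h
  rw [← h, ← intervalIntegral.integral_const_mul]
  refine intervalIntegral.integral_congr fun θ hθ => ?_
  rw [Set.uIcc_of_le pi_pos.le] at hθ
  have hc : 0 ≤ cos (θ / 2) :=
    cos_nonneg_of_mem_Icc ⟨by linarith [hθ.1, pi_pos], by linarith [hθ.2]⟩
  have hcos : cos θ = 2 * cos (θ / 2) ^ 2 - 1 := by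
    rw [← cos_two_mul]; congr 1; ring
  have hy : (2 / √3 * sin (θ / 2)) ^ 2 = 4 / 3 * (1 - cos (θ / 2) ^ 2) := by
    rw [mul_pow, div_pow, h3, sin_sq]; norm_num
  have hs : √(1 - 3 / 4 * (4 / 3 * (1 - cos (θ / 2) ^ 2))) = cos (θ / 2) := by
    rw [show 1 - 3 / 4 * (4 / 3 * (1 - cos (θ / 2) ^ 2)) = cos (θ / 2) ^ 2 by ring, sqrt_sq hc]
  simp only [Function.comp, hy, hs, hcos]
  rw [show 1 + 2 * (2 * cos (θ / 2) ^ 2 - 1) = 3 * (1 - 4 / 3 * (1 - cos (θ / 2) ^ 2)) by ring,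
    mul_pow]
  field_simp
  ring

lemma abs_sqrt_one_sub_sub_le {x : ℝ} (h0 : 0 ≤ x) (h1 : x ≤ 1) :
    |√(1 - x) - (1 - x / 2 - x ^ 2 / 8 - x ^ 3 / 16)| ≤ x ^ 4 := by
  set r := √(1 - x)
  have hr : 0 ≤ r := sqrt_nonneg _
  have hr2 : r ^ 2 = 1 - x := sq_sqrt (by linarith)
  have hx2 : x ^ 2 ≤ 1 := pow_le_one₀ h0 h1
  have hx3 : x ^ 3 ≤ 1 := pow_le_one₀ h0 h1
  set p := 1 - x / 2 - x ^ 2 / 8 - x ^ 3 / 16 with hp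
  have hp0 : 5 / 16 ≤ p := by linarith
  have hfac : (p - r) * (p + r) = x ^ 4 * (5 / 64 + x / 64 + x ^ 2 / 256) := by
    rw [show (p - r) * (p + r) = p ^ 2 - r ^ 2 by ring, hr2, hp]; ring
  have hx4 : 0 ≤ x ^ 4 := by positivity
  have hnn : 0 ≤ p - r := by
    refine nonneg_of_mul_nonneg_left (b := p + r) ?_ (by linarith)
    rw [hfac]; positivity
  rw [abs_sub_comm, abs_of_nonneg hnn]
  have hle : (p - r) * (5 / 16) ≤ x ^ 4 * (5 / 16) :=
    calc (p - r) * (5 / 16) ≤ (p - r) * (p + r) := by gcongr; linarith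
      _ ≤ x ^ 4 * (5 / 16) := by rw [hfac]; gcongr; linarith
  linarith

lemma abs_integral_sqrt_sub_le (m : ℕ) :
    |(∫ y in (0 : ℝ)..(2 / √3), (1 - y ^ 2) ^ m * √(1 - 3 / 4 * y ^ 2)) -
      (betaMoment m 0 - 3 / 8 * betaMoment m 1 - 9 / 128 * betaMoment m 2
        - 27 / 1024 * betaMoment m 3)| ≤ betaMoment m 4 + (1 / 3) ^ m := by
  have h3 : √3 ^ 2 = 3 := sq_sqrt (by norm_num)
  have h3pos : 0 < √3 := by positivity
  have hle : 1 ≤ 2 / √3 := by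
    rw [le_div_iff₀ h3pos, one_mul, sqrt_le_left (by norm_num)]; norm_num
  have hle2 : 2 / √3 ≤ 2 := by
    rw [div_le_iff₀ h3pos]
    have : 1 ≤ √3 := one_le_sqrt.mpr (by norm_num)
    linarith
  have hcont : Continuous fun y : ℝ => (1 - y ^ 2) ^ m * √(1 - 3 / 4 * y ^ 2) := by fun_prop
  rw [← intervalIntegral.integral_add_adjacent_intervals (hcont.intervalIntegrable 0 1)
    (hcont.intervalIntegrable 1 (2 / √3))]
  have htail : |∫ y in (1 : ℝ)..(2 / √3), (1 - y ^ 2) ^ m * √(1 - 3 / 4 * y ^ 2)| ≤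
      (1 / 3) ^ m := by
    have h := intervalIntegral.norm_integral_le_of_norm_le_const (a := 1) (b := 2 / √3)
      (f := fun y : ℝ => (1 - y ^ 2) ^ m * √(1 - 3 / 4 * y ^ 2)) (C := (1 / 3) ^ m) ?_
    · rw [Real.norm_eq_abs, abs_of_nonneg (by linarith : 0 ≤ 2 / √3 - 1)] at h
      refine h.trans (mul_le_of_le_one_right (by positivity) (by linarith))
    · intro y hy
      rw [Set.uIoc_of_le hle] at hy
      have hy2 : y ^ 2 ≤ 4 / 3 := by
        calc y ^ 2 ≤ (2 / √3) ^ 2 := pow_le_pow_left₀ (by linarith [hy.1]) hy.2 2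
          _ = 4 / 3 := by rw [div_pow, h3]; norm_num
      have hy1 : 1 ≤ y ^ 2 := one_le_pow₀ hy.1.le
      rw [norm_mul, norm_pow, Real.norm_eq_abs, Real.norm_eq_abs, abs_of_nonneg (sqrt_nonneg _)]
      calc |1 - y ^ 2| ^ m * √(1 - 3 / 4 * y ^ 2) ≤ (1 / 3) ^ m * 1 := by
            gcongr
            · rw [abs_le]; constructor <;> linarith
            · rw [sqrt_le_left zero_le_one]; linarith
        _ = (1 / 3) ^ m := mul_one _
  have hmoments : betaMoment m 0 - 3 / 8 * betaMoment m 1 - 9 / 128 * betaMoment m 2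
        - 27 / 1024 * betaMoment m 3 = ∫ y in (0 : ℝ)..1, (1 - y ^ 2) ^ m *
          (1 - (3 / 4 * y ^ 2) / 2 - (3 / 4 * y ^ 2) ^ 2 / 8 - (3 / 4 * y ^ 2) ^ 3 / 16) := by
    simp only [betaMoment, ← intervalIntegral.integral_const_mul]
    rw [← intervalIntegral.integral_sub, ← intervalIntegral.integral_sub,
      ← intervalIntegral.integral_sub]
    · congr 1
      funext y
      ring
    all_goals exact (by fun_prop : Continuous _).intervalIntegrable _ _
  have hmain : |(∫ y in (0 : ℝ)..1, (1 - y ^ 2) ^ m * √(1 - 3 / 4 * y ^ 2)) -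
      (betaMoment m 0 - 3 / 8 * betaMoment m 1 - 9 / 128 * betaMoment m 2
        - 27 / 1024 * betaMoment m 3)| ≤ betaMoment m 4 := by
    rw [hmoments, ← intervalIntegral.integral_sub (hcont.intervalIntegrable _ _)
      ((by fun_prop : Continuous _).intervalIntegrable _ _), ← Real.norm_eq_abs, betaMoment]
    refine intervalIntegral.norm_integral_le_of_norm_le zero_le_one ?_
      ((by fun_prop : Continuous _).intervalIntegrable _ _)
    refine Filter.Eventually.of_forall fun y hy => ?_
    have hy2 : y ^ 2 ≤ 1 := pow_le_one₀ hy.1.le hy.2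
    have h := abs_sqrt_one_sub_sub_le (x := 3 / 4 * y ^ 2) (by positivity) (by linarith)
    rw [← mul_sub, norm_mul, norm_pow, Real.norm_eq_abs, Real.norm_eq_abs,
      abs_of_nonneg (by linarith : 0 ≤ 1 - y ^ 2)]
    refine mul_le_mul_of_nonneg_left (h.trans ?_) (pow_nonneg (by linarith) m)
    rw [mul_pow, ← pow_mul]
    exact mul_le_of_le_one_left (by rw [pow_mul]; positivity) (by norm_num)
  rw [add_sub_right_comm]
  exact (abs_add_le _ _).trans (add_le_add hmain htail)

lemma abs_betaMoment_zero_sub_le (m : ℕ) {x s : ℝ} (hx : x = m + 1) (hs : 0 < s)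
    (hsx : s ^ 2 * x = π / 4) :
    |betaMoment m 0 - s * (1 + 1 / (8 * x) + 1 / (128 * x ^ 2) - 5 / (1024 * x ^ 3))| ≤
      2 * s / x ^ 4 := by
  have hx1 : 1 ≤ x := by rw [hx]; linarith [(Nat.cast_nonneg m : (0 : ℝ) ≤ m)]
  have hx0 : 0 < x := by linarith
  have hr := betaMoment_zero_pos m
  have hup := mul_betaMoment_sq_le m
  have hlo := le_mul_betaMoment_sq m
  rw [← hx, ← hsx] at hup hlo
  set r := betaMoment m 0
  obtain ⟨t, ht⟩ : ∃ t, t = 1 / x := ⟨_, rfl⟩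
  have ht0 : 0 < t := by rw [ht]; positivity
  have ht1 : t ≤ 1 := by rw [ht, div_le_one hx0]; exact hx1
  have hq : ∀ c, momentExpansion c x = 1 + t / 4 + t ^ 2 / 32 - t ^ 3 / 128 + c * t ^ 4 := by
    intro c
    rw [ht, momentExpansion]
    field_simp
  have hpt : 1 + 1 / (8 * x) + 1 / (128 * x ^ 2) - 5 / (1024 * x ^ 3) =
      1 + t / 8 + t ^ 2 / 128 - 5 * t ^ 3 / 1024 := by
    rw [ht]
    field_simp
  rw [hpt, show 2 * s / x ^ 4 = 2 * s * t ^ 4 by rw [ht]; field_simp]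
  rw [hq] at hup hlo
  have hup' : r ^ 2 ≤ s ^ 2 * (1 + t / 4 + t ^ 2 / 32 - t ^ 3 / 128 + 1 * t ^ 4) :=
    le_of_mul_le_mul_left (by linarith) hx0
  have hlo' : s ^ 2 * (1 + t / 4 + t ^ 2 / 32 - t ^ 3 / 128 + -1 * t ^ 4) ≤ r ^ 2 :=
    le_of_mul_le_mul_left (by linarith) hx0
  set p := 1 + t / 8 + t ^ 2 / 128 - 5 * t ^ 3 / 1024 with hp
  have ht2 : t ^ 2 ≤ 1 := pow_le_one₀ ht0.le ht1
  have ht3 : t ^ 3 ≤ t := by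
    rw [pow_succ]
    exact mul_le_of_le_one_left ht0.le ht2
  have hp1 : 1 ≤ p := by
    rw [hp]
    linarith [sq_nonneg t]
  have hp2 : p ^ 2 = 1 + t / 4 + t ^ 2 / 32 - t ^ 3 / 128 +
      t ^ 4 * (-(19 / 16384) - 5 / 65536 * t + 25 / 1048576 * t ^ 2) := by
    rw [hp]; ring
  have hs4 : 0 < s ^ 2 * t ^ 4 := by positivity
  have hsq : |r ^ 2 - (s * p) ^ 2| ≤ 2 * s ^ 2 * t ^ 4 := by
    have h1 : s ^ 2 * t ^ 4 * (-(19 / 16384) - 5 / 65536 * t + 25 / 1048576 * t ^ 2) ≤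
        s ^ 2 * t ^ 4 * 1 := mul_le_mul_of_nonneg_left (by linarith) hs4.le
    have h2 : s ^ 2 * t ^ 4 * (-1) ≤
        s ^ 2 * t ^ 4 * (-(19 / 16384) - 5 / 65536 * t + 25 / 1048576 * t ^ 2) :=
      mul_le_mul_of_nonneg_left (by linarith [sq_nonneg t]) hs4.le
    rw [mul_pow, hp2, abs_le]
    constructor <;> linarith
  have hsp : s ≤ r + s * p := by
    have := mul_le_mul_of_nonneg_left hp1 hs.le
    linarith
  refine le_of_mul_le_mul_right ?_ hs
  calc |r - s * p| * s ≤ |r - s * p| * (r + s * p) := by gcongr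
    _ = |r ^ 2 - (s * p) ^ 2| := by
      rw [show r ^ 2 - (s * p) ^ 2 = (r - s * p) * (r + s * p) by ring, abs_mul,
        abs_of_nonneg (by linarith : 0 ≤ r + s * p)]
    _ ≤ 2 * s ^ 2 * t ^ 4 := hsq
    _ = 2 * s * t ^ 4 * s := by ring

/-- The factor by which the Taylor expansion of the square root corrects the leading moment. -/
noncomputable def momentRatio (x : ℝ) : ℝ :=
  1 - 3 / 8 * (1 / (2 * x + 1)) - 9 / 128 * (3 / ((2 * x + 1) * (2 * x + 3))) -
    27 / 1024 * (15 / ((2 * x + 1) * (2 * x + 3) * (2 * x + 5)))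

lemma betaMoment_combination (m : ℕ) :
    betaMoment m 0 - 3 / 8 * betaMoment m 1 - 9 / 128 * betaMoment m 2
        - 27 / 1024 * betaMoment m 3 = betaMoment m 0 * momentRatio (m + 1) := by
  rw [betaMoment_succ_right m 2, betaMoment_succ_right m 1, betaMoment_succ_right m 0,
    momentRatio]
  push_cast
  field_simp
  ring

lemma betaMoment_four_le (m : ℕ) :
    betaMoment m 4 ≤ 7 * betaMoment m 0 / ((m : ℝ) + 1) ^ 4 := by
  have hr := betaMoment_zero_pos m
  rw [betaMoment_succ_right m 3, betaMoment_succ_right m 2, betaMoment_succ_right m 1,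
    betaMoment_succ_right m 0]
  have h : ((2 * (3 : ℕ) + 1) / (2 * ((m : ℝ) + 1) + 2 * (3 : ℕ) + 1) *
      ((2 * (2 : ℕ) + 1) / (2 * ((m : ℝ) + 1) + 2 * (2 : ℕ) + 1) *
      ((2 * (1 : ℕ) + 1) / (2 * ((m : ℝ) + 1) + 2 * (1 : ℕ) + 1) *
      ((2 * (0 : ℕ) + 1) / (2 * ((m : ℝ) + 1) + 2 * (0 : ℕ) + 1))))) ≤
      7 / (2 * ((m : ℝ) + 1)) * (5 / (2 * ((m : ℝ) + 1)) * (3 / (2 * ((m : ℝ) + 1)) *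
      (1 / (2 * ((m : ℝ) + 1))))) := by
    gcongr <;> norm_num <;> linarith
  calc _ = _ * betaMoment m 0 := by ring
    _ ≤ _ * betaMoment m 0 := mul_le_mul_of_nonneg_right h hr.le
    _ = 105 / 16 * (betaMoment m 0 / ((m : ℝ) + 1) ^ 4) := by field_simp; ring
    _ ≤ 7 * (betaMoment m 0 / ((m : ℝ) + 1) ^ 4) := by gcongr; norm_num
    _ = _ := by ring

lemma abs_momentRatio_le_one {x : ℝ} (hx : 1 ≤ x) : |momentRatio x| ≤ 1 := by
  have hx0 : 0 < x := by linarith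
  have h1 : 1 / (2 * x + 1) ≤ 1 := by rw [div_le_one (by positivity)]; linarith
  have h2 : 3 / ((2 * x + 1) * (2 * x + 3)) ≤ 1 := by
    rw [div_le_one (by positivity)]; nlinarith
  have h3 : 15 / ((2 * x + 1) * (2 * x + 3) * (2 * x + 5)) ≤ 1 := by
    rw [div_le_one (by positivity)]
    calc (15 : ℝ) ≤ 3 * 5 * 7 := by norm_num
      _ ≤ _ := by gcongr <;> linarith
  have h1' : 0 ≤ 1 / (2 * x + 1) := by positivity
  have h2' : 0 ≤ 3 / ((2 * x + 1) * (2 * x + 3)) := by positivity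
  have h3' : 0 ≤ 15 / ((2 * x + 1) * (2 * x + 3) * (2 * x + 5)) := by positivity
  rw [momentRatio, abs_le]
  constructor <;> linarith

lemma abs_expansion_mul_momentRatio_sub_le {x : ℝ} (hx : 1 ≤ x) :
    |(1 + 1 / (8 * x) + 1 / (128 * x ^ 2) - 5 / (1024 * x ^ 3)) * momentRatio x -
      (1 - 1 / (16 * x) + 13 / (512 * x ^ 2) + 65 / (8192 * x ^ 3))| ≤ 1 / x ^ 4 := by
  have hx0 : 0 < x := by linarith
  obtain ⟨d, hd⟩ : ∃ d, d = (2 * x + 1) * (2 * x + 3) * (2 * x + 5) := ⟨_, rfl⟩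
  obtain ⟨n, hn⟩ : ∃ n, n = (1024 * x ^ 3 + 128 * x ^ 2 + 8 * x - 5) *
      (1024 * d - 384 * ((2 * x + 3) * (2 * x + 5)) - 216 * (2 * x + 5) - 405) -
      128 * d * (8192 * x ^ 3 - 512 * x ^ 2 + 208 * x + 65) := ⟨_, rfl⟩
  have hd0 : 0 < d := by rw [hd]; positivity
  have h : (1 + 1 / (8 * x) + 1 / (128 * x ^ 2) - 5 / (1024 * x ^ 3)) * momentRatio x -
      (1 - 1 / (16 * x) + 13 / (512 * x ^ 2) + 65 / (8192 * x ^ 3)) =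
      n / (1048576 * x ^ 3 * d) := by
    rw [momentRatio, hn, hd]
    field_simp
    ring
  have hbound : |x * n| ≤ 1048576 * d := by
    obtain ⟨t, ht, rfl⟩ : ∃ t : ℝ, 0 ≤ t ∧ x = t + 1 := ⟨x - 1, by linarith, by ring⟩
    rw [abs_le, ← sub_nonneg, ← sub_nonneg (b := (t + 1) * n), hn, hd]
    constructor <;> ring_nf <;> positivity
  rw [abs_mul, abs_of_pos hx0] at hbound
  rw [h, abs_div, abs_of_pos (by positivity : 0 < 1048576 * x ^ 3 * d),
    div_le_div_iff₀ (by positivity) (by positivity)]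
  calc |n| * x ^ 4 = x * |n| * x ^ 3 := by ring
    _ ≤ 1048576 * d * x ^ 3 := by gcongr
    _ = 1 * (1048576 * x ^ 3 * d) := by ring

lemma nat_pow_five_le (N : ℕ) : N ^ 5 ≤ 13 * 3 ^ N := by
  rcases lt_or_ge N 5 with h | h
  · interval_cases N <;> norm_num
  · induction N, h using Nat.le_induction with
    | base => norm_num
    | succ n hn ih =>
      obtain ⟨k, rfl⟩ := Nat.exists_eq_add_of_le hn
      have : (5 + k + 1) ^ 5 ≤ 3 * (5 + k) ^ 5 := by
        ring_nf
        linarith [Nat.zero_le k, Nat.zero_le (k ^ 2), Nat.zero_le (k ^ 3), Nat.zero_le (k ^ 4),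
          Nat.zero_le (k ^ 5)]
      calc _ ≤ 3 * (5 + k) ^ 5 := this
        _ ≤ 3 * (13 * 3 ^ (5 + k)) := by gcongr
        _ = _ := by ring

lemma abs_integral_sqrt_sub_expansion_le (m : ℕ) {x s : ℝ} (hx : x = m + 1) (hs : 0 < s)
    (hsx : s ^ 2 * x = π / 4) :
    |(∫ y in (0 : ℝ)..(2 / √3), (1 - y ^ 2) ^ m * √(1 - 3 / 4 * y ^ 2)) -
      s * (1 - 1 / (16 * x) + 13 / (512 * x ^ 2) + 65 / (8192 * x ^ 3))| ≤
      109 * s / x ^ 4 := by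
  have hx1 : 1 ≤ x := by rw [hx]; linarith [(Nat.cast_nonneg m : (0 : ℝ) ≤ m)]
  have hx0 : 0 < x := by linarith
  have hint := abs_integral_sqrt_sub_le m
  have h4 := betaMoment_four_le m
  have hr := abs_betaMoment_zero_sub_le m hx hs hsx
  have hR := abs_momentRatio_le_one hx1
  have hP := abs_expansion_mul_momentRatio_sub_le hx1
  rw [betaMoment_combination, ← hx] at hint
  rw [← hx] at h4
  set r := betaMoment m 0
  set p := 1 + 1 / (8 * x) + 1 / (128 * x ^ 2) - 5 / (1024 * x ^ 3) with hp
  set P := 1 - 1 / (16 * x) + 13 / (512 * x ^ 2) + 65 / (8192 * x ^ 3)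
  set I := ∫ y in (0 : ℝ)..(2 / √3), (1 - y ^ 2) ^ m * √(1 - 3 / 4 * y ^ 2)
  have hinv : ∀ k : ℕ, 1 / x ^ k ≤ 1 := fun k => by
    rw [div_le_one (by positivity)]; exact one_le_pow₀ hx1
  have hr4 : r ≤ 4 * s := by
    have hp2 : p ≤ 2 := by
      have e : p = 1 + 1 / 8 * (1 / x ^ 1) + 1 / 128 * (1 / x ^ 2) - 5 / 1024 * (1 / x ^ 3) := by
        rw [hp]; field_simp
      have h3 : 0 ≤ 1 / x ^ 3 := by positivity
      linarith [hinv 1, hinv 2]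
    have h1 := (abs_le.mp hr).2
    have h2 := mul_le_mul_of_nonneg_left (hinv 4) hs.le
    have h3 := mul_le_mul_of_nonneg_left hp2 hs.le
    have h5 : 2 * s / x ^ 4 = 2 * (s * (1 / x ^ 4)) := by ring
    linarith
  have h4' : betaMoment m 4 ≤ 28 * s / x ^ 4 := by
    exact h4.trans (div_le_div_of_nonneg_right (by linarith) (by positivity))
  have htail : (1 / 3 : ℝ) ^ m ≤ 78 * s / x ^ 4 := by
    have hN : x ^ 5 ≤ 13 * 3 ^ (m + 1) := by
      rw [hx]; exact_mod_cast nat_pow_five_le (m + 1)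
    have hsx2 : 1 ≤ 2 * s * x := by
      have hpi := pi_gt_three
      have : 1 ≤ (2 * s * x) ^ 2 := by
        rw [show (2 * s * x) ^ 2 = 4 * (s ^ 2 * x) * x by ring, hsx]
        nlinarith
      nlinarith [mul_pos hs hx0]
    rw [one_div, inv_pow, inv_eq_one_div, div_le_div_iff₀ (by positivity) (by positivity)]
    calc 1 * x ^ 4 ≤ (2 * s * x) * x ^ 4 := by gcongr
      _ = 2 * s * x ^ 5 := by ring
      _ ≤ 2 * s * (13 * 3 ^ (m + 1)) := by gcongr
      _ = 78 * s * 3 ^ m := by ring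
  have hA : |(r - s * p) * momentRatio x| ≤ 2 * s / x ^ 4 := by
    rw [abs_mul]
    exact (mul_le_of_le_one_right (abs_nonneg _) hR).trans hr
  have hB : |s * (p * momentRatio x - P)| ≤ s / x ^ 4 := by
    rw [abs_mul, abs_of_pos hs, div_eq_mul_one_div]
    gcongr
  calc |I - s * P| = |(I - r * momentRatio x) + ((r - s * p) * momentRatio x +
        s * (p * momentRatio x - P))| := by congr 1; ring
    _ ≤ |I - r * momentRatio x| + (|(r - s * p) * momentRatio x| +
        |s * (p * momentRatio x - P)|) :=
      (abs_add_le _ _).trans (by gcongr; exact abs_add_le _ _)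
    _ ≤ (28 * s / x ^ 4 + 78 * s / x ^ 4) + (2 * s / x ^ 4 + s / x ^ 4) := by
      gcongr
      exact hint.trans (by gcongr)
    _ = 109 * s / x ^ 4 := by ring

theorem stmt_17 :
    ∃ C : ℝ, 0 < C ∧ ∀ N : ℕ, 1 ≤ N →
      |(((Finset.Ico (3 ^ (N - 1)) (3 ^ N)).filter
            (fun n => (Nat.digits 3 (2 * n)).sum < (Nat.digits 3 n).sum)).card : ℝ) -
          3 ^ N * (1 / 3 + (Real.sqrt 3 / Real.sqrt (π * N)) *
            (-(1 / 3) + 1 / (48 * N) - 13 / (1536 * (N : ℝ) ^ 2)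
              - 65 / (24576 * (N : ℝ) ^ 3)))| ≤
        C * 3 ^ N * (N : ℝ) ^ (-(9 / 2 : ℝ)) := by
  refine ⟨109 * √3 / (3 * √π), by positivity, fun N hN => ?_⟩
  obtain ⟨m, rfl⟩ := Nat.exists_eq_add_of_le' hN
  rw [Nat.add_sub_cancel, card_flimsy, integral_cos_eq_integral_sqrt]
  obtain ⟨x, hx⟩ : ∃ x : ℝ, x = ((m + 1 : ℕ) : ℝ) := ⟨_, rfl⟩
  rw [← hx]
  have hx0 : 0 < x := by rw [hx]; positivity
  have hpi := pi_pos
  have hsqpi : √π ^ 2 = π := sq_sqrt hpi.le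
  have hsqx : √x ^ 2 = x := sq_sqrt hx0.le
  have hspi : 0 < √π := by positivity
  have hsx : 0 < √x := by positivity
  have hrpow : x ^ (-(9 / 2 : ℝ)) = 1 / (x ^ 4 * √x) := by
    rw [rpow_neg hx0.le, show (9 / 2 : ℝ) = (4 : ℕ) + 1 / 2 by norm_num,
      rpow_add hx0, rpow_natCast, ← sqrt_eq_rpow, one_div]
  have key := abs_integral_sqrt_sub_expansion_le m (x := x) (s := √π / (2 * √x))
    (by rw [hx]; push_cast; ring) (by positivity)
    (by rw [div_pow, mul_pow, hsqpi, hsqx]; field_simp; norm_num)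
  set I := ∫ y in (0 : ℝ)..(2 / √3), (1 - y ^ 2) ^ m * √(1 - 3 / 4 * y ^ 2)
  have hfac : (3 ^ m - 3 ^ m * (2 * √3) * I / π) -
      3 ^ (m + 1) * (1 / 3 + √3 / √(π * x) *
        (-(1 / 3) + 1 / (48 * x) - 13 / (1536 * x ^ 2) - 65 / (24576 * x ^ 3))) =
      -(3 ^ m * (2 * √3) / π) * (I - √π / (2 * √x) *
        (1 - 1 / (16 * x) + 13 / (512 * x ^ 2) + 65 / (8192 * x ^ 3))) := by
    rw [sqrt_mul hpi.le]
    have h1 : √3 / (√π * √x) = 2 * √3 / π * (√π / (2 * √x)) := by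
      rw [← hsqpi, sqrt_sq hspi.le]
      field_simp
    rw [h1]
    ring
  rw [hfac, abs_mul, abs_neg, abs_of_pos (by positivity), hrpow]
  calc _ ≤ 3 ^ m * (2 * √3) / π * (109 * (√π / (2 * √x)) / x ^ 4) := by gcongr
    _ = _ := by
      rw [← hsqpi, sqrt_sq hspi.le]
      field_simp
      ring
end

section
/- Let E₃(N) denote the number of integers n with 2^{N−1} ≤ n < 2^N such that s_2(3n) = s_2(n) (the 3-equal numbers with N bits), and let c = √6/(4√π). Then E₃(N) = 2^N·(c·N^{−1/2} + O(N^{−3/2})); that is, there exists a constant C > 0 such that for all integers N ≥ 1, |E₃(N) − c·2^N·N^{−1/2}| ≤ C·2^N·N^{−3/2}. -/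
open Finset Real

namespace ThreeEqual

/-- The digit-sum increment `s₂(3n + r) - s₂(n)`. -/
def digitDiff (r n : ℕ) : ℤ :=
  ((Nat.digits 2 (3 * n + r)).sum : ℤ) - ((Nat.digits 2 n).sum : ℤ)

/-- The sum of `f` over the increments `s₂(3n + r) - s₂(n)` of all `n < 2 ^ N`. -/
def digitDiffSum (r : ℕ) (f : ℤ → ℝ) (N : ℕ) : ℝ :=
  ∑ n ∈ range (2 ^ N), f (digitDiff r n)

lemma sum_digits_two_mul (m : ℕ) : (Nat.digits 2 (2 * m)).sum = (Nat.digits 2 m).sum := by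
  rcases Nat.eq_zero_or_pos m with rfl | hm
  · simp
  · rw [Nat.digits_def' (by norm_num) (by lia)]
    simp

lemma sum_digits_two_mul_add_one (m : ℕ) :
    (Nat.digits 2 (2 * m + 1)).sum = (Nat.digits 2 m).sum + 1 := by
  rw [Nat.digits_def' (by norm_num) (by lia), show (2 * m + 1) % 2 = 1 by lia,
    show (2 * m + 1) / 2 = m by lia]
  simp [add_comm]

lemma sum_range_two_mul (g : ℕ → ℝ) (M : ℕ) :
    ∑ n ∈ range (2 * M), g n = ∑ n ∈ range M, g (2 * n) + ∑ n ∈ range M, g (2 * n + 1) := by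
  induction M with
  | zero => simp
  | succ M ih =>
    rw [show 2 * (M + 1) = 2 * M + 1 + 1 by ring, sum_range_succ, sum_range_succ, ih,
      sum_range_succ, sum_range_succ]
    ring

lemma digitDiffSum_succ (r : ℕ) (f : ℤ → ℝ) (N : ℕ) :
    digitDiffSum r f (N + 1) = ∑ n ∈ range (2 ^ N), f (digitDiff r (2 * n)) +
      ∑ n ∈ range (2 ^ N), f (digitDiff r (2 * n + 1)) := by
  rw [digitDiffSum, pow_succ', sum_range_two_mul]

lemma digitDiffSum_zero_succ (f : ℤ → ℝ) (N : ℕ) :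
    digitDiffSum 0 f (N + 1) = digitDiffSum 0 f N + digitDiffSum 1 f N := by
  rw [digitDiffSum_succ, digitDiffSum, digitDiffSum]
  congr 1 <;> refine sum_congr rfl fun n _ => congrArg f ?_ <;> unfold digitDiff
  · rw [show 3 * (2 * n) + 0 = 2 * (3 * n + 0) by ring, sum_digits_two_mul, sum_digits_two_mul]
  · rw [show 3 * (2 * n + 1) + 0 = 2 * (3 * n + 1) + 1 by ring, sum_digits_two_mul_add_one,
      sum_digits_two_mul_add_one]
    push_cast
    ring

lemma digitDiffSum_one_succ (f : ℤ → ℝ) (N : ℕ) :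
    digitDiffSum 1 f (N + 1) =
      digitDiffSum 0 (fun d => f (d + 1)) N + digitDiffSum 2 (fun d => f (d - 1)) N := by
  rw [digitDiffSum_succ, digitDiffSum, digitDiffSum]
  congr 1 <;> refine sum_congr rfl fun n _ => congrArg f ?_ <;> unfold digitDiff
  · rw [show 3 * (2 * n) + 1 = 2 * (3 * n + 0) + 1 by ring, sum_digits_two_mul_add_one,
      sum_digits_two_mul]
    push_cast
    ring
  · rw [show 3 * (2 * n + 1) + 1 = 2 * (3 * n + 2) by ring, sum_digits_two_mul,
      sum_digits_two_mul_add_one]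
    push_cast
    ring

lemma digitDiffSum_two_succ (f : ℤ → ℝ) (N : ℕ) :
    digitDiffSum 2 f (N + 1) = digitDiffSum 1 f N + digitDiffSum 2 f N := by
  rw [digitDiffSum_succ, digitDiffSum, digitDiffSum]
  congr 1 <;> refine sum_congr rfl fun n _ => congrArg f ?_ <;> unfold digitDiff
  · rw [show 3 * (2 * n) + 2 = 2 * (3 * n + 1) by ring, sum_digits_two_mul, sum_digits_two_mul]
  · rw [show 3 * (2 * n + 1) + 2 = 2 * (3 * n + 2) + 1 by ring, sum_digits_two_mul_add_one,
      sum_digits_two_mul_add_one]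
    push_cast
    ring

lemma digitDiffSum_one_add_two (f : ℤ → ℝ) (N : ℕ) :
    digitDiffSum 1 f (N + 2) = digitDiffSum 1 f (N + 1) +
      (digitDiffSum 1 (fun d => f (d + 1)) N + digitDiffSum 1 (fun d => f (d - 1)) N) := by
  rw [digitDiffSum_one_succ f (N + 1), digitDiffSum_zero_succ, digitDiffSum_two_succ,
    digitDiffSum_one_succ f N]
  ring

/-- The cosine transform of the increments `s₂(3n + 1) - s₂(n)` for `n < 2 ^ N`. -/
noncomputable def cosSum (N : ℕ) (x : ℝ) : ℝ :=
  digitDiffSum 1 (fun d => cos (d * x)) N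

lemma cosSum_zero (x : ℝ) : cosSum 0 x = cos x := by
  simp [cosSum, digitDiffSum, digitDiff]

lemma cosSum_one (x : ℝ) : cosSum 1 x = 1 + cos x := by
  simp [cosSum, digitDiffSum, digitDiff, sum_range_succ, add_comm]

lemma cosSum_add_two (N : ℕ) (x : ℝ) :
    cosSum (N + 2) x = cosSum (N + 1) x + 2 * cos x * cosSum N x := by
  rw [cosSum, digitDiffSum_one_add_two, ← cosSum]
  congr 1
  simp only [cosSum, digitDiffSum, mul_sum, ← sum_add_distrib]
  refine sum_congr rfl fun n _ => ?_
  push_cast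
  rw [add_mul, sub_mul, one_mul, cos_add, cos_sub]
  ring

lemma continuous_cosSum (N : ℕ) : Continuous (cosSum N) := by
  unfold cosSum digitDiffSum
  fun_prop

lemma integral_cos_int_mul (d : ℤ) :
    ∫ x in (0 : ℝ)..π, cos (d * x) = if d = 0 then π else 0 := by
  split_ifs with h
  · simp [h]
  · rw [intervalIntegral.integral_comp_mul_left _ (Int.cast_ne_zero.mpr h)]
    simp [sin_int_mul_pi]

lemma integral_cosSum (N : ℕ) :
    ∫ x in (0 : ℝ)..π, cosSum N x =
      π * digitDiffSum 1 (fun d => if d = 0 then 1 else 0) N := by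
  unfold cosSum digitDiffSum
  rw [intervalIntegral.integral_finsetSum]
  · simp_rw [integral_cos_int_mul, mul_sum, mul_ite, mul_one, mul_zero]
  · intro i _
    exact Continuous.intervalIntegrable (by fun_prop) _ _

lemma card_filter_range (N : ℕ) :
    (((range (2 ^ N)).filter
      (fun n => (Nat.digits 2 (3 * n)).sum = (Nat.digits 2 n).sum)).card : ℝ) =
      digitDiffSum 0 (fun d => if d = 0 then 1 else 0) N := by
  rw [digitDiffSum, ← sum_boole]
  refine sum_congr rfl fun n _ => ?_
  simp only [digitDiff, add_zero, sub_eq_zero, Nat.cast_inj]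

lemma card_filter_Ico (N : ℕ) :
    (((Ico (2 ^ N) (2 ^ (N + 1))).filter
      (fun n => (Nat.digits 2 (3 * n)).sum = (Nat.digits 2 n).sum)).card : ℝ) =
      digitDiffSum 1 (fun d => if d = 0 then 1 else 0) N := by
  have h := digitDiffSum_zero_succ (fun d => if d = 0 then 1 else 0) N
  rw [← card_filter_range, ← card_filter_range] at h
  have hle : 2 ^ N ≤ 2 ^ (N + 1) := Nat.pow_le_pow_right (by norm_num) (by lia)
  rw [← sum_boole, ← sum_boole] at h
  rw [← sum_boole, sum_Ico_eq_sub _ hle, h]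
  ring

/-- The deviation of the normalised cosine transform from half a Gaussian. -/
noncomputable def gaussError (x : ℝ) (n : ℕ) : ℝ :=
  cosSum n x / 2 ^ (n + 1) - exp (-(x ^ 2 / 6)) ^ (n + 1) / 2

lemma gaussError_add_two (x : ℝ) (n : ℕ) :
    gaussError x (n + 2) = gaussError x (n + 1) / 2 + cos x / 2 * gaussError x n +
      exp (-(x ^ 2 / 6)) ^ (n + 1) / 2 *
        (exp (-(x ^ 2 / 6)) / 2 + cos x / 2 - exp (-(x ^ 2 / 6)) ^ 2) := by
  unfold gaussError
  rw [cosSum_add_two]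
  field_simp
  ring

lemma abs_exp_neg_sub_le {y : ℝ} (hy : 0 ≤ y) (hy1 : y ≤ 1) :
    |exp (-y) - (1 - y)| ≤ y ^ 2 := by
  have h := Real.abs_exp_sub_one_sub_id_le (x := -y) (by rw [abs_neg, abs_of_nonneg hy]; exact hy1)
  rwa [neg_sq, show exp (-y) - 1 - -y = exp (-y) - (1 - y) by ring] at h

lemma abs_gauss_defect_le (x : ℝ) :
    |exp (-(x ^ 2 / 6)) / 2 + cos x / 2 - exp (-(x ^ 2 / 6)) ^ 2| ≤ 2 * x ^ 4 := by
  rcases le_or_gt |x| 1 with hx | hx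
  · have hx2 : x ^ 2 ≤ 1 := (sq_le_one_iff_abs_le_one x).mpr hx
    have h0 := sq_nonneg x
    have h1 := abs_le.mp (abs_exp_neg_sub_le (y := x ^ 2 / 6) (by linarith) (by linarith))
    have h2 := abs_le.mp (abs_exp_neg_sub_le (y := x ^ 2 / 3) (by linarith) (by linarith))
    have h3 := abs_le.mp (cos_bound hx)
    have h4 : |x| ^ 4 = x ^ 4 := by rw [show (4 : ℕ) = 2 * 2 by rfl, pow_mul, pow_mul, sq_abs]
    have h5 : exp (-(x ^ 2 / 6)) ^ 2 = exp (-(x ^ 2 / 3)) := by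
      rw [← exp_nat_mul]
      congr 1
      push_cast
      ring
    rw [h4] at h3
    rw [h5]
    have h6 : 0 ≤ x ^ 4 := by positivity
    have h7 : (x ^ 2 / 6) ^ 2 = x ^ 4 / 36 := by ring
    have h8 : (x ^ 2 / 3) ^ 2 = x ^ 4 / 9 := by ring
    rw [h7] at h1
    rw [h8] at h2
    rw [abs_le]
    constructor <;> linarith
  · have h1 : 1 ≤ x ^ 2 := by
      rw [← sq_abs]
      nlinarith
    have h2 : exp (-(x ^ 2 / 6)) ≤ 1 := exp_le_one_iff.mpr (by linarith)
    have h3 := exp_pos (-(x ^ 2 / 6))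
    have h4 := cos_le_one x
    have h5 := neg_one_le_cos x
    rw [abs_le]
    constructor <;> nlinarith

lemma exp_neg_pow_le_one {y : ℝ} (hy : 0 ≤ y) (n : ℕ) : exp (-y) ^ n ≤ 1 :=
  pow_le_one₀ (exp_pos _).le (exp_le_one_iff.mpr (by linarith))

lemma half_le_exp_pow_three {x : ℝ} (hx : |x| ≤ π) : 1 / 2 ≤ exp (-(x ^ 2 / 100)) ^ 3 := by
  have h1 : x ^ 2 ≤ 10 := by
    have := pi_lt_d2
    have h := abs_nonneg x
    rw [← sq_abs]
    nlinarith
  rw [← exp_nat_mul]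
  have := add_one_le_exp (((3 : ℕ) : ℝ) * -(x ^ 2 / 100))
  push_cast at this ⊢
  linarith

lemma contraction_le {x : ℝ} (hx : |x| ≤ π) :
    |1 / 4 + cos x / 2| * exp (-(x ^ 2 / 100)) + |cos x| / 4 ≤ exp (-(x ^ 2 / 100)) ^ 3 := by
  have hhalf := half_le_exp_pow_three hx
  have hp0 := exp_pos (-(x ^ 2 / 100))
  have hx2 := sq_nonneg x
  have hp1 : exp (-(x ^ 2 / 100)) ≤ 1 := exp_le_one_iff.mpr (by linarith)
  have hpl := add_one_le_exp (-(x ^ 2 / 100))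
  set p := exp (-(x ^ 2 / 100))
  rcases le_or_gt 0 (cos x) with hc | hc
  · rw [abs_of_nonneg hc, abs_of_nonneg (by linarith)]
    have hcu : cos x ≤ 1 - x ^ 2 / 5 := by
      have h := cos_le_one_sub_mul_cos_sq hx
      have h1 : (1 : ℝ) / 5 ≤ 2 / π ^ 2 := by
        rw [div_le_div_iff₀ (by norm_num) (by positivity)]
        have := pi_lt_d2
        nlinarith [pi_pos]
      nlinarith
    have h1 : cos x * p ≤ (1 - x ^ 2 / 5) * p := mul_le_mul_of_nonneg_right hcu hp0.le
    have h2 : (1 - p) * (p ^ 2 + p + 1 / 4) ≤ (1 - p) * (9 / 4) :=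
      mul_le_mul_of_nonneg_left (by nlinarith) (by linarith)
    nlinarith [mul_nonneg hx2 hp0.le]
  · refine le_trans ?_ hhalf
    have h1 : |1 / 4 + cos x / 2| * p ≤ |1 / 4 + cos x / 2| :=
      mul_le_of_le_one_right (abs_nonneg _) hp1
    have h2 := neg_one_le_cos x
    have h3 : |1 / 4 + cos x / 2| ≤ 1 / 2 + cos x / 4 := by
      rw [abs_le]
      constructor <;> linarith
    rw [abs_of_neg hc]
    linarith

lemma abs_gaussError_le {x : ℝ} (hx : |x| ≤ π) (n : ℕ) :
    |gaussError x n| ≤ 4 * (x ^ 2 + n * x ^ 4) * exp (-(x ^ 2 / 100)) ^ n := by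
  have hhalf := half_le_exp_pow_three hx
  have hcon := contraction_le hx
  have hdef := abs_gauss_defect_le x
  have hx2 := sq_nonneg x
  have hp0 := exp_pos (-(x ^ 2 / 100))
  have hp1 : exp (-(x ^ 2 / 100)) ≤ 1 := exp_le_one_iff.mpr (by linarith)
  have hq0 := exp_pos (-(x ^ 2 / 6))
  have hq1 : exp (-(x ^ 2 / 6)) ≤ 1 := exp_le_one_iff.mpr (by linarith)
  have hqp : exp (-(x ^ 2 / 6)) ≤ exp (-(x ^ 2 / 100)) := exp_le_exp.mpr (by linarith)
  have hql := add_one_le_exp (-(x ^ 2 / 6))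
  have hc1 := cos_le_one x
  have hc0 := neg_one_le_cos x
  have hcl := one_sub_sq_div_two_le_cos (x := x)
  have hrec := gaussError_add_two x
  have e0 : gaussError x 0 = cos x / 2 - exp (-(x ^ 2 / 6)) / 2 := by
    simp [gaussError, cosSum_zero]
  have e1 : gaussError x 1 = (1 + cos x) / 4 - exp (-(x ^ 2 / 6)) ^ 2 / 2 := by
    simp only [gaussError, cosSum_one]
    norm_num
  have e2 : gaussError x 2 =
      (1 + cos x + 2 * cos x ^ 2) / 8 - exp (-(x ^ 2 / 6)) ^ 3 / 2 := by
    have h : cosSum 2 x = cosSum 1 x + 2 * cos x * cosSum 0 x := cosSum_add_two 0 x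
    rw [gaussError, h, cosSum_one, cosSum_zero]
    ring
  set p := exp (-(x ^ 2 / 100))
  set q := exp (-(x ^ 2 / 6))
  set c := cos x
  have h4 : 0 ≤ x ^ 4 := by positivity
  have hpow : ∀ k ≤ 3, 1 / 2 ≤ p ^ k := fun k hk =>
    hhalf.trans (pow_le_pow_of_le_one hp0.le hp1 hk)
  have h_start : ∀ k ≤ 3, |gaussError x k| ≤ 2 * x ^ 2 →
      |gaussError x k| ≤ 4 * (x ^ 2 + k * x ^ 4) * p ^ k := by
    intro k hk h
    have h1 := hpow k hk
    have h2 : (0 : ℝ) ≤ k * x ^ 4 := by positivity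
    nlinarith
  induction n using Nat.strong_induction_on with
  | _ n ih =>
  match n with
  | 0 =>
    refine h_start 0 (by lia) ?_
    rw [e0, abs_le]
    constructor <;> linarith
  | 1 =>
    refine h_start 1 (by lia) ?_
    rw [e1, abs_le]
    constructor <;> nlinarith
  | 2 =>
    refine h_start 2 (by lia) ?_
    have h3 : 1 - x ^ 2 / 2 ≤ q ^ 3 := by
      have : (1 - q) * (1 + q + q ^ 2) ≤ (1 - q) * 3 :=
        mul_le_mul_of_nonneg_left (by nlinarith) (by linarith)
      nlinarith
    have h3' : q ^ 3 ≤ 1 := pow_le_one₀ hq0.le hq1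
    have hcs : 1 - x ^ 2 ≤ c ^ 2 := by nlinarith
    have hcs' : c ^ 2 ≤ 1 := by nlinarith
    rw [e2, abs_le]
    constructor <;> linarith
  | n + 3 =>
    have i0 := ih n (by lia)
    have i1 := ih (n + 1) (by lia)
    set δ := q / 2 + c / 2 - q ^ 2
    have hstep : gaussError x (n + 3) =
        (1 / 4 + c / 2) * gaussError x (n + 1) + c / 4 * gaussError x n +
          (q ^ (n + 1) / 4 + q ^ (n + 2) / 2) * δ := by
      rw [hrec (n + 1), hrec n]
      ring
    have hqn : ∀ k, q ^ (n + k) ≤ p ^ n := fun k => by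
      rw [pow_add]
      exact (mul_le_of_le_one_right (by positivity) (pow_le_one₀ hq0.le hq1)).trans
        (pow_le_pow_left₀ hq0.le hqp n)
    have hpn : 0 < p ^ n := pow_pos hp0 n
    have t3 : |(q ^ (n + 1) / 4 + q ^ (n + 2) / 2) * δ| ≤ p ^ n * (2 * x ^ 4) := by
      rw [abs_mul, abs_of_pos (by positivity)]
      refine mul_le_mul ?_ hdef (abs_nonneg _) hpn.le
      linarith [hqn 1, hqn 2]
    have t1 : |(1 / 4 + c / 2) * gaussError x (n + 1)| ≤
        |1 / 4 + c / 2| * p * (4 * (x ^ 2 + (n + 1) * x ^ 4) * p ^ n) := by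
      rw [abs_mul, mul_assoc]
      refine mul_le_mul_of_nonneg_left (i1.trans_eq ?_) (abs_nonneg _)
      push_cast
      ring
    have t2 : |c / 4 * gaussError x n| ≤
        |c| / 4 * (4 * (x ^ 2 + (n + 1) * x ^ 4) * p ^ n) := by
      rw [abs_mul, abs_div, abs_of_pos (show (0 : ℝ) < 4 by norm_num)]
      refine mul_le_mul_of_nonneg_left (i0.trans ?_) (by positivity)
      gcongr
      linarith
    rw [hstep]
    calc _ ≤ |(1 / 4 + c / 2) * gaussError x (n + 1)| + |c / 4 * gaussError x n| +
          |(q ^ (n + 1) / 4 + q ^ (n + 2) / 2) * δ| := abs_add_three _ _ _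
      _ ≤ (|1 / 4 + c / 2| * p + |c| / 4) * (4 * (x ^ 2 + (n + 1) * x ^ 4) * p ^ n) +
          p ^ n * (2 * x ^ 4) := by linarith
      _ ≤ p ^ 3 * (4 * (x ^ 2 + (n + 1) * x ^ 4) * p ^ n) + p ^ 3 * (p ^ n * (8 * x ^ 4)) := by
        refine add_le_add (mul_le_mul_of_nonneg_right hcon (by positivity)) ?_
        have : 0 ≤ p ^ n * x ^ 4 := by positivity
        nlinarith
      _ = 4 * (x ^ 2 + (n + 3 : ℕ) * x ^ 4) * p ^ (n + 3) := by
        push_cast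
        ring

lemma mul_exp_neg_le {a u : ℝ} (ha : 0 < a) : u * exp (-(u / a)) ≤ a := by
  have h := add_one_le_exp (u / a)
  rw [exp_neg, ← div_eq_mul_inv, div_le_iff₀ (exp_pos _)]
  have : u = a * (u / a) := by field_simp
  nlinarith

/-- The moment bound that turns the pointwise error into an integrable Gaussian one. -/
lemma mul_moment_le (u : ℝ) (hu : 0 ≤ u) :
    u * (1 + u) * exp (-(u / 100)) ≤ 180000 * exp (-(u / 200)) := by
  have h1 : u * exp (-(u / 400)) ≤ 400 := mul_exp_neg_le (by norm_num)
  have h2 : exp (-(u / 400)) ≤ 1 := exp_le_one_iff.mpr (by linarith)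
  have h3 := exp_pos (-(u / 400))
  have h4 : exp (-(u / 100)) = exp (-(u / 400)) * exp (-(u / 400)) * exp (-(u / 200)) := by
    rw [← exp_add, ← exp_add]
    congr 1
    ring
  rw [h4]
  calc _ = (u * exp (-(u / 400))) * (exp (-(u / 400)) + u * exp (-(u / 400))) *
        exp (-(u / 200)) := by ring
    _ ≤ 400 * (1 + 400) * exp (-(u / 200)) := by gcongr
    _ ≤ _ := by
      gcongr
      norm_num

lemma abs_gaussError_le_gaussian {x : ℝ} (hx : |x| ≤ π) (n : ℕ) :
    |gaussError x n| ≤ 1440000 / (n + 1 : ℝ) * exp (-((n + 1 : ℝ) / 200) * x ^ 2) := by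
  have hpos : (0 : ℝ) < n + 1 := by positivity
  have h := abs_gaussError_le hx n
  have hhalf := (half_le_exp_pow_three hx).trans
    (pow_le_pow_of_le_one (exp_pos _).le (exp_le_one_iff.mpr (by nlinarith)) (show 1 ≤ 3 by lia))
  have hm := mul_moment_le ((n + 1) * x ^ 2) (by positivity)
  have hp : exp (-(((n : ℝ) + 1) * x ^ 2 / 100)) = exp (-(x ^ 2 / 100)) ^ (n + 1) := by
    rw [← exp_nat_mul]
    congr 1
    push_cast
    ring
  rw [show -((n + 1 : ℝ) / 200) * x ^ 2 = -((n + 1) * x ^ 2 / 200) by ring, div_mul_eq_mul_div,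
    le_div_iff₀ hpos]
  rw [hp, pow_succ (exp (-(x ^ 2 / 100)))] at hm
  rw [pow_one] at hhalf
  set p := exp (-(x ^ 2 / 100))
  have hpn : 0 < p ^ n := pow_pos (exp_pos _) n
  have h4 : 0 ≤ x ^ 4 := by positivity
  calc |gaussError x n| * (n + 1) ≤ 4 * (x ^ 2 + n * x ^ 4) * p ^ n * (n + 1) := by gcongr
    _ ≤ 4 * (x ^ 2 + (n + 1) * x ^ 4) * p ^ n * (n + 1) := by
      gcongr
      linarith
    _ = 4 * ((n + 1) * x ^ 2 * (1 + (n + 1) * x ^ 2) * p ^ n) * 1 := by ring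
    _ ≤ 4 * ((n + 1) * x ^ 2 * (1 + (n + 1) * x ^ 2) * p ^ n) * (2 * p) := by
      gcongr
      linarith
    _ ≤ _ := by linarith

lemma gaussian_tail_le {x : ℝ} (hx : 1 ≤ x) {N : ℝ} (hN : 0 < N) :
    exp (-(N / 6) * x ^ 2) ≤ 12 / N * exp (-(N / 200) * x ^ 2) := by
  have h := mul_exp_neg_le (a := 12) (u := N * x ^ 2) (by norm_num)
  have h1 : 1 ≤ x ^ 2 := by nlinarith
  have h2 : exp (-(N / 6) * x ^ 2) = exp (-(N * x ^ 2 / 12)) * exp (-(N * x ^ 2 / 12)) := by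
    rw [← exp_add]
    congr 1
    ring
  have h3 : exp (-(N * x ^ 2 / 12)) ≤ exp (-(N / 200) * x ^ 2) :=
    exp_le_exp.mpr (by nlinarith [mul_pos hN (by linarith : 0 < x ^ 2)])
  have h4 : exp (-(N * x ^ 2 / 12)) ≤ 12 / N := by
    rw [le_div_iff₀ hN]
    refine le_trans ?_ h
    have := exp_pos (-(N * x ^ 2 / 12))
    nlinarith [mul_le_mul_of_nonneg_left h1 (mul_pos hN this).le]
  rw [h2]
  exact mul_le_mul h4 h3 (exp_pos _).le (by positivity)

lemma abs_integral_gaussError_le (n : ℕ) :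
    |∫ x in (0 : ℝ)..π, gaussError x n| ≤
      1440000 / (n + 1 : ℝ) * (√(π / ((n + 1 : ℝ) / 200)) / 2) := by
  have hpos : (0 : ℝ) < (n + 1 : ℝ) / 200 := by positivity
  have h_integrable := (integrable_exp_neg_mul_sq hpos).const_mul (1440000 / (n + 1 : ℝ))
  rw [← integral_gaussian_Ioi, ← MeasureTheory.integral_const_mul,
    intervalIntegral.integral_of_le pi_pos.le, ← Real.norm_eq_abs]
  calc _ ≤ ∫ x in Set.Ioc 0 π,
        1440000 / (n + 1 : ℝ) * exp (-((n + 1 : ℝ) / 200) * x ^ 2) := by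
        refine MeasureTheory.norm_integral_le_of_norm_le h_integrable.integrableOn ?_
        refine (MeasureTheory.ae_restrict_mem measurableSet_Ioc).mono fun x hx => ?_
        exact abs_gaussError_le_gaussian (by rw [abs_of_pos hx.1]; exact hx.2) n
    _ ≤ _ := MeasureTheory.setIntegral_mono_set h_integrable.integrableOn
        (Filter.Eventually.of_forall fun x => by positivity)
        Set.Ioc_subset_Ioi_self.eventuallyLE

lemma abs_integral_gaussian_sub_le {N : ℝ} (hN : 0 < N) :
    |(∫ x in (0 : ℝ)..π, exp (-(N / 6) * x ^ 2)) - √(π / (N / 6)) / 2| ≤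
      12 / N * (√(π / (N / 200)) / 2) := by
  have h6 := integrable_exp_neg_mul_sq (show 0 < N / 6 by positivity)
  have h200 := (integrable_exp_neg_mul_sq (show 0 < N / 200 by positivity)).const_mul (12 / N)
  rw [← integral_gaussian_Ioi, ← integral_gaussian_Ioi, ← MeasureTheory.integral_const_mul,
    intervalIntegral.integral_of_le pi_pos.le, ← Set.Ioc_union_Ioi_eq_Ioi pi_pos.le,
    MeasureTheory.setIntegral_union Set.Ioc_disjoint_Ioi_same measurableSet_Ioi
      h6.integrableOn h6.integrableOn, sub_add_cancel_left, abs_neg, ← Real.norm_eq_abs,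
    Set.Ioc_union_Ioi_eq_Ioi pi_pos.le]
  calc _ ≤ ∫ x in Set.Ioi π, 12 / N * exp (-(N / 200) * x ^ 2) := by
        refine MeasureTheory.norm_integral_le_of_norm_le h200.integrableOn ?_
        refine (MeasureTheory.ae_restrict_mem measurableSet_Ioi).mono fun x hx => ?_
        rw [Real.norm_eq_abs, abs_of_pos (exp_pos _)]
        exact gaussian_tail_le (by linarith [pi_gt_three, Set.mem_Ioi.mp hx]) hN
    _ ≤ _ := MeasureTheory.setIntegral_mono_set h200.integrableOn
        (Filter.Eventually.of_forall fun x => by positivity)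
        (Set.Ioi_subset_Ioi pi_pos.le).eventuallyLE

lemma integral_cosSum_eq (n : ℕ) :
    ∫ x in (0 : ℝ)..π, cosSum n x = 2 ^ (n + 1) * ((∫ x in (0 : ℝ)..π, gaussError x n) +
      (∫ x in (0 : ℝ)..π, exp (-((n + 1 : ℝ) / 6) * x ^ 2)) / 2) := by
  have hc := continuous_cosSum n
  rw [← intervalIntegral.integral_div, ← intervalIntegral.integral_add,
    ← intervalIntegral.integral_const_mul]
  · refine intervalIntegral.integral_congr fun x _ => ?_
    have : exp (-((n + 1 : ℝ) / 6) * x ^ 2) = exp (-(x ^ 2 / 6)) ^ (n + 1) := by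
      rw [← exp_nat_mul]
      congr 1
      push_cast
      ring
    simp only [gaussError, this]
    field_simp
    ring
  · unfold gaussError
    exact Continuous.intervalIntegrable (by fun_prop) _ _
  · exact Continuous.intervalIntegrable (by fun_prop) _ _

end ThreeEqual

open ThreeEqual

theorem stmt_18 :
    ∃ C : ℝ, 0 < C ∧ ∀ N : ℕ, 1 ≤ N →
      |(((Finset.Ico (2 ^ (N - 1)) (2 ^ N)).filter
            (fun n => (Nat.digits 2 (3 * n)).sum = (Nat.digits 2 n).sum)).card : ℝ) -
          (Real.sqrt 6 / (4 * Real.sqrt π)) * 2 ^ N * (N : ℝ) ^ (-(1 / 2 : ℝ))| ≤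
        C * 2 ^ N * (N : ℝ) ^ (-(3 / 2 : ℝ)) := by
  refine ⟨1440012 * (√(π * 200) / 2) / π, by positivity, fun N hN => ?_⟩
  obtain ⟨n, rfl⟩ : ∃ n, N = n + 1 := ⟨N - 1, by lia⟩
  rw [Nat.add_sub_cancel, card_filter_Ico]
  have hI := integral_cosSum n
  rw [integral_cosSum_eq] at hI
  have h1 := abs_integral_gaussError_le n
  have hM : (0 : ℝ) < n + 1 := by positivity
  have h2 := abs_integral_gaussian_sub_le hM
  push_cast
  generalize (n + 1 : ℝ) = M at *
  have hs : 0 < √M := sqrt_pos.mpr hM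
  have hr1 : M ^ (-(1 / 2 : ℝ)) = 1 / √M := by
    rw [rpow_neg hM.le, ← sqrt_eq_rpow, one_div]
  have hr3 : M ^ (-(3 / 2 : ℝ)) = 1 / M * (1 / √M) := by
    rw [show -(3 / 2 : ℝ) = -1 + -(1 / 2) by norm_num, rpow_add hM, hr1, rpow_neg_one, one_div M]
  have hq : √(π / (M / 200)) = √(π * 200) * (1 / √M) := by
    rw [show π / (M / 200) = π * 200 / M by field_simp, sqrt_div (by positivity)]
    ring
  have hq6 : √(π / (M / 6)) = √π * √6 * (1 / √M) := by
    rw [show π / (M / 6) = π * 6 / M by field_simp, sqrt_div (by positivity), sqrt_mul pi_pos.le]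
    ring
  have hpi : √π * √π = π := mul_self_sqrt pi_pos.le
  have hspi : 0 < √π := sqrt_pos.mpr pi_pos
  rw [hr1, hr3]
  rw [hq] at h1 h2
  rw [hq6] at h2
  set I := ∫ x in (0 : ℝ)..π, gaussError x n
  set J := ∫ x in (0 : ℝ)..π, exp (-(M / 6) * x ^ 2)
  set T := digitDiffSum 1 (fun d => if d = 0 then 1 else 0) n
  have hT : T = 2 ^ (n + 1) * (I + J / 2) / π := by
    rw [hI]
    field_simp
  have key : T - √6 / (4 * √π) * 2 ^ (n + 1) * (1 / √M) =
      2 ^ (n + 1) / π * (I + (J - √π * √6 * (1 / √M) / 2) / 2) := by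
    have : √6 / (4 * √π) = √π * √6 / 4 / π := by
      nth_rewrite 3 [← hpi]
      field_simp
    rw [hT, this]
    ring
  rw [key, abs_mul, abs_of_pos (by positivity)]
  have hb : |I + (J - √π * √6 * (1 / √M) / 2) / 2| ≤
      1440012 / M * (√(π * 200) * (1 / √M) / 2) := by
    refine (abs_add_le _ _).trans ?_
    rw [abs_div, abs_two]
    have h0 := abs_nonneg (J - √π * √6 * (1 / √M) / 2)
    have : 1440012 / M * (√(π * 200) * (1 / √M) / 2) =
      1440000 / M * (√(π * 200) * (1 / √M) / 2) + 12 / M * (√(π * 200) * (1 / √M) / 2) := by ring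
    linarith
  refine (mul_le_mul_of_nonneg_left hb (by positivity)).trans_eq ?_
  ring
end

section
/- Let E₅(N) denote the number of integers n with 2^{N−1} ≤ n < 2^N such that s_2(5n) = s_2(n) (the 5-equal numbers with N bits), and let c = √5/(4√π). Then E₅(N) = 2^N·(c·N^{−1/2} + O(N^{−3/2})); that is, there exists a constant C > 0 such that for all integers N ≥ 1, |E₅(N) − c·2^N·N^{−1/2}| ≤ C·2^N·N^{−3/2}. -/
open Finset Real

/-- The difference between the binary digit sums of `5 * n + c` and of `n`. -/
def digitSumDiff (c n : ℕ) : ℤ :=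
  ((Nat.digits 2 (5 * n + c)).sum : ℤ) - (Nat.digits 2 n).sum

lemma sum_digits_two_mul_add (n d : ℕ) (hd : d < 2) :
    (Nat.digits 2 (2 * n + d)).sum = (Nat.digits 2 n).sum + d := by
  rcases Nat.eq_zero_or_pos (2 * n + d) with h | h
  · obtain ⟨rfl, rfl⟩ : n = 0 ∧ d = 0 := by omega
    simp
  · rw [Nat.digits_def' (by norm_num) h, List.sum_cons, show (2 * n + d) % 2 = d by omega,
      show (2 * n + d) / 2 = n by omega, add_comm]

lemma digitSumDiff_two_mul (c n : ℕ) :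
    digitSumDiff c (2 * n) = digitSumDiff (c / 2) n + (c % 2 : ℕ) := by
  have h1 := sum_digits_two_mul_add (5 * n + c / 2) (c % 2) (by omega)
  have h2 := sum_digits_two_mul_add n 0 (by omega)
  rw [show 2 * (5 * n + c / 2) + c % 2 = 5 * (2 * n) + c by omega] at h1
  simp only [add_zero] at h2
  simp only [digitSumDiff, h1, h2]
  push_cast
  ring

lemma digitSumDiff_two_mul_add_one (c n : ℕ) :
    digitSumDiff c (2 * n + 1) = digitSumDiff ((5 + c) / 2) n + ((5 + c) % 2 : ℕ) - 1 := by
  have h1 := sum_digits_two_mul_add (5 * n + (5 + c) / 2) ((5 + c) % 2) (by omega)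
  have h2 := sum_digits_two_mul_add n 1 (by omega)
  rw [show 2 * (5 * n + (5 + c) / 2) + (5 + c) % 2 = 5 * (2 * n + 1) + c by omega] at h1
  simp only [digitSumDiff, h1, h2]
  push_cast
  ring

lemma sum_range_two_mul {M : Type*} [AddCommMonoid M] (f : ℕ → M) (m : ℕ) :
    ∑ n ∈ range (2 * m), f n = ∑ n ∈ range m, (f (2 * n) + f (2 * n + 1)) := by
  induction m with
  | zero => simp
  | succ m ih =>
    rw [show 2 * (m + 1) = 2 * m + 1 + 1 by ring, sum_range_succ, sum_range_succ, ih,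
      sum_range_succ, add_assoc]

/-- The exponential sum of `digitSumDiff c` over the integers with at most `N` bits. -/
noncomputable def digitExpSum (θ : ℝ) (c N : ℕ) : ℂ :=
  ∑ n ∈ range (2 ^ N), Complex.exp (θ * Complex.I) ^ digitSumDiff c n

lemma digitExpSum_succ (θ : ℝ) (c N : ℕ) :
    digitExpSum θ c (N + 1) =
      Complex.exp (θ * Complex.I) ^ (c % 2) * digitExpSum θ (c / 2) N +
      Complex.exp (θ * Complex.I) ^ (((5 + c) % 2 : ℕ) - 1 : ℤ) *
        digitExpSum θ ((5 + c) / 2) N := by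
  have h0 := Complex.exp_ne_zero (θ * Complex.I)
  simp only [digitExpSum, pow_succ', sum_range_two_mul, sum_add_distrib, mul_sum]
  congr 1
  · refine sum_congr rfl fun n _ => ?_
    rw [digitSumDiff_two_mul, zpow_add₀ h0, zpow_natCast, mul_comm]
  · refine sum_congr rfl fun n _ => ?_
    rw [digitSumDiff_two_mul_add_one, add_sub_assoc, zpow_add₀ h0, mul_comm]

section Recurrence

variable (θ : ℝ) (N : ℕ)

lemma digitExpSum_zero_succ :
    digitExpSum θ 0 (N + 1) = digitExpSum θ 0 N + digitExpSum θ 2 N := by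
  simp [digitExpSum_succ]

lemma digitExpSum_one_succ :
    digitExpSum θ 1 (N + 1) = Complex.exp (θ * Complex.I) * digitExpSum θ 0 N +
      (Complex.exp (θ * Complex.I))⁻¹ * digitExpSum θ 3 N := by
  simp [digitExpSum_succ]

lemma digitExpSum_two_succ :
    digitExpSum θ 2 (N + 1) = digitExpSum θ 1 N + digitExpSum θ 3 N := by
  simp [digitExpSum_succ]

lemma digitExpSum_three_succ :
    digitExpSum θ 3 (N + 1) = Complex.exp (θ * Complex.I) * digitExpSum θ 1 N +
      (Complex.exp (θ * Complex.I))⁻¹ * digitExpSum θ 4 N := by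
  simp [digitExpSum_succ]

lemma digitExpSum_four_succ :
    digitExpSum θ 4 (N + 1) = digitExpSum θ 2 N + digitExpSum θ 4 N := by
  simp [digitExpSum_succ]

lemma exp_mul_I_add_inv :
    Complex.exp (θ * Complex.I) + (Complex.exp (θ * Complex.I))⁻¹ =
      ((2 * cos θ : ℝ) : ℂ) := by
  rw [← Complex.exp_neg]
  push_cast
  rw [Complex.two_cos]
  simp

lemma digitExpSum_two_add_four :
    digitExpSum θ 2 (N + 4) = digitExpSum θ 2 (N + 3) + digitExpSum θ 2 (N + 2) +
      ((2 * cos θ - 1 : ℝ) : ℂ) * digitExpSum θ 2 (N + 1) +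
      (((2 * cos θ) ^ 2 - 2 : ℝ) : ℂ) * digitExpSum θ 2 N := by
  have h0 := Complex.exp_ne_zero (θ * Complex.I)
  have h := exp_mul_I_add_inv θ
  rw [Complex.ofReal_sub, Complex.ofReal_sub, Complex.ofReal_pow, ← h]
  simp only [digitExpSum_zero_succ, digitExpSum_one_succ, digitExpSum_two_succ,
    digitExpSum_three_succ, digitExpSum_four_succ, Complex.ofReal_one, Complex.ofReal_ofNat]
  generalize Complex.exp (θ * Complex.I) = z at *
  field_simp
  ring

/-- The real part of `digitExpSum θ 2 N`. -/
noncomputable def digitCosSum : ℝ := (digitExpSum θ 2 N).re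

lemma digitCosSum_add_four :
    digitCosSum θ (N + 4) = digitCosSum θ (N + 3) + digitCosSum θ (N + 2) +
      (2 * cos θ - 1) * digitCosSum θ (N + 1) + ((2 * cos θ) ^ 2 - 2) * digitCosSum θ N := by
  simp only [digitCosSum]
  rw [digitExpSum_two_add_four]
  simp only [Complex.add_re, Complex.re_ofReal_mul]

lemma digitCosSum_eq_sum :
    digitCosSum θ N = ∑ n ∈ range (2 ^ N), cos (digitSumDiff 2 n * θ) := by
  simp only [digitCosSum, digitExpSum, Complex.re_sum]
  refine sum_congr rfl fun n _ => ?_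
  rw [← Complex.exp_int_mul, ← mul_assoc]
  exact_mod_cast Complex.exp_ofReal_mul_I_re (digitSumDiff 2 n * θ)

lemma digitCosSum_zero : digitCosSum θ 0 = cos θ := by
  simp [digitCosSum_eq_sum, digitSumDiff]

lemma digitCosSum_one : digitCosSum θ 1 = cos θ + cos (2 * θ) := by
  simp [digitCosSum_eq_sum, digitSumDiff, sum_range_succ, one_add_one_eq_two]

lemma digitCosSum_two : digitCosSum θ 2 = 1 + 2 * cos θ + cos (2 * θ) := by
  simp [digitCosSum_eq_sum, digitSumDiff, sum_range_succ]
  ring_nf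

lemma digitCosSum_three : digitCosSum θ 3 = 2 + 3 * cos θ + 3 * cos (2 * θ) := by
  simp [digitCosSum_eq_sum, digitSumDiff, sum_range_succ]
  ring_nf

end Recurrence

lemma exists_dominant_root {s : ℝ} (hs0 : 0 ≤ s) (hs : s ≤ 1 / 10) :
    ∃ x : ℝ, |x - (2 - 2 / 5 * s)| ≤ s ^ 2 ∧
      x ^ 4 - x ^ 3 - x ^ 2 + (s - 1) * x + 2 - (2 - s) ^ 2 = 0 := by
  have hle : 2 - 2 / 5 * s - s ^ 2 ≤ 2 - 2 / 5 * s + s ^ 2 := by nlinarith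
  have hc : ContinuousOn
      (fun x : ℝ => x ^ 4 - x ^ 3 - x ^ 2 + (s - 1) * x + 2 - (2 - s) ^ 2)
      (Set.Icc (2 - 2 / 5 * s - s ^ 2) (2 - 2 / 5 * s + s ^ 2)) := by fun_prop
  obtain ⟨x, hx, hx0⟩ := intermediate_value_Icc hle hc (show (0 : ℝ) ∈ _ by
    constructor
    · have : 0 ≤ 1 / 10 - s := by linarith
      nlinarith [pow_nonneg hs0 2, pow_nonneg hs0 3, pow_nonneg hs0 4, pow_nonneg hs0 5,
        pow_nonneg hs0 6,
        mul_nonneg (pow_nonneg hs0 2) this, mul_nonneg (pow_nonneg hs0 3) this,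
        mul_nonneg (pow_nonneg hs0 4) this, mul_nonneg (pow_nonneg hs0 5) this,
        mul_nonneg (pow_nonneg hs0 6) this, mul_nonneg (pow_nonneg hs0 7) this]
    · have : 0 ≤ 1 / 10 - s := by linarith
      nlinarith [pow_nonneg hs0 2, pow_nonneg hs0 3, pow_nonneg hs0 4, pow_nonneg hs0 5,
        pow_nonneg hs0 6,
        mul_nonneg (pow_nonneg hs0 2) this, mul_nonneg (pow_nonneg hs0 3) this,
        mul_nonneg (pow_nonneg hs0 4) this, mul_nonneg (pow_nonneg hs0 5) this,
        mul_nonneg (pow_nonneg hs0 6) this, mul_nonneg (pow_nonneg hs0 7) this])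
  exact ⟨x, abs_le.2 ⟨by linarith [hx.1], by linarith [hx.2]⟩, hx0⟩

lemma abs_le_of_cubic_recurrence {b c d K : ℝ} {e : ℕ → ℝ} (hb : b ∈ Set.Icc 0 1)
    (hc : c ∈ Set.Icc 0 1) (hd : d ∈ Set.Icc 0 1)
    (he : ∀ n, e (n + 3) + b * e (n + 2) + c * e (n + 1) + d * e n = 0)
    (h0 : |e 0| ≤ K) (h1 : |e 1| ≤ K) (h2 : |e 2| ≤ K) (n : ℕ) :
    |e n| ≤ K * (19 / 10) ^ n := by
  have hK : 0 ≤ K := (abs_nonneg _).trans h0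
  suffices h : |e n| ≤ K * (19 / 10) ^ n ∧ |e (n + 1)| ≤ K * (19 / 10) ^ (n + 1) ∧
      |e (n + 2)| ≤ K * (19 / 10) ^ (n + 2) from h.1
  induction n with
  | zero =>
    norm_num
    exact ⟨h0, by linarith, by linarith⟩
  | succ n ih =>
    obtain ⟨i0, i1, i2⟩ := ih
    refine ⟨i1, i2, ?_⟩
    have key : ∀ t ∈ Set.Icc (0 : ℝ) 1, ∀ u : ℝ, |t * u| ≤ |u| := fun t ht u => by
      rw [abs_mul, abs_of_nonneg ht.1]
      exact mul_le_of_le_one_left (abs_nonneg u) ht.2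
    have hn : e (n + 1 + 2) = -(b * e (n + 2) + c * e (n + 1) + d * e n) := by
      linarith [he n]
    have hX : 0 ≤ K * (19 / 10) ^ n := by positivity
    rw [hn, abs_neg]
    calc _ ≤ |b * e (n + 2)| + |c * e (n + 1)| + |d * e n| := abs_add_three _ _ _
      _ ≤ |e (n + 2)| + |e (n + 1)| + |e n| := by
        exact add_le_add_three (key b hb _) (key c hc _) (key d hd _)
      _ ≤ K * (19 / 10) ^ (n + 2) + K * (19 / 10) ^ (n + 1) + K * (19 / 10) ^ n := by gcongr
      _ ≤ K * (19 / 10) ^ (n + 1 + 2) := by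
        rw [show n + 1 + 2 = n + 3 by ring]
        simp only [pow_add]
        nlinarith

lemma abs_sub_mul_le_of_near {u v A X : ℝ} (hu : |u - v| ≤ 1) (hv : |v| ≤ 4)
    (hA : |A - 1| ≤ 1) (hX : |X| ≤ 4) : |u - A * X| ≤ 20 := by
  have h1 : |A * X| ≤ 2 * 4 := by
    rw [abs_mul]
    gcongr
    linarith [abs_sub_abs_le_abs_sub A 1, abs_one (α := ℝ)]
  linarith [abs_sub_abs_le_abs_sub u v, abs_sub u (A * X)]

lemma exists_dominant_root_quotient {s : ℝ} (hs0 : 0 ≤ s) (hs : s ≤ 1 / 10) :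
    ∃ x b c d : ℝ, |x - (2 - 2 / 5 * s)| ≤ s ^ 2 ∧ 2 - s / 2 ≤ x ∧ x ≤ 2 ∧
      b ∈ Set.Icc 0 1 ∧ 9 / 10 ≤ b ∧ c ∈ Set.Icc 0 1 ∧ d ∈ Set.Icc 0 1 ∧
      1 + b = x ∧ 1 + c = x * b ∧ 1 - s + d = x * c ∧ (2 - s) ^ 2 - 2 = x * d := by
  obtain ⟨x, hx, hP⟩ := exists_dominant_root hs0 hs
  obtain ⟨hx1, hx2⟩ := abs_le.1 hx
  have hxl : 2 - s / 2 ≤ x := by nlinarith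
  have hxu : x ≤ 2 - 3 / 10 * s := by nlinarith
  obtain ⟨t, hxt⟩ : ∃ t, x = 2 - t := ⟨2 - x, by ring⟩
  have ht0 : 3 / 10 * s ≤ t := by linarith
  have ht1 : t ≤ s / 2 := by linarith
  obtain ⟨b, hb⟩ : ∃ b, b = x - 1 := ⟨_, rfl⟩
  obtain ⟨c, hc⟩ : ∃ c, c = x * b - 1 := ⟨_, rfl⟩
  obtain ⟨d, hd⟩ : ∃ d, d = x * c - 1 + s := ⟨_, rfl⟩
  have hbm : b ∈ Set.Icc (1 - s) 1 := by constructor <;> linarith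
  have hcm : c ∈ Set.Icc (1 - 2 * s) 1 := by
    constructor <;> simp only [hc, hb, hxt] <;> nlinarith
  have hdm : d ∈ Set.Icc (1 - 3 * s) 1 := by
    constructor <;> simp only [hd, hc, hb, hxt] <;>
      nlinarith [mul_nonneg hs0 hs0,
        mul_nonneg (hs0.trans (by linarith : s ≤ 10 / 3 * t)) hs0,
        pow_nonneg (hs0.trans (by linarith : s ≤ 10 / 3 * t)) 3]
  have hb0 : b ∈ Set.Icc 0 1 := ⟨by linarith [hbm.1], hbm.2⟩
  have hc0 : c ∈ Set.Icc 0 1 := ⟨by linarith [hcm.1], hcm.2⟩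
  have hd0 : d ∈ Set.Icc 0 1 := ⟨by linarith [hdm.1], hdm.2⟩
  have hxd : x * d = (2 - s) ^ 2 - 2 := by
    rw [hd, hc, hb]
    linear_combination hP
  exact ⟨x, b, c, d, hx, hxl, by linarith, hb0, by linarith [hbm.1], hc0, hd0, by linarith,
    by linarith, by linarith, hxd.symm⟩

lemma exists_approx_of_recurrence {s : ℝ} (hs0 : 0 ≤ s) (hs : s ≤ 1 / 10) {r : ℕ → ℝ}
    (hr : ∀ n, r (n + 4) = r (n + 3) + r (n + 2) + (1 - s) * r (n + 1) +
      ((2 - s) ^ 2 - 2) * r n)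
    (h0 : |r 0 - 1| ≤ 10 * s) (h1 : |r 1 - 2| ≤ 10 * s) (h2 : |r 2 - 4| ≤ 10 * s)
    (h3 : |r 3 - 8| ≤ 10 * s) :
    ∃ x A : ℝ, |x - (2 - 2 / 5 * s)| ≤ s ^ 2 ∧ |A - 1| ≤ 5 * s ∧
      ∀ n, |r n - A * x ^ n| ≤ 20 * (19 / 10) ^ n := by
  obtain ⟨x, b, c, d, hx, hxl, hx2, hb0, hb9, hc0, hd0, hb, hc, hd, hxd⟩ :=
    exists_dominant_root_quotient hs0 hs
  obtain ⟨t, hxt⟩ : ∃ t, x = 2 - t := ⟨2 - x, by ring⟩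
  have ht : 0 ≤ t := by linarith
  have ht1 : t ≤ s / 2 := by linarith
  have hx19 : 39 / 20 ≤ x := by linarith
  have hx0 : 0 ≤ x := by linarith
  obtain ⟨Q, hQdef⟩ : ∃ Q, Q = x ^ 3 + b * x ^ 2 + c * x + d := ⟨_, rfl⟩
  have hQ : 10 ≤ Q := by
    have e1 : (39 / 20 : ℝ) ^ 3 ≤ x ^ 3 := by gcongr
    have e2 : (9 / 10 : ℝ) * (39 / 20) ^ 2 ≤ b * x ^ 2 := by
      gcongr
    have e3 : 0 ≤ c * x := mul_nonneg hc0.1 (by linarith)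
    linarith [hd0.1]
  obtain ⟨h, hh⟩ : ∃ h, h = r 3 + b * r 2 + c * r 1 + d * r 0 := ⟨_, rfl⟩
  have key : ∀ n, r (n + 3) + b * r (n + 2) + c * r (n + 1) + d * r n = h * x ^ n := by
    intro n
    induction n with
    | zero => simp [hh]
    | succ n ih =>
      rw [pow_succ, ← mul_assoc, ← ih, hr n]
      linear_combination r (n + 3) * hb + r (n + 2) * hc + r (n + 1) * hd + r n * hxd
  have hscale : ∀ u ∈ Set.Icc (0 : ℝ) 1, ∀ v : ℝ, |u * v| ≤ |v| := fun u hu v => by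
    rw [abs_mul, abs_of_nonneg hu.1]
    exact mul_le_of_le_one_left (abs_nonneg v) hu.2
  have hhQ : |h - Q| ≤ 49 * s := by
    have w3 : |8 - x ^ 3| ≤ 6 * s := by
      rw [show 8 - x ^ 3 = t * (4 + 2 * x + x ^ 2) by rw [hxt]; ring,
        abs_of_nonneg (by positivity)]
      calc t * (4 + 2 * x + x ^ 2) ≤ s / 2 * (4 + 2 * 2 + 2 ^ 2) := by gcongr
        _ = 6 * s := by ring
    have w2 : |4 - x ^ 2| ≤ 2 * s := by
      rw [show 4 - x ^ 2 = t * (2 + x) by rw [hxt]; ring, abs_of_nonneg (by positivity)]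
      calc t * (2 + x) ≤ s / 2 * (2 + 2) := by gcongr
        _ = 2 * s := by ring
    have w1 : |2 - x| ≤ s := by
      rw [abs_le]; constructor <;> linarith
    have y3 : |r 3 - x ^ 3| ≤ 16 * s := by linarith [abs_sub_le (r 3) 8 (x ^ 3)]
    have y2 : |r 2 - x ^ 2| ≤ 12 * s := by linarith [abs_sub_le (r 2) 4 (x ^ 2)]
    have y1 : |r 1 - x| ≤ 11 * s := by linarith [abs_sub_le (r 1) 2 x]
    have h3 := abs_add_three (r 3 - x ^ 3) (b * (r 2 - x ^ 2)) (c * (r 1 - x))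
    have h4 := abs_add_le (r 3 - x ^ 3 + b * (r 2 - x ^ 2) + c * (r 1 - x)) (d * (r 0 - 1))
    rw [show h - Q = (r 3 - x ^ 3) + b * (r 2 - x ^ 2) + c * (r 1 - x) + d * (r 0 - 1) by
      rw [hh, hQdef]; ring]
    linarith [hscale b hb0 (r 2 - x ^ 2), hscale c hc0 (r 1 - x), hscale d hd0 (r 0 - 1)]
  have hA : |h / Q - 1| ≤ 5 * s := by
    rw [div_sub_one (by linarith), abs_div, abs_of_pos (by linarith : 0 < Q),
      div_le_iff₀ (by linarith)]
    nlinarith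
  refine ⟨x, h / Q, hx, hA, abs_le_of_cubic_recurrence hb0 hc0 hd0 (fun n => ?_) ?_ ?_ ?_⟩
  · have hQ0 : Q ≠ 0 := by linarith
    have h1 : h / Q * Q = h := div_mul_cancel₀ h hQ0
    simp only [pow_add]
    linear_combination key n - x ^ n * h1 + h / Q * x ^ n * hQdef
  · exact abs_sub_mul_le_of_near (by linarith) (by norm_num) (by linarith) (by norm_num)
  · exact abs_sub_mul_le_of_near (by linarith) (by norm_num) (by linarith)
      (by rw [pow_one, abs_of_nonneg hx0]; linarith)
  · exact abs_sub_mul_le_of_near (by linarith) (by norm_num) (by linarith)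
      (by rw [abs_of_nonneg (by positivity)]; nlinarith)

lemma norm_one_add_exp_mul_I_le (θ : ℝ) :
    ‖1 + Complex.exp (θ * Complex.I)‖ ≤ 2 - (2 - 2 * cos θ) / 4 := by
  have h : ‖1 + Complex.exp (θ * Complex.I)‖ ^ 2 = 2 + 2 * cos θ := by
    rw [Complex.sq_norm, Complex.normSq_apply]
    simp only [Complex.add_re, Complex.add_im, Complex.one_re, Complex.one_im,
      Complex.exp_ofReal_mul_I_re, Complex.exp_ofReal_mul_I_im]
    nlinarith [sin_sq_add_cos_sq θ]
  refine (pow_le_pow_iff_left₀ (norm_nonneg _) (by linarith [neg_one_le_cos θ]) two_ne_zero).1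
    (h.trans_le ?_)
  nlinarith [sq_nonneg (1 - cos θ)]

lemma norm_digitExpSum_add_five_le {θ M : ℝ} {N : ℕ}
    (h : ∀ c < 5, ‖digitExpSum θ c N‖ ≤ M) (c : ℕ) (hc : c < 5) :
    ‖digitExpSum θ c (N + 5)‖ ≤ (32 - (2 - 2 * cos θ) / 4) * M := by
  have hz : ‖Complex.exp (θ * Complex.I)‖ = 1 := Complex.norm_exp_ofReal_mul_I θ
  have hw : ‖(Complex.exp (θ * Complex.I))⁻¹‖ = 1 := by rw [norm_inv, hz, inv_one]
  have hzw := Complex.exp_ne_zero (θ * Complex.I)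
  have hs : 0 ≤ 2 - 2 * cos θ := by linarith [cos_le_one θ]
  have hη := norm_one_add_exp_mul_I_le θ
  have s0 := fun N => digitExpSum_zero_succ θ N
  have s1 := fun N => digitExpSum_one_succ θ N
  have s2 := fun N => digitExpSum_two_succ θ N
  have s3 := fun N => digitExpSum_three_succ θ N
  have s4 := fun N => digitExpSum_four_succ θ N
  generalize Complex.exp (θ * Complex.I) = z at *
  generalize 2 - 2 * cos θ = s at *
  have hM : 0 ≤ M := (norm_nonneg _).trans (h 0 (by norm_num))
  have bound : ∀ u v a b : ℂ, ∀ A B : ℝ, ‖u‖ ≤ 1 → ‖v‖ ≤ 1 → ‖a‖ ≤ A → ‖b‖ ≤ B →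
      ‖u * a + v * b‖ ≤ A + B := fun u v a b A B hu hv ha hb => by
    refine (norm_add_le _ _).trans (add_le_add ?_ ?_)
    · rw [norm_mul]
      exact (mul_le_of_le_one_left (norm_nonneg _) hu).trans ha
    · rw [norm_mul]
      exact (mul_le_of_le_one_left (norm_nonneg _) hv).trans hb
  have n1 : ‖(1 : ℂ)‖ ≤ 1 := norm_one.le
  have step : ∀ (n : ℕ) (K : ℝ), (∀ c < 5, ‖digitExpSum θ c n‖ ≤ K) →
      ∀ c < 5, ‖digitExpSum θ c (n + 1)‖ ≤ 2 * K := by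
    intro n K hn c hc
    rw [two_mul]
    interval_cases c
    · rw [s0]; simpa using bound 1 1 _ _ _ _ n1 n1 (hn 0 (by simp)) (hn 2 (by simp))
    · rw [s1]; exact bound _ _ _ _ _ _ hz.le hw.le (hn 0 (by simp)) (hn 3 (by simp))
    · rw [s2]; simpa using bound 1 1 _ _ _ _ n1 n1 (hn 1 (by simp)) (hn 3 (by simp))
    · rw [s3]; exact bound _ _ _ _ _ _ hz.le hw.le (hn 1 (by simp)) (hn 4 (by simp))
    · rw [s4]; simpa using bound 1 1 _ _ _ _ n1 n1 (hn 2 (by simp)) (hn 4 (by simp))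
  have h3 := step _ _ (step _ _ (step _ _ h))
  have h4 := step _ _ h3
  have two3 : ∀ (n : ℕ) (K : ℝ), (∀ c < 5, ‖digitExpSum θ c n‖ ≤ K) →
      ‖digitExpSum θ 2 (n + 3)‖ ≤ (8 - s / 4) * K := by
    intro n K hn
    have e : digitExpSum θ 2 (n + 3) = z * ((1 + z) * digitExpSum θ 0 n) +
        (z * digitExpSum θ 2 n + z⁻¹ * digitExpSum θ 2 n) +
        (digitExpSum θ 1 n + digitExpSum θ 3 n) +
        z⁻¹ * (z⁻¹ * digitExpSum θ 4 n + 1 * digitExpSum θ 4 n) := by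
      simp only [s0, s1, s2, s3, s4]
      field_simp
      ring
    have b1 : ‖z * ((1 + z) * digitExpSum θ 0 n)‖ ≤ (2 - s / 4) * K := by
      rw [norm_mul, norm_mul, hz, one_mul]
      exact mul_le_mul hη (hn 0 (by simp)) (norm_nonneg _) ((norm_nonneg _).trans hη)
    have b2 := bound _ _ _ _ _ _ hz.le hw.le (hn 2 (by simp)) (hn 2 (by simp))
    have b3 := (norm_add_le (digitExpSum θ 1 n) (digitExpSum θ 3 n)).trans
      (add_le_add (hn 1 (by simp)) (hn 3 (by simp)))
    have b4 : ‖z⁻¹ * (z⁻¹ * digitExpSum θ 4 n + 1 * digitExpSum θ 4 n)‖ ≤ K + K := by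
      rw [norm_mul, hw, one_mul]
      exact bound _ _ _ _ _ _ hw.le n1 (hn 4 (by simp)) (hn 4 (by simp))
    rw [e]
    refine (norm_add_le _ _).trans ((add_le_add (norm_add₃_le.trans
      (add_le_add_three b1 b2 b3)) b4).trans ?_)
    linarith
  have two3M := two3 N M h
  have zero4 : ‖digitExpSum θ 0 (N + 4)‖ ≤ (16 - s / 4) * M := by
    rw [s0]
    linarith [norm_add_le (digitExpSum θ 0 (N + 3)) (digitExpSum θ 2 (N + 3)),
      h3 0 (by simp)]
  have four4 : ‖digitExpSum θ 4 (N + 4)‖ ≤ (16 - s / 4) * M := by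
    rw [s4]
    linarith [norm_add_le (digitExpSum θ 2 (N + 3)) (digitExpSum θ 4 (N + 3)),
      h3 4 (by simp)]
  have three4 := h4 3 (by simp)
  have hsM : 0 ≤ s * M := mul_nonneg hs hM
  interval_cases c
  · rw [s0]
    linarith [norm_add_le (digitExpSum θ 0 (N + 4)) (digitExpSum θ 2 (N + 4)),
      h4 2 (by simp)]
  · rw [s1]
    linarith [bound _ _ _ _ _ _ hz.le hw.le zero4 three4]
  · linarith [two3 (N + 2) _ (step _ _ (step _ _ h))]
  · rw [s3]
    linarith [bound _ _ _ _ _ _ hz.le hw.le (h4 1 (by simp)) four4]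
  · rw [s4]
    linarith [norm_add_le (digitExpSum θ 2 (N + 4)) (digitExpSum θ 4 (N + 4)),
      h4 2 (by simp)]

lemma norm_digitExpSum_le_of_cos_le {θ : ℝ} (hθ : cos θ ≤ 24 / 25) (N : ℕ) :
    ∀ c < 5, ‖digitExpSum θ c N‖ ≤ 2 * (2 * (1 - 1 / 8000)) ^ N := by
  induction N using Nat.strong_induction_on with
  | _ N ih =>
    intro c hc
    rcases lt_or_ge N 5 with hN | hN
    · have h1 : ‖digitExpSum θ c N‖ ≤ 2 ^ N := by
        refine (norm_sum_le _ _).trans ?_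
        simp [norm_zpow, Complex.norm_exp_ofReal_mul_I]
      refine h1.trans ?_
      interval_cases N <;> norm_num
    · obtain ⟨m, rfl⟩ := Nat.exists_eq_add_of_le' hN
      refine (norm_digitExpSum_add_five_le (ih m (by omega)) c hc).trans ?_
      rw [show (2 : ℝ) * (2 * (1 - 1 / 8000)) ^ (m + 5) =
        (2 * (1 - 1 / 8000)) ^ 5 * (2 * (2 * (1 - 1 / 8000)) ^ m) by rw [pow_add]; ring]
      gcongr
      norm_num
      linarith

lemma abs_pow_sub_exp_pow_le {T u : ℝ} (hT : 0 ≤ T) (hu0 : 0 ≤ u)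
    (hu : u ≤ exp (-(T / 10))) (hT1 : T ≤ 1)
    (huT : |u - exp (-(T / 5))| ≤ T ^ 2) (N : ℕ) :
    |u ^ N - exp (-(T / 5)) ^ N| ≤ 40 * T * exp (-(N * T / 20)) := by
  rcases Nat.eq_zero_or_pos N with rfl | hN
  · simp; positivity
  set E := exp (-(N * T / 20)) with hE
  have hmax : max |u| |exp (-(T / 5))| ≤ exp (-(T / 10)) := by
    rw [abs_of_nonneg hu0, abs_of_pos (exp_pos _)]
    exact max_le hu (exp_le_exp.2 (by linarith))
  have hq : exp (-(T / 10)) ^ (N - 1) ≤ 2 * E ^ 2 := by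
    have h1 : exp (-(T / 10)) ^ (N - 1) = exp (T / 10) * E ^ 2 := by
      rw [← exp_nat_mul, hE, ← exp_nat_mul, ← exp_add, Nat.cast_pred hN]
      congr 1
      push_cast
      ring
    have h2 : exp (T / 10) ≤ 2 := by
      have := (abs_le.1 (abs_exp_sub_one_sub_id_le (x := T / 10)
        (by rw [abs_of_nonneg (by linarith)]; linarith))).2
      nlinarith
    rw [h1]
    gcongr
  have hNT : N * T * E ≤ 20 := by
    have h1 := add_one_le_exp (N * T / 20)
    have h2 : E * exp (N * T / 20) = 1 := by rw [hE, ← exp_add, neg_add_cancel, exp_zero]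
    have h3 : 0 < E := exp_pos _
    nlinarith
  calc |u ^ N - exp (-(T / 5)) ^ N|
      ≤ |u - exp (-(T / 5))| * N * max |u| |exp (-(T / 5))| ^ (N - 1) := abs_pow_sub_pow_le ..
    _ ≤ T ^ 2 * N * (2 * E ^ 2) := by
      gcongr
      exact (pow_le_pow_left₀ (le_max_of_le_left (abs_nonneg u)) hmax _).trans hq
    _ = 2 * T * E * (N * T * E) := by ring
    _ ≤ 2 * T * E * 20 := by gcongr
    _ = 40 * T * E := by ring

lemma sub_sq_le_two_sub_two_cos {θ : ℝ} (h : |θ| ≤ 1) :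
    θ ^ 2 - 5 / 48 * (θ ^ 2) ^ 2 ≤ 2 - 2 * cos θ := by
  have := (abs_le.1 (cos_bound h)).2
  rw [show |θ| ^ 4 = (θ ^ 2) ^ 2 by rw [← sq_abs θ]; ring] at this
  linarith

lemma abs_digitCosSum_sub_le_of_small {θ : ℝ} (h0 : 0 ≤ θ) (hθ : θ ≤ 3 / 10) (N : ℕ) :
    |digitCosSum θ N - 2 ^ N * exp (-(N / 5 : ℝ) * θ ^ 2)| ≤
      2 ^ N * (45 * (θ ^ 2 * exp (-(N / 20 : ℝ) * θ ^ 2)) + 20 * (1 - 1 / 8000) ^ N) := by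
  obtain ⟨T, hT⟩ : ∃ T, T = θ ^ 2 := ⟨_, rfl⟩
  obtain ⟨s, hs⟩ : ∃ s, s = 2 - 2 * cos θ := ⟨_, rfl⟩
  have hT0 : 0 ≤ T := hT ▸ sq_nonneg θ
  have hT1 : T ≤ 9 / 100 := by rw [hT]; nlinarith
  have hsl : T - 5 / 48 * T ^ 2 ≤ s := by
    rw [hs, hT]
    exact sub_sq_le_two_sub_two_cos (by rw [abs_of_nonneg h0]; linarith)
  have hsu : s ≤ T := by
    rw [hs, hT]
    linarith [one_sub_sq_div_two_le_cos (x := θ)]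
  have hs0 : 0 ≤ s := by nlinarith
  have hc : cos θ = 1 - s / 2 := by linarith
  have hc2 : cos (2 * θ) = 2 * (1 - s / 2) ^ 2 - 1 := by rw [cos_two_mul, hc]
  obtain ⟨x, A, hx, hA, hr⟩ := exists_approx_of_recurrence (r := digitCosSum θ) hs0
    (by linarith)
    (fun n => by rw [digitCosSum_add_four, hc]; ring)
    (by rw [digitCosSum_zero, hc, abs_le]; constructor <;> linarith)
    (by rw [digitCosSum_one, hc2, hc, abs_le]; constructor <;> nlinarith)
    (by rw [digitCosSum_two, hc2, hc, abs_le]; constructor <;> nlinarith)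
    (by rw [digitCosSum_three, hc2, hc, abs_le]; constructor <;> nlinarith)
  obtain ⟨u, rfl⟩ : ∃ u, x = 2 * u := ⟨x / 2, by ring⟩
  obtain ⟨hx1, hx2⟩ := abs_le.1 hx
  have hsT : s ^ 2 ≤ T ^ 2 := by gcongr
  have hu0 : 0 ≤ u := by nlinarith
  have hu : u ≤ exp (-(T / 10)) := by
    have := add_one_le_exp (-(T / 10))
    nlinarith
  have huT : |u - exp (-(T / 5))| ≤ T ^ 2 := by
    obtain ⟨e1, e2⟩ := abs_le.1 (abs_exp_sub_one_sub_id_le (x := -(T / 5))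
      (by rw [abs_neg, abs_of_nonneg (by linarith)]; linarith))
    rw [abs_le]
    constructor <;> nlinarith
  have hpow := abs_pow_sub_exp_pow_le hT0 hu0 hu (by linarith) huT N
  have hexp : exp (-(T / 5)) ^ N = exp (-(N / 5 : ℝ) * T) := by
    rw [← exp_nat_mul]; congr 1; ring
  have hexp' : exp (-(N * T / 20)) = exp (-(N / 20 : ℝ) * T) := by
    congr 1; ring
  have huN : u ^ N ≤ exp (-(N / 20 : ℝ) * T) := by
    refine (pow_le_pow_left₀ hu0 hu N).trans ?_
    rw [← exp_nat_mul, exp_le_exp]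
    have : 0 ≤ N * T := by positivity
    linarith
  rw [hexp, hexp'] at hpow
  rw [← hT]
  set E := exp (-(N / 20 : ℝ) * T)
  have h19 : 20 * (19 / 10 : ℝ) ^ N ≤ 2 ^ N * (20 * (1 - 1 / 8000) ^ N) := by
    rw [mul_left_comm, ← mul_pow]
    gcongr
    norm_num
  have hAu : |(A - 1) * u ^ N| ≤ 5 * T * E := by
    rw [abs_mul, abs_of_nonneg (pow_nonneg hu0 N)]
    exact mul_le_mul (hA.trans (by linarith)) huN (by positivity) (by positivity)
  calc _ = |(digitCosSum θ N - A * (2 * u) ^ N) + 2 ^ N * ((A - 1) * u ^ N +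
          (u ^ N - exp (-(N / 5 : ℝ) * T)))| := by
        congr 1
        rw [mul_pow]
        ring
    _ ≤ 20 * (19 / 10) ^ N + 2 ^ N * (5 * T * E + 40 * T * E) := by
        refine (abs_add_le _ _).trans (add_le_add (hr N) ?_)
        rw [abs_mul, abs_of_pos (by positivity : (0 : ℝ) < 2 ^ N)]
        gcongr
        exact (abs_add_le _ _).trans (add_le_add hAu hpow)
    _ ≤ _ := by linarith

lemma abs_digitCosSum_sub_le {θ : ℝ} (h0 : 0 ≤ θ) (hπ : θ ≤ π) (N : ℕ) :
    |digitCosSum θ N - 2 ^ N * exp (-(N / 5 : ℝ) * θ ^ 2)| ≤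
      2 ^ N * (45 * (θ ^ 2 * exp (-(N / 20 : ℝ) * θ ^ 2)) + 20 * (1 - 1 / 8000) ^ N) := by
  rcases le_or_gt θ (3 / 10) with h | h
  · exact abs_digitCosSum_sub_le_of_small h0 h N
  have hcos : cos θ ≤ 24 / 25 := by
    have h1 := cos_le_cos_of_nonneg_of_le_pi (by norm_num : (0 : ℝ) ≤ 3 / 10) hπ h.le
    have h2 := sub_sq_le_two_sub_two_cos (θ := 3 / 10) (by norm_num)
    linarith
  have hr : |digitCosSum θ N| ≤ 2 ^ N * (2 * (1 - 1 / 8000) ^ N) := by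
    refine (Complex.abs_re_le_norm _).trans
      ((norm_digitExpSum_le_of_cos_le hcos N 2 (by norm_num)).trans_eq ?_)
    rw [mul_pow]
    ring
  have he : exp (-(N / 5 : ℝ) * θ ^ 2) ≤ (1 - 1 / 8000) ^ N := by
    have h1 : exp (-(1 / 5) * θ ^ 2) ≤ 1 - 1 / 8000 := by
      have h2 : exp (-(1 / 5) * θ ^ 2) ≤ exp (-(18 / 1000)) := exp_le_exp.2 (by nlinarith)
      have h3 := (abs_le.1 (abs_exp_sub_one_sub_id_le (x := -(18 / 1000)) (by norm_num))).2
      linarith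
    rw [show -(N / 5 : ℝ) * θ ^ 2 = N * (-(1 / 5) * θ ^ 2) by ring, exp_nat_mul]
    gcongr
  have hE : 0 ≤ (2 : ℝ) ^ N * (45 * (θ ^ 2 * exp (-(N / 20 : ℝ) * θ ^ 2))) := by positivity
  have hp : 0 ≤ (2 : ℝ) ^ N * (1 - 1 / 8000) ^ N := by
    have : (0 : ℝ) ≤ 1 - 1 / 8000 := by norm_num
    positivity
  have he' := mul_le_mul_of_nonneg_left he (by positivity : (0 : ℝ) ≤ 2 ^ N)
  have he'' : |2 ^ N * exp (-(N / 5 : ℝ) * θ ^ 2)| ≤ 2 ^ N * (1 - 1 / 8000) ^ N := by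
    rwa [abs_of_nonneg (by positivity)]
  linarith [abs_sub (digitCosSum θ N) (2 ^ N * exp (-(N / 5 : ℝ) * θ ^ 2))]

lemma card_filter_digits_eq (N : ℕ) :
    ((Finset.Ico (2 ^ N) (2 ^ (N + 1))).filter
      (fun n => (Nat.digits 2 (5 * n)).sum = (Nat.digits 2 n).sum)).card =
    ((range (2 ^ N)).filter (fun n => digitSumDiff 2 n = 0)).card := by
  have hiff : ∀ n, (Nat.digits 2 (5 * n)).sum = (Nat.digits 2 n).sum ↔
      digitSumDiff 0 n = 0 := fun n => by
    simp only [digitSumDiff, add_zero]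
    omega
  simp only [hiff, card_filter]
  refine Nat.add_left_cancel ((sum_range_add_sum_Ico _
    (Nat.pow_le_pow_right two_pos (Nat.le_succ N))).trans ?_)
  rw [pow_succ', sum_range_two_mul, sum_add_distrib]
  simp [digitSumDiff_two_mul, digitSumDiff_two_mul_add_one]

lemma continuous_digitCosSum (N : ℕ) : Continuous fun θ => digitCosSum θ N := by
  simp only [digitCosSum_eq_sum]
  fun_prop

lemma integral_digitCosSum (N : ℕ) :
    ∫ θ in (0 : ℝ)..π, digitCosSum θ N =
      π * ((range (2 ^ N)).filter (fun n => digitSumDiff 2 n = 0)).card := by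
  simp only [digitCosSum_eq_sum]
  rw [intervalIntegral.integral_finsetSum
    fun n _ => (by fun_prop : Continuous _).intervalIntegrable _ _]
  simp only [integral_cos_int_mul]
  rw [← sum_filter, sum_const, nsmul_eq_mul, mul_comm]

lemma integrableOn_sq_mul_exp_neg_mul_sq {b : ℝ} (hb : 0 < b) :
    MeasureTheory.IntegrableOn (fun x : ℝ => x ^ 2 * exp (-b * x ^ 2)) (Set.Ioi 0) := by
  have := integrableOn_rpow_mul_exp_neg_mul_sq hb (s := 2) (by norm_num)
  simpa using this

lemma integral_sq_mul_exp_neg_mul_sq {b : ℝ} (hb : 0 < b) :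
    ∫ x in Set.Ioi (0 : ℝ), x ^ 2 * exp (-b * x ^ 2) =
      b ^ (-(3 / 2) : ℝ) * (1 / 2 * Gamma (3 / 2)) := by
  have := integral_rpow_mul_exp_neg_mul_rpow (p := 2) (q := 2) (by norm_num) (by norm_num) hb
  norm_num at this ⊢
  rw [this]
  ring

lemma exists_pow_le_mul_rpow_neg {ρ : ℝ} (h0 : 0 ≤ ρ) (h1 : ρ < 1) :
    ∃ K : ℝ, 0 < K ∧ ∀ N : ℕ, 1 ≤ N → ρ ^ N ≤ K * (N : ℝ) ^ (-(3 / 2 : ℝ)) := by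
  have ht := tendsto_pow_const_mul_const_pow_of_abs_lt_one 2
    (show |ρ| < 1 by rwa [abs_of_nonneg h0])
  obtain ⟨K, hK⟩ := ht.bddAbove_range
  refine ⟨max K 1, by positivity, fun N hN => ?_⟩
  have hN1 : (1 : ℝ) ≤ N := by exact_mod_cast hN
  have hN0 : (0 : ℝ) < N := by linarith
  have hKN : (N : ℝ) ^ 2 * ρ ^ N ≤ K := hK ⟨N, rfl⟩
  calc ρ ^ N = (N ^ 2 * ρ ^ N) * (N : ℝ) ^ (-2 : ℝ) := by
        rw [rpow_neg hN0.le, rpow_two]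
        field_simp
    _ ≤ max K 1 * (N : ℝ) ^ (-(3 / 2 : ℝ)) := by
        gcongr
        · exact hKN.trans (le_max_left _ _)
        · norm_num

lemma abs_integral_digitCosSum_sub_le {N : ℕ} (hN : 1 ≤ N) :
    |(∫ θ in (0 : ℝ)..π, digitCosSum θ N) - 2 ^ N * (√(π / (N / 5)) / 2)| ≤
      2 ^ N * (46 * (∫ x in Set.Ioi (0 : ℝ), x ^ 2 * exp (-(N / 20 : ℝ) * x ^ 2)) +
        20 * π * (1 - 1 / 8000) ^ N) := by
  have hN0 : (0 : ℝ) < N := by exact_mod_cast hN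
  have hJ := integrableOn_sq_mul_exp_neg_mul_sq (b := N / 20) (by positivity)
  have hG : MeasureTheory.Integrable (fun x : ℝ => exp (-(N / 5 : ℝ) * x ^ 2)) :=
    integrable_exp_neg_mul_sq (by positivity)
  have hJnn : ∀ x : ℝ, 0 ≤ x ^ 2 * exp (-(N / 20 : ℝ) * x ^ 2) := fun x => by positivity
  rw [← integral_gaussian_Ioi, ← intervalIntegral.integral_interval_add_Ioi (b := π)
    hG.integrableOn hG.integrableOn]
  set J := ∫ x in Set.Ioi (0 : ℝ), x ^ 2 * exp (-(N / 20 : ℝ) * x ^ 2) with hJdef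
  have htail0 : 0 ≤ ∫ x in Set.Ioi π, exp (-(N / 5 : ℝ) * x ^ 2) :=
    MeasureTheory.integral_nonneg fun x => (exp_pos _).le
  have htail : ∫ x in Set.Ioi π, exp (-(N / 5 : ℝ) * x ^ 2) ≤ J := by
    have hsub : Set.Ioi π ⊆ Set.Ioi (0 : ℝ) := Set.Ioi_subset_Ioi pi_pos.le
    calc _ ≤ ∫ x in Set.Ioi π, x ^ 2 * exp (-(N / 20 : ℝ) * x ^ 2) := by
          refine MeasureTheory.setIntegral_mono_on hG.integrableOn (hJ.mono_set hsub)
            measurableSet_Ioi fun x hx => ?_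
          have hx1 : 1 ≤ x ^ 2 := by
            have : 1 ≤ x := by linarith [pi_gt_three, Set.mem_Ioi.1 hx]
            nlinarith
          have : exp (-(N / 5 : ℝ) * x ^ 2) ≤ exp (-(N / 20 : ℝ) * x ^ 2) :=
            exp_le_exp.2 (by nlinarith)
          nlinarith [exp_pos (-(N / 20 : ℝ) * x ^ 2)]
      _ ≤ J := MeasureTheory.setIntegral_mono_set hJ
          (Filter.Eventually.of_forall hJnn) hsub.eventuallyLE
  have hrI := (continuous_digitCosSum N).intervalIntegrable (μ := MeasureTheory.volume) 0 π
  have hgI : IntervalIntegrable (fun x : ℝ => 2 ^ N * exp (-(N / 5 : ℝ) * x ^ 2))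
    MeasureTheory.volume 0 π := (by fun_prop : Continuous _).intervalIntegrable _ _
  have hbI : IntervalIntegrable (fun x : ℝ => 45 * (x ^ 2 * exp (-(N / 20 : ℝ) * x ^ 2)))
    MeasureTheory.volume 0 π := (by fun_prop : Continuous _).intervalIntegrable _ _
  have hmain : |(∫ θ in (0 : ℝ)..π, digitCosSum θ N) -
      2 ^ N * ∫ θ in (0 : ℝ)..π, exp (-(N / 5 : ℝ) * θ ^ 2)| ≤
      2 ^ N * (45 * J + 20 * π * (1 - 1 / 8000) ^ N) := by
    rw [← intervalIntegral.integral_const_mul, ← intervalIntegral.integral_sub hrI hgI]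
    have hnorm := intervalIntegral.norm_integral_le_of_norm_le pi_pos.le
      (μ := MeasureTheory.volume) (f := fun θ => digitCosSum θ N -
        2 ^ N * exp (-(N / 5 : ℝ) * θ ^ 2))
      (g := fun θ => 2 ^ N * (45 * (θ ^ 2 * exp (-(N / 20 : ℝ) * θ ^ 2)) +
        20 * (1 - 1 / 8000) ^ N))
      (Filter.Eventually.of_forall fun θ hθ => abs_digitCosSum_sub_le hθ.1.le hθ.2 N)
      ((by fun_prop : Continuous _).intervalIntegrable _ _)
    rw [Real.norm_eq_abs] at hnorm
    refine hnorm.trans ?_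
    rw [intervalIntegral.integral_const_mul, intervalIntegral.integral_add hbI
      (by simp), intervalIntegral.integral_const_mul,
      intervalIntegral.integral_const, smul_eq_mul, sub_zero]
    have hle : ∫ x in (0 : ℝ)..π, x ^ 2 * exp (-(N / 20 : ℝ) * x ^ 2) ≤ J := by
      rw [intervalIntegral.integral_of_le pi_pos.le]
      exact MeasureTheory.setIntegral_mono_set hJ
          (Filter.Eventually.of_forall hJnn) Set.Ioc_subset_Ioi_self.eventuallyLE
    rw [mul_left_comm π 20, mul_assoc 20 π]
    gcongr
  have h2 : (0 : ℝ) < 2 ^ N := by positivity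
  have t1 := mul_le_mul_of_nonneg_left htail h2.le
  have t0 := mul_nonneg h2.le htail0
  rw [abs_le] at hmain ⊢
  constructor <;> nlinarith [hmain.1, hmain.2]

lemma sqrt_pi_div_div_five {x : ℝ} (hx : 0 < x) :
    √(π / (x / 5)) / 2 = π * (√5 / (4 * √π) * 2 * x ^ (-(1 / 2) : ℝ)) := by
  rw [rpow_neg hx.le, ← sqrt_eq_rpow, show π / (x / 5) = π * 5 / x by field_simp,
    sqrt_div (by positivity), sqrt_mul pi_pos.le]
  have h := mul_self_sqrt pi_pos.le
  have h1 : √π ≠ 0 := by positivity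
  have h2 : √x ≠ 0 := by positivity
  field_simp
  nlinarith

lemma abs_rpow_neg_half_sub_le {x : ℝ} (hx : 1 ≤ x) :
    |x ^ (-(1 / 2) : ℝ) - (x + 1) ^ (-(1 / 2) : ℝ)| ≤ x ^ (-(3 / 2) : ℝ) := by
  have hx0 : 0 < x := by linarith
  have h32 : x ^ (-(3 / 2) : ℝ) = (x * √x)⁻¹ := by
    rw [rpow_neg hx0.le, show (3 / 2 : ℝ) = 1 + 1 / 2 by norm_num, rpow_add hx0, rpow_one,
      sqrt_eq_rpow]
  rw [h32, rpow_neg hx0.le, rpow_neg (by linarith), ← sqrt_eq_rpow, ← sqrt_eq_rpow]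
  have ha : 0 < √x := sqrt_pos.2 hx0
  have hab : √x ≤ √(x + 1) := sqrt_le_sqrt (by linarith)
  have hb : 0 < √(x + 1) := ha.trans_le hab
  have ha2 := sq_sqrt hx0.le
  have hb2 := sq_sqrt (by linarith : 0 ≤ x + 1)
  rw [abs_of_nonneg (sub_nonneg.2 (inv_anti₀ ha hab))]
  generalize √x = a at *
  generalize √(x + 1) = b at *
  rw [← ha2, inv_sub_inv ha.ne' hb.ne', inv_eq_one_div,
    div_le_div_iff₀ (by positivity) (by positivity)]
  have h1 : (b - a) * (b + a) = 1 := by linarith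
  have h2 : (b - a) * a ≤ 1 := by nlinarith
  have h3 : a ^ 2 * ((b - a) * a) ≤ a * b * 1 := by
    gcongr
    nlinarith
  linarith

lemma rpow_neg_three_half_le {x : ℝ} (hx : 1 ≤ x) :
    x ^ (-(3 / 2) : ℝ) ≤ 4 * (x + 1) ^ (-(3 / 2) : ℝ) := by
  have h1 : (2 * x) ^ (-(3 / 2) : ℝ) ≤ (x + 1) ^ (-(3 / 2) : ℝ) :=
    rpow_le_rpow_of_nonpos (by linarith) (by linarith) (by norm_num)
  rw [mul_rpow (by norm_num) (by linarith)] at h1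
  have h2 : (2 : ℝ) ^ (-2 : ℝ) ≤ 2 ^ (-(3 / 2) : ℝ) :=
    rpow_le_rpow_of_exponent_le (by norm_num) (by norm_num)
  rw [rpow_neg (by norm_num), rpow_two] at h2
  have h3 : 0 < x ^ (-(3 / 2) : ℝ) := by positivity
  nlinarith

lemma exists_card_filter_bound : ∃ K : ℝ, 0 < K ∧ ∀ N : ℕ, 1 ≤ N →
    |(((range (2 ^ N)).filter (fun n => digitSumDiff 2 n = 0)).card : ℝ) -
      √5 / (4 * √π) * 2 ^ (N + 1) * (N : ℝ) ^ (-(1 / 2 : ℝ))| ≤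
      K * 2 ^ N * (N : ℝ) ^ (-(3 / 2 : ℝ)) := by
  obtain ⟨K, hK0, hK⟩ := exists_pow_le_mul_rpow_neg (ρ := 1 - 1 / 8000) (by norm_num)
    (by norm_num)
  have hΓ : 0 < Gamma (3 / 2) := Gamma_pos_of_pos (by norm_num)
  refine ⟨(46 * ((1 / 20 : ℝ) ^ (-(3 / 2) : ℝ) * (1 / 2 * Gamma (3 / 2))) + 20 * π * K) / π,
    by positivity, fun N hN => ?_⟩
  have hN0 : (0 : ℝ) < N := by exact_mod_cast hN
  have h := abs_integral_digitCosSum_sub_le hN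
  rw [integral_digitCosSum, sqrt_pi_div_div_five hN0,
    integral_sq_mul_exp_neg_mul_sq (by positivity), div_eq_mul_one_div (N : ℝ) 20,
    mul_rpow hN0.le (by norm_num)] at h
  have hKN := mul_le_mul_of_nonneg_left (hK N hN) (by positivity : 0 ≤ 20 * π)
  rw [← mul_le_mul_iff_right₀ pi_pos]
  calc _ = |π * (((range (2 ^ N)).filter (fun n => digitSumDiff 2 n = 0)).card : ℝ) -
          2 ^ N * (π * (√5 / (4 * √π) * 2 * (N : ℝ) ^ (-(1 / 2) : ℝ)))| := by
        rw [← abs_of_pos pi_pos, ← abs_mul, abs_of_pos pi_pos]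
        congr 1
        ring
    _ ≤ _ := h
    _ ≤ 2 ^ N * (46 * (N ^ (-(3 / 2) : ℝ) * (1 / 20) ^ (-(3 / 2) : ℝ) *
          (1 / 2 * Gamma (3 / 2))) + 20 * π * (K * N ^ (-(3 / 2) : ℝ))) := by gcongr
    _ = _ := by
      field_simp

theorem stmt_19 :
    ∃ C : ℝ, 0 < C ∧ ∀ N : ℕ, 1 ≤ N →
      |(((Finset.Ico (2 ^ (N - 1)) (2 ^ N)).filter
            (fun n => (Nat.digits 2 (5 * n)).sum = (Nat.digits 2 n).sum)).card : ℝ) -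
          (Real.sqrt 5 / (4 * Real.sqrt π)) * 2 ^ N * (N : ℝ) ^ (-(1 / 2 : ℝ))| ≤
        C * 2 ^ N * (N : ℝ) ^ (-(3 / 2 : ℝ)) := by
  obtain ⟨K, hK0, hK⟩ := exists_card_filter_bound
  have hc0 : 0 < √5 / (4 * √π) := by positivity
  generalize √5 / (4 * √π) = c at *
  refine ⟨1 + 4 * (K + c), by positivity, fun N hN => ?_⟩
  obtain ⟨M, rfl⟩ := Nat.exists_eq_add_of_le' hN
  rw [Nat.add_sub_cancel, card_filter_digits_eq]
  rcases Nat.eq_zero_or_pos M with rfl | hM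
  · have h1 : (((range (2 ^ 0)).filter (fun n => digitSumDiff 2 n = 0)).card : ℝ) ≤ 1 := by
      exact_mod_cast (card_filter_le _ _).trans (by simp)
    have h0 : (0 : ℝ) ≤ ((range (2 ^ 0)).filter (fun n => digitSumDiff 2 n = 0)).card :=
      Nat.cast_nonneg _
    generalize (((range (2 ^ 0)).filter (fun n => digitSumDiff 2 n = 0)).card : ℝ) = E at *
    rw [abs_le]
    norm_num
    constructor <;> linarith
  · have hM1 : (1 : ℝ) ≤ M := by exact_mod_cast hM
    have h1 := hK M hM
    have h2 := abs_rpow_neg_half_sub_le hM1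
    have h3 := rpow_neg_three_half_le hM1
    push_cast
    set E : ℝ := (((range (2 ^ M)).filter (fun n => digitSumDiff 2 n = 0)).card : ℝ)
    have hp : 0 < ((M : ℝ) + 1) ^ (-(3 / 2) : ℝ) := by positivity
    calc _ = |(E - c * 2 ^ (M + 1) * (M : ℝ) ^ (-(1 / 2) : ℝ)) + c * 2 ^ (M + 1) *
            ((M : ℝ) ^ (-(1 / 2) : ℝ) - (M + 1) ^ (-(1 / 2) : ℝ))| := by
          congr 1
          ring
      _ ≤ K * 2 ^ M * (M : ℝ) ^ (-(3 / 2) : ℝ) +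
            c * 2 ^ (M + 1) * (M : ℝ) ^ (-(3 / 2) : ℝ) := by
          refine (abs_add_le _ _).trans (add_le_add h1 ?_)
          rw [abs_mul, abs_of_pos (by positivity : 0 < c * 2 ^ (M + 1))]
          gcongr
      _ ≤ K * 2 ^ (M + 1) * (M : ℝ) ^ (-(3 / 2) : ℝ) +
            c * 2 ^ (M + 1) * (M : ℝ) ^ (-(3 / 2) : ℝ) := by
          gcongr
          · norm_num
          · exact Nat.le_succ M
      _ = (K + c) * 2 ^ (M + 1) * (M : ℝ) ^ (-(3 / 2) : ℝ) := by ring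
      _ ≤ (K + c) * 2 ^ (M + 1) * (4 * (M + 1) ^ (-(3 / 2) : ℝ)) := by gcongr
      _ ≤ _ := by
          have : 0 < (2 : ℝ) ^ (M + 1) * (M + 1) ^ (-(3 / 2) : ℝ) := by positivity
          linarith
end
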